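/- Let D ⊂ ℂ^m be a bounded open Stein set with strongly pseudoconvex boundary of class C², and let g : D̄ → ℂ^k be of class C² on D̄ and holomorphic in D. Then the graph A := {(z, g(z)) : z ∈ D̄} ⊆ ℂ^m × ℂ^k has a basis of open Stein neighborhoods: for every open set U ⊆ ℂ^{m+k} with A ⊆ U there is a Stein open set Ω ⊆ ℂ^{m+k} with A ⊆ Ω ⊆ U. -/

import Mathlib

open Set Filter Complex Metric

noncomputable section

abbrev Cn (N : ℕ) := EuclideanSpace ℂ (Fin N)

/-- The Levi form of a `C²` function `ρ` at `x` in direction `v`. -/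
def LeviForm {N : ℕ} (ρ : Cn N → ℝ) (x v : Cn N) : ℝ :=
  (1 / 4) * (iteratedFDeriv ℝ 2 ρ x ![v, v] +
    iteratedFDeriv ℝ 2 ρ x ![Complex.I • v, Complex.I • v])

/-- A bounded open set `D ⊆ ℂ^m` has strongly pseudoconvex boundary of class `C^ℓ`. -/
def SPSCBoundary {m : ℕ} (ℓ : ℕ) (D : Set (Cn m)) : Prop :=
  ∃ V : Set (Cn m), IsOpen V ∧ frontier D ⊆ V ∧
    ∃ ρ : Cn m → ℝ, ContDiffOn ℝ ℓ ρ V ∧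
      D ∩ V = {z ∈ V | ρ z < 0} ∧
      (∀ x ∈ frontier D, fderiv ℝ ρ x ≠ 0) ∧
      (∀ x ∈ frontier D, ∀ v : Cn m, v ≠ 0 →
        fderiv ℝ ρ x v = 0 → fderiv ℝ ρ x (Complex.I • v) = 0 → 0 < LeviForm ρ x v)

/-- An open set `Ω` in a complex normed space is Stein (holomorphically convex). -/
def SteinOpen {E : Type*} [NormedAddCommGroup E] [NormedSpace ℂ E] (Ω : Set E) : Prop :=
  IsOpen Ω ∧ ∀ K : Set E, K ⊆ Ω → IsCompact K →
    IsCompact {z ∈ Ω | ∀ h : E → ℂ, DifferentiableOn ℂ h Ω →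
      ‖h z‖ ≤ sSup ((fun w => ‖h w‖) '' K)}

/-- `g` is of class `C^r` on `D̄` and holomorphic in `D` (several variables). -/
def ClassAm {E F : Type*} [NormedAddCommGroup E] [NormedSpace ℂ E]
    [NormedAddCommGroup F] [NormedSpace ℂ F] (r : ℕ) (D : Set E) (g : E → F) : Prop :=
  ContinuousOn g (closure D) ∧ DifferentiableOn ℂ g D ∧
  ∀ k ≤ r, ∃ G : E → ContinuousMultilinearMap ℂ (fun _ : Fin k => E) F,
    ContinuousOn G (closure D) ∧ EqOn G (iteratedFDeriv ℂ k g) D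

set_option linter.unusedSectionVars false
set_option linter.unusedSimpArgs false
open MeasureTheory Topology ContDiff ComplexConjugate

namespace SteinAux

section Wirtinger

variable {E : Type*} [NormedAddCommGroup E] [NormedSpace ℂ E]

/-- The operator `∂/∂z` in direction `e`. -/
def dz (e : E) (f : E → ℂ) (x : E) : ℂ :=
  (1 / 2) * (fderiv ℝ f x e - I * fderiv ℝ f x (I • e))

/-- The operator `∂/∂z̄` in direction `e`. -/
def dzb (e : E) (f : E → ℂ) (x : E) : ℂ :=
  (1 / 2) * (fderiv ℝ f x e + I * fderiv ℝ f x (I • e))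

/-- Four times the Levi form. -/
def levi (φ : E → ℝ) (x v : E) : ℝ :=
  fderiv ℝ (fderiv ℝ φ) x v v + fderiv ℝ (fderiv ℝ φ) x (I • v) (I • v)

lemma dz_mul (e : E) {f g : E → ℂ} {x : E} (hf : DifferentiableAt ℝ f x)
    (hg : DifferentiableAt ℝ g x) :
    dz e (fun y => f y * g y) x = dz e f x * g x + f x * dz e g x := by
  simp only [dz]
  rw [fderiv_fun_mul hf hg]
  simp
  ring

lemma dzb_mul (e : E) {f g : E → ℂ} {x : E} (hf : DifferentiableAt ℝ f x)
    (hg : DifferentiableAt ℝ g x) :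
    dzb e (fun y => f y * g y) x = dzb e f x * g x + f x * dzb e g x := by
  simp only [dzb]
  rw [fderiv_fun_mul hf hg]
  simp
  ring

lemma dz_sub (e : E) {f g : E → ℂ} {x : E} (hf : DifferentiableAt ℝ f x)
    (hg : DifferentiableAt ℝ g x) :
    dz e (fun y => f y - g y) x = dz e f x - dz e g x := by
  simp only [dz]
  rw [fderiv_fun_sub hf hg]
  simp
  ring

lemma dzb_sub (e : E) {f g : E → ℂ} {x : E} (hf : DifferentiableAt ℝ f x)
    (hg : DifferentiableAt ℝ g x) :
    dzb e (fun y => f y - g y) x = dzb e f x - dzb e g x := by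
  simp only [dzb]
  rw [fderiv_fun_sub hf hg]
  simp
  ring

lemma fderiv_conj (f : E → ℂ) (x v : E) :
    fderiv ℝ (fun y => conj (f y)) x v = conj (fderiv ℝ f x v) := by
  have h : (fun y => conj (f y)) = (conjCLE : ℂ ≃L[ℝ] ℂ) ∘ f := by
    ext y; simp
  rw [h, ContinuousLinearEquiv.comp_fderiv]
  simp

lemma conj_two' : conj (2 : ℂ) = 2 := Complex.conj_ofNat 2

lemma dz_conj (e : E) (f : E → ℂ) (x : E) :
    dz e (fun y => conj (f y)) x = conj (dzb e f x) := by
  simp only [dz, dzb, fderiv_conj]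
  simp [conj_two']
  ring

lemma dzb_conj (e : E) (f : E → ℂ) (x : E) :
    dzb e (fun y => conj (f y)) x = conj (dz e f x) := by
  simp only [dz, dzb, fderiv_conj]
  simp [conj_two']

lemma contDiff_fderiv_apply_const {F : Type*} [NormedAddCommGroup F] [NormedSpace ℝ F]
    {n k : ℕ∞ω} {f : E → F} (hf : ContDiff ℝ n f) (h : k + 1 ≤ n)
    (v : E) : ContDiff ℝ k (fun x => fderiv ℝ f x v) :=
  (hf.fderiv_right h).clm_apply contDiff_const

lemma contDiff_dz {n k : ℕ∞ω} {f : E → ℂ} (hf : ContDiff ℝ n f) (h : k + 1 ≤ n)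
    (e : E) : ContDiff ℝ k (dz e f) :=
  contDiff_const.mul ((contDiff_fderiv_apply_const hf h e).sub
    (contDiff_const.mul (contDiff_fderiv_apply_const hf h _)))

lemma contDiff_dzb {n k : ℕ∞ω} {f : E → ℂ} (hf : ContDiff ℝ n f) (h : k + 1 ≤ n)
    (e : E) : ContDiff ℝ k (dzb e f) :=
  contDiff_const.mul ((contDiff_fderiv_apply_const hf h e).add
    (contDiff_const.mul (contDiff_fderiv_apply_const hf h _)))

lemma dz_congr (e : E) {f g : E → ℂ} {x : E} (h : f =ᶠ[𝓝 x] g) : dz e f x = dz e g x := by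
  simp only [dz, h.fderiv_eq]

lemma dzb_congr (e : E) {f g : E → ℂ} {x : E} (h : f =ᶠ[𝓝 x] g) : dzb e f x = dzb e g x := by
  simp only [dzb, h.fderiv_eq]

lemma dz_zero_of_notMem (e : E) {f : E → ℂ} {x : E} (h : x ∉ tsupport f) : dz e f x = 0 := by
  simp [dz, fderiv_of_notMem_tsupport (𝕜 := ℝ) h]

lemma dzb_zero_of_notMem (e : E) {f : E → ℂ} {x : E} (h : x ∉ tsupport f) : dzb e f x = 0 := by
  simp [dzb, fderiv_of_notMem_tsupport (𝕜 := ℝ) h]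

lemma hcs_dz (e : E) {f : E → ℂ} (hf : HasCompactSupport f) : HasCompactSupport (dz e f) :=
  HasCompactSupport.intro hf fun _ hx => dz_zero_of_notMem e hx

lemma hcs_dzb (e : E) {f : E → ℂ} (hf : HasCompactSupport f) : HasCompactSupport (dzb e f) :=
  HasCompactSupport.intro hf fun _ hx => dzb_zero_of_notMem e hx

lemma fderiv_dz {f : E → ℂ} (hf : ContDiff ℝ 2 f) (e x v : E) :
    fderiv ℝ (dz e f) x v =
      (1 / 2) * (fderiv ℝ (fderiv ℝ f) x v e - I * fderiv ℝ (fderiv ℝ f) x v (I • e)) := by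
  have hd : DifferentiableAt ℝ (fderiv ℝ f) x :=
    ((hf.fderiv_right (m := 1) (by norm_num)).differentiable (by norm_num)) x
  have h1 : ∀ w : E, HasFDerivAt (fun y => fderiv ℝ f y w)
      ((ContinuousLinearMap.apply ℝ ℂ w).comp (fderiv ℝ (fderiv ℝ f) x)) x := fun w =>
    (ContinuousLinearMap.apply ℝ ℂ w).hasFDerivAt.comp x hd.hasFDerivAt
  have h2 := (((h1 e).sub ((h1 (I • e)).const_mul I)).const_mul (1 / 2)).fderiv
  have h3 : dz e f = fun y => (1 / 2) * (fderiv ℝ f y e - I * fderiv ℝ f y (I • e)) := rfl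
  rw [h3]
  erw [h2]
  simp

lemma fderiv_dzb {f : E → ℂ} (hf : ContDiff ℝ 2 f) (e x v : E) :
    fderiv ℝ (dzb e f) x v =
      (1 / 2) * (fderiv ℝ (fderiv ℝ f) x v e + I * fderiv ℝ (fderiv ℝ f) x v (I • e)) := by
  have hd : DifferentiableAt ℝ (fderiv ℝ f) x :=
    ((hf.fderiv_right (m := 1) (by norm_num)).differentiable (by norm_num)) x
  have h1 : ∀ w : E, HasFDerivAt (fun y => fderiv ℝ f y w)
      ((ContinuousLinearMap.apply ℝ ℂ w).comp (fderiv ℝ (fderiv ℝ f) x)) x := fun w =>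
    (ContinuousLinearMap.apply ℝ ℂ w).hasFDerivAt.comp x hd.hasFDerivAt
  have h2 := (((h1 e).add ((h1 (I • e)).const_mul I)).const_mul (1 / 2)).fderiv
  have h3 : dzb e f = fun y => (1 / 2) * (fderiv ℝ f y e + I * fderiv ℝ f y (I • e)) := rfl
  rw [h3]
  erw [h2]
  simp
  ring

lemma snd_symm {F : Type*} [NormedAddCommGroup F] [NormedSpace ℝ F] {f : E → F} {x : E}
    (hf : ContDiffAt ℝ 2 f x) (v w : E) :
    fderiv ℝ (fderiv ℝ f) x v w = fderiv ℝ (fderiv ℝ f) x w v :=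
  (hf.isSymmSndFDerivAt (by simp)).eq v w

lemma dz_dzb_comm {f : E → ℂ} (hf : ContDiff ℝ 2 f) (e e' x : E) :
    dz e (dzb e' f) x = dzb e' (dz e f) x := by
  have hs := fun v w => snd_symm (x := x) hf.contDiffAt v w
  rw [dz, dzb, fderiv_dz hf, fderiv_dz hf, fderiv_dzb hf, fderiv_dzb hf, hs e e', hs e (I • e'),
    hs (I • e) e', hs (I • e) (I • e')]
  ring

lemma dzb_dzb_comm {f : E → ℂ} (hf : ContDiff ℝ 2 f) (e e' x : E) :
    dzb e (dzb e' f) x = dzb e' (dzb e f) x := by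
  have hs := fun v w => snd_symm (x := x) hf.contDiffAt v w
  rw [dzb, dzb, fderiv_dzb hf, fderiv_dzb hf, fderiv_dzb hf, fderiv_dzb hf, hs e e',
    hs e (I • e'), hs (I • e) e', hs (I • e) (I • e')]
  ring

variable [FiniteDimensional ℂ E] [MeasurableSpace E] [BorelSpace E] (μ : Measure E)
  [μ.IsAddHaarMeasure]

lemma integral_fderiv_zero {f : E → ℂ} (hf : ContDiff ℝ 1 f) (hc : HasCompactSupport f) (v : E) :
    ∫ x, fderiv ℝ f x v ∂μ = 0 := by
  have hcont : Continuous (fun x => fderiv ℝ f x v) :=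
    (contDiff_fderiv_apply_const (k := 0) hf (by norm_num) v).continuous
  have hcs : HasCompactSupport (fun x => fderiv ℝ f x v) :=
    HasCompactSupport.intro hc fun x hx => by simp [fderiv_of_notMem_tsupport (𝕜 := ℝ) hx]
  have := integral_mul_fderiv_eq_neg_fderiv_mul_of_integrable (μ := μ) (f := fun _ : E => (1 : ℂ))
    (g := f) (v := v) (by simp) (by simpa using hcont.integrable_of_hasCompactSupport hcs)
    (by simpa using hf.continuous.integrable_of_hasCompactSupport hc) (by simp)
    (fun x _ => hf.differentiable (by norm_num) x)
  simpa using this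

lemma integrable_fderiv {f : E → ℂ} (hf : ContDiff ℝ 1 f) (hc : HasCompactSupport f) (v : E) :
    Integrable (fun x => fderiv ℝ f x v) μ := by
  have hcont : Continuous (fun x => fderiv ℝ f x v) :=
    (contDiff_fderiv_apply_const (k := 0) hf (by norm_num) v).continuous
  have hcs : HasCompactSupport (fun x => fderiv ℝ f x v) :=
    HasCompactSupport.intro hc fun x hx => by simp [fderiv_of_notMem_tsupport (𝕜 := ℝ) hx]
  exact hcont.integrable_of_hasCompactSupport hcs

lemma integral_dz_zero {f : E → ℂ} (hf : ContDiff ℝ 1 f) (hc : HasCompactSupport f) (e : E) :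
    ∫ x, dz e f x ∂μ = 0 := by
  simp only [dz]
  rw [integral_const_mul, integral_sub (integrable_fderiv μ hf hc _)
    ((integrable_fderiv μ hf hc _).const_mul _), integral_const_mul,
    integral_fderiv_zero μ hf hc, integral_fderiv_zero μ hf hc]
  simp

lemma integral_dzb_zero {f : E → ℂ} (hf : ContDiff ℝ 1 f) (hc : HasCompactSupport f) (e : E) :
    ∫ x, dzb e f x ∂μ = 0 := by
  simp only [dzb]
  rw [integral_const_mul, integral_add (integrable_fderiv μ hf hc _)
    ((integrable_fderiv μ hf hc _).const_mul _), integral_const_mul,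
    integral_fderiv_zero μ hf hc, integral_fderiv_zero μ hf hc]
  simp

end Wirtinger

end SteinAux

set_option linter.unusedSectionVars false
set_option linter.unusedSimpArgs false
namespace SteinAux

section Basic

variable {E : Type*} [NormedAddCommGroup E] [NormedSpace ℂ E]

/-- the weighted derivative `e^φ ∂ (e^{-φ} a)` -/
def del (φ : E → ℝ) (e : E) (a : E → ℂ) (x : E) : ℂ :=
  dz e a x - dz e (fun y => (φ y : ℂ)) x * a x

lemma dzb_ofReal (φ : E → ℝ) (e x : E) :
    dzb e (fun y => (φ y : ℂ)) x = conj (dz e (fun y => (φ y : ℂ)) x) := by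
  rw [← dzb_conj]; simp

lemma contDiff_ofReal {n : ℕ∞ω} {φ : E → ℝ} (h : ContDiff ℝ n φ) :
    ContDiff ℝ n (fun y => (φ y : ℂ)) :=
  Complex.ofRealCLM.contDiff.comp h

lemma fderiv_exp_neg {φ : E → ℝ} {x : E} (h : DifferentiableAt ℝ φ x) (v : E) :
    fderiv ℝ (fun y => ((Real.exp (-φ y) : ℝ) : ℂ)) x v =
      -fderiv ℝ (fun y => (φ y : ℂ)) x v * (Real.exp (-φ x) : ℝ) := by
  have h1 : HasFDerivAt (fun y => (φ y : ℂ)) (Complex.ofRealCLM.comp (fderiv ℝ φ x)) x :=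
    Complex.ofRealCLM.hasFDerivAt.comp x h.hasFDerivAt
  have h2 : HasFDerivAt (fun y => ((Real.exp (-φ y) : ℝ) : ℂ))
      (Complex.ofRealCLM.comp (Real.exp (-φ x) • (-fderiv ℝ φ x))) x :=
    Complex.ofRealCLM.hasFDerivAt.comp x (h.hasFDerivAt.neg.exp)
  rw [h1.fderiv, h2.fderiv]
  simp
  ring

lemma dz_exp_neg {φ : E → ℝ} {x : E} (h : DifferentiableAt ℝ φ x) (e : E) :
    dz e (fun y => ((Real.exp (-φ y) : ℝ) : ℂ)) x =
      -dz e (fun y => (φ y : ℂ)) x * (Real.exp (-φ x) : ℝ) := by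
  simp only [dz, fderiv_exp_neg h]
  ring

lemma dzb_exp_neg {φ : E → ℝ} {x : E} (h : DifferentiableAt ℝ φ x) (e : E) :
    dzb e (fun y => ((Real.exp (-φ y) : ℝ) : ℂ)) x =
      -dzb e (fun y => (φ y : ℂ)) x * (Real.exp (-φ x) : ℝ) := by
  simp only [dzb, fderiv_exp_neg h]
  ring

lemma contDiff_del {φ : E → ℝ} (hφ : ContDiff ℝ 2 φ) {a : E → ℂ} (ha : ContDiff ℝ 2 a) (e : E) :
    ContDiff ℝ 1 (del φ e a) :=
  (contDiff_dz ha (by norm_num) e).sub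
    ((contDiff_dz (contDiff_ofReal hφ) (by norm_num) e).mul (ha.of_le (by norm_num)))

lemma commutator {φ : E → ℝ} (hφ : ContDiff ℝ 2 φ) {a : E → ℂ} (ha : ContDiff ℝ 2 a)
    (e e' x : E) :
    del φ e' (dzb e a) x - dzb e (del φ e' a) x =
      dzb e (dz e' (fun y => (φ y : ℂ))) x * a x := by
  have h1 : DifferentiableAt ℝ (dz e' a) x :=
    (contDiff_dz (k := 1) ha (by norm_num) e').differentiable (by norm_num) x
  have h2 : DifferentiableAt ℝ (dz e' (fun y => (φ y : ℂ))) x :=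
    (contDiff_dz (k := 1) (contDiff_ofReal hφ) (by norm_num) e').differentiable (by norm_num) x
  have h3 : DifferentiableAt ℝ a x := ha.differentiable (by norm_num) x
  have h4 : dzb e (del φ e' a) x = dzb e (dz e' a) x -
      (dzb e (dz e' (fun y => (φ y : ℂ))) x * a x +
        dz e' (fun y => (φ y : ℂ)) x * dzb e a x) := by
    rw [← dzb_mul e h2 h3, ← dzb_sub e h1 (h2.fun_mul h3)]
    rfl
  rw [h4, del, dz_dzb_comm ha]
  ring

lemma basic_pt {φ : E → ℝ} (hφ : ContDiff ℝ 2 φ) {a c : E → ℂ} (ha : ContDiff ℝ 2 a)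
    (hc : ContDiff ℝ 2 c) (e e' x : E) :
    dz e (fun y => a y * (conj (del φ e' c y) * (Real.exp (-φ y) : ℝ))) x
      - dzb e' (fun y => a y * (conj (dzb e c y) * (Real.exp (-φ y) : ℝ))) x =
    (del φ e a x * conj (del φ e' c x) - dzb e' a x * conj (dzb e c x)
      - a x * conj (dzb e (dz e' (fun y => (φ y : ℂ))) x * c x)) * (Real.exp (-φ x) : ℝ) := by
  have hφd : DifferentiableAt ℝ φ x := hφ.differentiable (by norm_num) x
  have h1 : DifferentiableAt ℝ (fun y => conj (del φ e' c y)) x :=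
    (conjCLE : ℂ ≃L[ℝ] ℂ).differentiableAt.comp x
      ((contDiff_del hφ hc e').differentiable (by norm_num) x)
  have h2 : DifferentiableAt ℝ (fun y => ((Real.exp (-φ y) : ℝ) : ℂ)) x :=
    Complex.ofRealCLM.differentiableAt.comp x (hφd.neg.exp)
  have h3 : DifferentiableAt ℝ a x := ha.differentiable (by norm_num) x
  have h4 : DifferentiableAt ℝ (fun y => conj (dzb e c y)) x :=
    (conjCLE : ℂ ≃L[ℝ] ℂ).differentiableAt.comp x
      ((contDiff_dzb (k := 1) hc (by norm_num) e).differentiable (by norm_num) x)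
  rw [dz_mul e h3 (h1.fun_mul h2), dz_mul e h1 h2, dzb_mul e' h3 (h4.fun_mul h2), dzb_mul e' h4 h2,
    dz_conj, dzb_conj, dz_exp_neg hφd, dzb_exp_neg hφd, dzb_ofReal]
  rw [← commutator hφ hc]
  simp only [del, map_sub, map_mul]
  ring

/-- Sesquilinear form attached to a real bilinear form. -/
lemma levi_expand {N : ℕ} (B : E →L[ℝ] E →L[ℝ] ℝ) (hB : ∀ v w, B v w = B w v)
    (b : Fin N → E) (c : Fin N → ℂ) :
    ∑ j, ∑ k, c j * conj (c k) * ((B (b j) (b k) + B (I • b j) (I • b k) : ℝ) +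
      I * (B (b j) (I • b k) - B (I • b j) (b k) : ℝ)) =
    ((B (∑ j, c j • b j) (∑ j, c j • b j) +
      B (I • ∑ j, c j • b j) (I • ∑ j, c j • b j) : ℝ) : ℂ) := by
  let h : E → E → ℂ := fun v w => ((B v w + B (I • v) (I • w) : ℝ) : ℂ) +
    I * ((B v (I • w) - B (I • v) w : ℝ) : ℂ)
  have hsm : ∀ (z : ℂ) (v : E), z • v = z.re • v + z.im • (I • v) := by
    intro z v
    conv_lhs => rw [← Complex.re_add_im z]
    rw [add_smul, mul_smul, ← Complex.coe_smul, ← Complex.coe_smul]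
  have hII : ∀ v : E, I • I • v = -v := fun v => by
    rw [smul_smul, I_mul_I, neg_one_smul]
  have hl : ∀ (z : ℂ) v w, h (z • v) w = z * h v w := by
    intro z v w
    have e1 : I • z • v = z.re • (I • v) - z.im • v := by
      rw [smul_comm, hsm z (I • v), hII]; simp [sub_eq_add_neg]
    simp only [h]
    rw [e1, hsm z v]
    simp only [map_add, map_sub, add_apply, sub_apply,
      map_smul, smul_apply, smul_eq_mul]
    apply Complex.ext <;> simp <;> ring
  have hr : ∀ (z : ℂ) v w, h v (z • w) = conj z * h v w := by
    intro z v w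
    have e1 : I • z • w = z.re • (I • w) - z.im • w := by
      rw [smul_comm, hsm z (I • w), hII]; simp [sub_eq_add_neg]
    simp only [h]
    rw [e1, hsm z w]
    simp only [map_add, map_sub, map_smul, smul_eq_mul]
    apply Complex.ext <;> simp <;> ring
  have hal : ∀ v v' w, h (v + v') w = h v w + h v' w := by
    intro v v' w
    simp only [h, smul_add, map_add, add_apply]
    push_cast; ring
  have har : ∀ v w w', h v (w + w') = h v w + h v w' := by
    intro v w w'
    simp only [h, smul_add, map_add, add_apply]
    push_cast; ring
  have h0l : ∀ w, h 0 w = 0 := by intro w; simp [h]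
  have h0r : ∀ w, h w 0 = 0 := by intro w; simp [h]
  have hsl : ∀ (s : Finset (Fin N)) w, h (∑ j ∈ s, c j • b j) w = ∑ j ∈ s, c j * h (b j) w := by
    intro s w
    induction s using Finset.induction_on with
    | empty => simp [h0l]
    | insert a s ha ih => rw [Finset.sum_insert ha, Finset.sum_insert ha, hal, ih, hl]
  have hsr : ∀ (s : Finset (Fin N)) w,
      h w (∑ j ∈ s, c j • b j) = ∑ j ∈ s, conj (c j) * h w (b j) := by
    intro s w
    induction s using Finset.induction_on with
    | empty => simp [h0r]
    | insert a s ha ih => rw [Finset.sum_insert ha, Finset.sum_insert ha, har, ih, hr]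
  have key : h (∑ j, c j • b j) (∑ j, c j • b j) =
      ∑ j, ∑ k, c j * conj (c k) * h (b j) (b k) := by
    rw [hsl]
    refine Finset.sum_congr rfl fun j _ => ?_
    rw [hsr, Finset.mul_sum]
    refine Finset.sum_congr rfl fun k _ => ?_
    ring
  rw [show (∑ j, ∑ k, c j * conj (c k) * (((B (b j) (b k) + B (I • b j) (I • b k) : ℝ) : ℂ) +
      I * (B (b j) (I • b k) - B (I • b j) (b k) : ℝ))) =
      ∑ j, ∑ k, c j * conj (c k) * h (b j) (b k) from rfl, ← key]
  simp only [h]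
  rw [hB (I • ∑ j, c j • b j) (∑ j, c j • b j)]
  simp

lemma conj_dzb_dz {φ : E → ℝ} (hφ : ContDiff ℝ 2 φ) (e e' x : E) :
    conj (dzb e (dz e' (fun y => (φ y : ℂ))) x) = (1 / 4) *
    (((fderiv ℝ (fderiv ℝ φ) x e e' + fderiv ℝ (fderiv ℝ φ) x (I • e) (I • e') : ℝ) : ℂ) +
      I * ((fderiv ℝ (fderiv ℝ φ) x e (I • e') - fderiv ℝ (fderiv ℝ φ) x (I • e) e' : ℝ) : ℂ)) := by
  have hd : ∀ y, DifferentiableAt ℝ φ y := hφ.differentiable (by norm_num)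
  have hdd : DifferentiableAt ℝ (fderiv ℝ φ) x :=
    ((hφ.fderiv_right (m := 1) (by norm_num)).differentiable (by norm_num)) x
  have h1 : fderiv ℝ (fun y => (φ y : ℂ)) = fun y => Complex.ofRealCLM.comp (fderiv ℝ φ y) := by
    ext1 y
    exact (Complex.ofRealCLM.hasFDerivAt.comp y (hd y).hasFDerivAt).fderiv
  have h2 : ∀ v w, fderiv ℝ (fderiv ℝ (fun y => (φ y : ℂ))) x v w =
      ((fderiv ℝ (fderiv ℝ φ) x v w : ℝ) : ℂ) := by
    intro v w
    rw [h1]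
    have := ((ContinuousLinearMap.compL ℝ E ℝ ℂ Complex.ofRealCLM).hasFDerivAt.comp x
      hdd.hasFDerivAt).fderiv
    have h3 : (fun y => Complex.ofRealCLM.comp (fderiv ℝ φ y)) =
      (ContinuousLinearMap.compL ℝ E ℝ ℂ Complex.ofRealCLM) ∘ (fderiv ℝ φ) := rfl
    rw [h3, this]
    simp
  rw [dzb, fderiv_dz (contDiff_ofReal hφ), fderiv_dz (contDiff_ofReal hφ)]
  simp only [h2]
  simp [conj_two']
  ring_nf
  simp
  ring

lemma levi_sum {N : ℕ} {φ : E → ℝ} (hφ : ContDiff ℝ 2 φ) (b : Fin N → E) (α : Fin N → ℂ) (x : E) :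
    ∑ j, ∑ k, α j * conj (dzb (b j) (dz (b k) (fun y => (φ y : ℂ))) x * α k) =
      ((1 / 4 * levi φ x (∑ j, α j • b j) : ℝ) : ℂ) := by
  have := levi_expand (fderiv ℝ (fderiv ℝ φ) x) (fun v w => snd_symm hφ.contDiffAt v w) b α
  rw [levi, ofReal_mul, ← this, Finset.mul_sum]
  refine Finset.sum_congr rfl fun j _ => ?_
  rw [Finset.mul_sum]
  refine Finset.sum_congr rfl fun k _ => ?_
  rw [map_mul, conj_dzb_dz hφ]
  push_cast
  ring

lemma antisymm_sum {N : ℕ} (m : Fin N → Fin N → ℂ) :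
    (∑ j, ∑ k, m k j * conj (m j k)).re =
      ∑ j, ∑ k, ‖m k j‖ ^ 2 - 1 / 2 * ∑ j, ∑ k, ‖m k j - m j k‖ ^ 2 := by
  have h1 : ∀ j k, ‖m k j - m j k‖ ^ 2 =
      ‖m k j‖ ^ 2 + ‖m j k‖ ^ 2 - 2 * (m k j * conj (m j k)).re := by
    intro j k
    simp only [← Complex.normSq_eq_norm_sq]
    rw [Complex.normSq_sub]
  simp only [h1, Finset.sum_sub_distrib, Finset.sum_add_distrib, ← Finset.mul_sum,
    Complex.re_sum]
  rw [Finset.sum_comm (f := fun j k => ‖m j k‖ ^ 2)]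
  ring

variable [FiniteDimensional ℂ E] [MeasurableSpace E] [BorelSpace E] (μ : Measure E)
  [μ.IsAddHaarMeasure]

theorem basic_ineq {N : ℕ} (b : Fin N → E) {φ : E → ℝ} (hφ : ContDiff ℝ 2 φ) (α : Fin N → E → ℂ)
    (hα : ∀ j, ContDiff ℝ 2 (α j)) (hc : ∀ j, HasCompactSupport (α j)) :
    ∫ x, 1 / 4 * levi φ x (∑ j, α j x • b j) * Real.exp (-φ x) ∂μ ≤
      ∫ x, (‖∑ j, del φ (b j) (α j) x‖ ^ 2 +
        1 / 2 * ∑ j, ∑ k, ‖dzb (b k) (α j) x - dzb (b j) (α k) x‖ ^ 2) * Real.exp (-φ x) ∂μ := by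
  set K : Set E := ⋃ j, tsupport (α j) with hK
  have hKc : IsCompact K := isCompact_iUnion hc
  have hz : ∀ x, x ∉ K → ∀ j, x ∉ tsupport (α j) := by
    intro x hx j hj; exact hx (mem_iUnion.2 ⟨j, hj⟩)
  have hα0 : ∀ x, x ∉ K → ∀ j, α j x = 0 := fun x hx j => image_eq_zero_of_notMem_tsupport (hz x hx j)
  have hdel0 : ∀ x, x ∉ K → ∀ j, del φ (b j) (α j) x = 0 := fun x hx j => by
    simp [del, hα0 x hx, dz_zero_of_notMem _ (hz x hx j)]
  have hdzb0 : ∀ x, x ∉ K → ∀ j k, dzb (b k) (α j) x = 0 := fun x hx j k =>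
    dzb_zero_of_notMem _ (hz x hx j)
  have cα : ∀ j, Continuous (α j) := fun j => (hα j).continuous
  have cdel : ∀ j, Continuous (del φ (b j) (α j)) := fun j => (contDiff_del hφ (hα j) _).continuous
  have cdzb : ∀ j k, Continuous (dzb (b k) (α j)) := fun j k =>
    (contDiff_dzb (k := 1) (hα j) (by norm_num) _).continuous
  have cφ : Continuous φ := hφ.continuous
  have cφ2 : Continuous (fderiv ℝ (fderiv ℝ φ)) :=
    ((hφ.fderiv_right (m := 1) (by norm_num)).fderiv_right (m := 0) (by norm_num)).continuous
  have clevi : Continuous fun x => levi φ x (∑ j, α j x • b j) := by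
    unfold levi
    fun_prop
  have integ : ∀ f : E → ℝ, Continuous f → (∀ x, x ∉ K → f x = 0) → Integrable f μ :=
    fun f hf h0 => hf.integrable_of_hasCompactSupport (HasCompactSupport.intro hKc h0)
  -- main identity
  let X : E → ℂ := fun x => ∑ j, ∑ k, (del φ (b j) (α j) x * conj (del φ (b k) (α k) x) -
    dzb (b k) (α j) x * conj (dzb (b j) (α k) x)
      - α j x * conj (dzb (b j) (dz (b k) (fun y => (φ y : ℂ))) x * α k x)) * (Real.exp (-φ x) : ℝ)
  have cdexp : ContDiff ℝ 1 (fun y => ((Real.exp (-φ y) : ℝ) : ℂ)) :=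
    contDiff_ofReal ((hφ.of_le (by norm_num)).neg.exp)
  have cd1 : ∀ j k, ContDiff ℝ 1
      (fun y => α j y * (conj (del φ (b k) (α k) y) * (Real.exp (-φ y) : ℝ))) := fun j k =>
    ((hα j).of_le (by norm_num)).mul
      (((conjCLE : ℂ ≃L[ℝ] ℂ).contDiff.comp (contDiff_del hφ (hα k) _)).mul cdexp)
  have cd2 : ∀ j k, ContDiff ℝ 1
      (fun y => α j y * (conj (dzb (b j) (α k) y) * (Real.exp (-φ y) : ℝ))) := fun j k =>
    ((hα j).of_le (by norm_num)).mul
      (((conjCLE : ℂ ≃L[ℝ] ℂ).contDiff.comp (contDiff_dzb (hα k) (by norm_num) _)).mul cdexp)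
  have hs1 : ∀ j k, HasCompactSupport
      (fun y => α j y * (conj (del φ (b k) (α k) y) * (Real.exp (-φ y) : ℝ))) := fun j k =>
    (hc j).mul_right
  have hs2 : ∀ j k, HasCompactSupport
      (fun y => α j y * (conj (dzb (b j) (α k) y) * (Real.exp (-φ y) : ℝ))) := fun j k =>
    (hc j).mul_right
  have i1 : ∀ j k, Integrable (dz (b j)
      (fun y => α j y * (conj (del φ (b k) (α k) y) * (Real.exp (-φ y) : ℝ)))) μ := fun j k =>
    (contDiff_dz (k := 0) (cd1 j k) (by norm_num) _).continuous.integrable_of_hasCompactSupport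
      (hcs_dz _ (hs1 j k))
  have i2 : ∀ j k, Integrable (dzb (b k)
      (fun y => α j y * (conj (dzb (b j) (α k) y) * (Real.exp (-φ y) : ℝ)))) μ := fun j k =>
    (contDiff_dzb (k := 0) (cd2 j k) (by norm_num) _).continuous.integrable_of_hasCompactSupport
      (hcs_dzb _ (hs2 j k))
  have hX : ∫ x, X x ∂μ = 0 ∧ Integrable X μ := by
    have e1 : X = fun x => ∑ j, ∑ k, (dz (b j)
      (fun y => α j y * (conj (del φ (b k) (α k) y) * (Real.exp (-φ y) : ℝ))) x -
      dzb (b k) (fun y => α j y * (conj (dzb (b j) (α k) y) * (Real.exp (-φ y) : ℝ))) x) := by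
      ext1 x
      refine Finset.sum_congr rfl fun j _ => Finset.sum_congr rfl fun k _ => ?_
      rw [basic_pt hφ (hα j) (hα k)]
    have i12 : ∀ j k, Integrable (fun x => dz (b j)
      (fun y => α j y * (conj (del φ (b k) (α k) y) * (Real.exp (-φ y) : ℝ))) x -
      dzb (b k) (fun y => α j y * (conj (dzb (b j) (α k) y) * (Real.exp (-φ y) : ℝ))) x) μ :=
      fun j k => (i1 j k).sub (i2 j k)
    rw [e1]
    constructor
    · rw [integral_finsetSum _ fun j _ => integrable_finsetSum _ fun k _ => i12 j k]
      refine Finset.sum_eq_zero fun j _ => ?_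
      rw [integral_finsetSum _ fun k _ => i12 j k]
      refine Finset.sum_eq_zero fun k _ => ?_
      rw [integral_sub (i1 j k) (i2 j k), integral_dz_zero μ (cd1 j k) (hs1 j k),
        integral_dzb_zero μ (cd2 j k) (hs2 j k), sub_zero]
    · exact integrable_finsetSum _ fun j _ => integrable_finsetSum _ fun k _ =>
        i12 j k
  have hXre : ∀ x, (X x).re = (‖∑ j, del φ (b j) (α j) x‖ ^ 2 -
      (∑ j, ∑ k, ‖dzb (b k) (α j) x‖ ^ 2 -
        1 / 2 * ∑ j, ∑ k, ‖dzb (b k) (α j) x - dzb (b j) (α k) x‖ ^ 2) -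
      1 / 4 * levi φ x (∑ j, α j x • b j)) * Real.exp (-φ x) := by
    intro x
    have e2 : X x = ((∑ j, del φ (b j) (α j) x) * conj (∑ j, del φ (b j) (α j) x) -
        (∑ j, ∑ k, dzb (b k) (α j) x * conj (dzb (b j) (α k) x)) -
        ((1 / 4 * levi φ x (∑ j, α j x • b j) : ℝ) : ℂ)) * (Real.exp (-φ x) : ℝ) := by
      rw [← levi_sum hφ, map_sum, Finset.sum_mul_sum]
      simp only [X, ← Finset.sum_mul, Finset.sum_sub_distrib]
    rw [e2, Complex.re_mul_ofReal, Complex.sub_re, Complex.sub_re, Complex.ofReal_re,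
      antisymm_sum (fun k j => dzb (b k) (α j) x), Complex.mul_conj, Complex.ofReal_re,
      Complex.normSq_eq_norm_sq]
  have hre : ∫ x, (X x).re ∂μ = 0 := by
    have := integral_re (𝕜 := ℂ) hX.2
    simp only [RCLike.re_eq_complex_re] at this
    rw [this, hX.1]; simp
  have hire : Integrable (fun x => (X x).re) μ := hX.2.re
  have hiR : Integrable (fun x => (‖∑ j, del φ (b j) (α j) x‖ ^ 2 +
        1 / 2 * ∑ j, ∑ k, ‖dzb (b k) (α j) x - dzb (b j) (α k) x‖ ^ 2) * Real.exp (-φ x)) μ := by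
    apply integ
    · fun_prop
    · intro x hx; simp [hdel0 x hx, hdzb0 x hx]
  have hiL : Integrable (fun x => 1 / 4 * levi φ x (∑ j, α j x • b j) * Real.exp (-φ x)) μ := by
    apply integ
    · fun_prop
    · intro x hx; simp [hα0 x hx, levi]
  have hiD : Integrable (fun x => (∑ j, ∑ k, ‖dzb (b k) (α j) x‖ ^ 2) * Real.exp (-φ x)) μ := by
    apply integ
    · fun_prop
    · intro x hx; simp [hdzb0 x hx]
  have e3 : ∀ x, (‖∑ j, del φ (b j) (α j) x‖ ^ 2 +
        1 / 2 * ∑ j, ∑ k, ‖dzb (b k) (α j) x - dzb (b j) (α k) x‖ ^ 2) * Real.exp (-φ x) =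
      1 / 4 * levi φ x (∑ j, α j x • b j) * Real.exp (-φ x) + ((X x).re +
        (∑ j, ∑ k, ‖dzb (b k) (α j) x‖ ^ 2) * Real.exp (-φ x)) := by
    intro x; rw [hXre]; ring
  simp_rw [e3]
  have hrD : Integrable (fun x => (X x).re +
      (∑ j, ∑ k, ‖dzb (b k) (α j) x‖ ^ 2) * Real.exp (-φ x)) μ := hire.add hiD
  rw [integral_add hiL hrD, integral_add hire hiD, hre, zero_add]
  have : 0 ≤ ∫ x, (∑ j, ∑ k, ‖dzb (b k) (α j) x‖ ^ 2) * Real.exp (-φ x) ∂μ :=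
    integral_nonneg fun x => by positivity
  linarith

end Basic

end SteinAux

set_option linter.unusedSectionVars false
set_option linter.unusedSimpArgs false

namespace SteinAux

variable {E : Type*} [NormedAddCommGroup E] [NormedSpace ℂ E]
  [FiniteDimensional ℂ E] [MeasurableSpace E] [BorelSpace E]
  (μ : Measure E) [μ.IsAddHaarMeasure] {N : ℕ} (b : Module.Basis (Fin N) ℂ E)

/-- the coordinate square norm -/
def Qf (y : E) : ℝ := ∑ j, ‖b.repr y j‖ ^ 2

lemma contDiff_coord (j : Fin N) : ContDiff ℝ ∞ (fun y : E => b.repr y j) := by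
  have : (fun y : E => b.repr y j)
      = fun y => ((LinearMap.toContinuousLinearMap (b.coord j)).restrictScalars ℝ) y := by
    ext y; simp
  rw [this]
  exact ContinuousLinearMap.contDiff _

lemma contDiff_Qf : ContDiff ℝ ∞ (Qf b) := by
  unfold Qf
  exact ContDiff.sum fun j _ => (contDiff_coord b j).norm_sq ℝ

lemma Qf_smul (c : ℂ) (hc : ‖c‖ = 1) (y : E) : Qf b (c • y) = Qf b y := by
  simp [Qf, hc]

lemma Qf_zero : Qf b 0 = 0 := by simp [Qf]

lemma norm_le_of_Qf {y : E} {ε : ℝ} (hε : 0 ≤ ε) (h : Qf b y ≤ ε ^ 2) :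
    ‖y‖ ≤ ε * ∑ j, ‖b j‖ := by
  have h1 : ∀ j, ‖b.repr y j‖ ≤ ε := by
    intro j
    have : ‖b.repr y j‖ ^ 2 ≤ ε ^ 2 :=
      (Finset.single_le_sum (f := fun j => ‖b.repr y j‖ ^ 2) (fun i _ => by positivity)
        (Finset.mem_univ j)).trans h
    exact abs_le_of_sq_le_sq' this hε |>.2
  calc ‖y‖ = ‖∑ j, b.repr y j • b j‖ := by rw [b.sum_repr]
    _ ≤ ∑ j, ‖b.repr y j • b j‖ := norm_sum_le _ _
    _ ≤ ∑ j, ε * ‖b j‖ := by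
        refine Finset.sum_le_sum fun j _ => ?_
        rw [norm_smul]; gcongr; exact h1 j
    _ = _ := by rw [Finset.mul_sum]

/-- unnormalised mollifier -/
def bmp (n : ℕ) (y : E) : ℝ := Real.smoothTransition (1 - (n + 1) ^ 2 * Qf b y)

lemma contDiff_bmp (n : ℕ) : ContDiff ℝ ∞ (bmp b n) := by
  unfold bmp
  exact Real.smoothTransition.contDiff.comp
    (contDiff_const.sub (contDiff_const.mul (contDiff_Qf b)))

lemma bmp_supp {n : ℕ} {y : E} (h : bmp b n y ≠ 0) : ‖y‖ ≤ (∑ j, ‖b j‖) / (n + 1) := by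
  by_contra hn
  apply h
  apply Real.smoothTransition.zero_of_nonpos
  by_contra h2
  push Not at h2
  apply hn
  have h3 : Qf b y ≤ (1 / ((n : ℝ) + 1)) ^ 2 := by
    rw [div_pow, one_pow, le_div_iff₀ (by positivity)]; nlinarith
  have := norm_le_of_Qf b (by positivity) h3
  rw [div_eq_inv_mul, ← one_div]; exact this

lemma hcs_bmp (n : ℕ) : HasCompactSupport (bmp b n) := by
  have : ProperSpace E := FiniteDimensional.proper ℂ E
  refine HasCompactSupport.of_support_subset_isCompact
    (isCompact_closedBall (0 : E) ((∑ j, ‖b j‖) / (n + 1))) ?_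
  intro y hy
  simpa using bmp_supp b hy

lemma bmp_int_pos (n : ℕ) : 0 < ∫ y, bmp b n y ∂μ := by
  refine Continuous.integral_pos_of_hasCompactSupport_nonneg_nonzero (x := 0)
    (contDiff_bmp b n).continuous (hcs_bmp b n) (fun y => Real.smoothTransition.nonneg _) ?_
  simp [bmp, Qf_zero]

/-- mollifier -/
def moll (n : ℕ) (y : E) : ℝ := (∫ y, bmp b n y ∂μ)⁻¹ * bmp b n y

lemma contDiff_moll (n : ℕ) : ContDiff ℝ ∞ (moll μ b n) :=
  contDiff_const.mul (contDiff_bmp b n)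

lemma moll_nonneg (n : ℕ) (y : E) : 0 ≤ moll μ b n y :=
  mul_nonneg (inv_nonneg.2 (bmp_int_pos μ b n).le) (Real.smoothTransition.nonneg _)

lemma moll_supp {n : ℕ} {y : E} (h : moll μ b n y ≠ 0) : ‖y‖ ≤ (∑ j, ‖b j‖) / (n + 1) :=
  bmp_supp b (right_ne_zero_of_mul h)

lemma hcs_moll (n : ℕ) : HasCompactSupport (moll μ b n) := (hcs_bmp b n).mul_left

lemma moll_smul (n : ℕ) (c : ℂ) (hc : ‖c‖ = 1) (y : E) : moll μ b n (c • y) = moll μ b n y := by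
  simp only [moll, bmp, Qf_smul b c hc]

lemma moll_neg (n : ℕ) (y : E) : moll μ b n (-y) = moll μ b n y := by
  have := moll_smul μ b n (-1) (by simp) y
  simpa using this

lemma moll_integral (n : ℕ) : ∫ y, moll μ b n y ∂μ = 1 := by
  unfold moll
  rw [integral_const_mul]
  exact inv_mul_cancel₀ (bmp_int_pos μ b n).ne'

def mconv (n : ℕ) (c : E → ℂ) (x : E) : ℂ := ∫ y, c y * (moll μ b n (x - y) : ℂ) ∂μ

lemma mconv_eq (n : ℕ) (c : E → ℂ) :
    mconv μ b n c = convolution c (fun y => (moll μ b n y : ℂ)) (ContinuousLinearMap.mul ℝ ℂ) μ := by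
  ext x; simp [mconv, convolution]

lemma contDiff_mollC (n : ℕ) : ContDiff ℝ ∞ (fun y => (moll μ b n y : ℂ)) :=
  Complex.ofRealCLM.contDiff.comp (contDiff_moll μ b n)

lemma hcs_mollC (n : ℕ) : HasCompactSupport (fun y => (moll μ b n y : ℂ)) :=
  (hcs_moll μ b n).comp_left (g := fun x : ℝ => (x : ℂ)) (by simp)

lemma contDiff_mconv (n : ℕ) {c : E → ℂ} (hc : LocallyIntegrable c μ) :
    ContDiff ℝ ∞ (mconv μ b n c) := by
  rw [mconv_eq]
  exact (hcs_mollC μ b n).contDiff_convolution_right _ hc (contDiff_mollC μ b n)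

lemma hcs_mconv (n : ℕ) {c : E → ℂ} (hc : HasCompactSupport c) :
    HasCompactSupport (mconv μ b n c) := by
  rw [mconv_eq]
  exact hc.convolution _ (hcs_mollC μ b n)

lemma fderiv_mconv (n : ℕ) {c : E → ℂ} (hc : LocallyIntegrable c μ) (x e : E) :
    fderiv ℝ (mconv μ b n c) x e
      = ∫ y, c y * fderiv ℝ (fun y => (moll μ b n y : ℂ)) (x - y) e ∂μ := by
  have : FiniteDimensional ℝ E := FiniteDimensional.complexToReal E
  have hd := (hcs_mollC μ b n).hasFDerivAt_convolution_right (ContinuousLinearMap.mul ℝ ℂ) hc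
    ((contDiff_mollC μ b n).of_le (by simp)) x
  rw [mconv_eq, hd.fderiv, convolution]
  rw [ContinuousLinearMap.integral_apply]
  · simp
  · exact ((hcs_mollC μ b n).fderiv ℝ).convolutionExists_right _ hc
      ((contDiff_mollC μ b n).continuous_fderiv (by simp)) x


lemma fderiv_sub_flip {f : E → ℂ} (hf : ContDiff ℝ 1 f) (x y e : E) :
    fderiv ℝ (fun y => f (x - y)) y e = - fderiv ℝ f (x - y) e := by
  have h1 : HasFDerivAt f (fderiv ℝ f (x - y)) (x - y) :=
    (hf.differentiable (by simp) _).hasFDerivAt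
  have h2 : HasFDerivAt (fun y : E => x - y) (-(ContinuousLinearMap.id ℝ E)) y := by
    simpa using (hasFDerivAt_id (𝕜 := ℝ) y).const_sub x
  have h3 : HasFDerivAt (fun y => f (x - y)) _ y := h1.comp y h2
  rw [h3.fderiv]; simp

lemma integrable_mul_fderiv_moll (n : ℕ) {c : E → ℂ} (hc : LocallyIntegrable c μ) (x e : E) :
    Integrable (fun y => c y * fderiv ℝ (fun y => (moll μ b n y : ℂ)) (x - y) e) μ := by
  have : FiniteDimensional ℝ E := FiniteDimensional.complexToReal E
  have h := ((hcs_mollC μ b n).fderiv ℝ).convolutionExists_right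
    ((ContinuousLinearMap.mul ℝ ℂ).precompR E) hc
      ((contDiff_mollC μ b n).continuous_fderiv (by simp)) x
  exact (ContinuousLinearMap.apply ℝ ℂ e).integrable_comp h

/-- test function -/
def tst (n : ℕ) (x y : E) : ℂ := (moll μ b n (x - y) : ℂ)

lemma contDiff_tst (n : ℕ) (x : E) : ContDiff ℝ ∞ (tst μ b n x) :=
  (contDiff_mollC μ b n).comp (contDiff_const.sub contDiff_id)

lemma tst_supp {n : ℕ} {x y : E} (h : tst μ b n x y ≠ 0) : ‖x - y‖ ≤ (∑ j, ‖b j‖) / (n + 1) := by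
  apply moll_supp μ b (n := n)
  intro h0; apply h; simp [tst, h0]

lemma tst_tsupport (n : ℕ) (x : E) :
    tsupport (tst μ b n x) ⊆ closedBall x ((∑ j, ‖b j‖) / (n + 1)) := by
  apply closure_minimal _ isClosed_closedBall
  intro y hy
  rw [mem_closedBall, dist_comm, dist_eq_norm]
  exact tst_supp μ b hy

lemma hcs_tst (n : ℕ) (x : E) : HasCompactSupport (tst μ b n x) := by
  have : ProperSpace E := FiniteDimensional.proper ℂ E
  exact (isCompact_closedBall _ _).of_isClosed_subset (isClosed_tsupport _) (tst_tsupport μ b n x)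

lemma fderiv_mconv' (n : ℕ) {c : E → ℂ} (hc : LocallyIntegrable c μ) (x e : E) :
    fderiv ℝ (mconv μ b n c) x e = - ∫ y, c y * fderiv ℝ (tst μ b n x) y e ∂μ := by
  rw [fderiv_mconv μ b n hc, ← integral_neg]
  congr 1; ext y
  have := fderiv_sub_flip ((contDiff_mollC μ b n).of_le (by simp)) x y e
  unfold tst
  rw [this]; ring

lemma integrable_mul_fderiv_tst (n : ℕ) {c : E → ℂ} (hc : LocallyIntegrable c μ) (x e : E) :
    Integrable (fun y => c y * fderiv ℝ (tst μ b n x) y e) μ := by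
  refine (integrable_mul_fderiv_moll μ b n hc x e).neg.congr (Eventually.of_forall fun y => ?_)
  have := fderiv_sub_flip ((contDiff_mollC μ b n).of_le (by simp)) x y e
  unfold tst
  simp only [this, Pi.neg_apply]; ring

lemma dz_mconv (n : ℕ) {c : E → ℂ} (hc : LocallyIntegrable c μ) (x e : E) :
    dz e (mconv μ b n c) x = - ∫ y, c y * dz e (tst μ b n x) y ∂μ := by
  unfold dz
  have h1 := integrable_mul_fderiv_tst μ b n hc x e
  have h2 := integrable_mul_fderiv_tst μ b n hc x (I • e)
  have h3 : (fun y => c y * (1 / 2 * (fderiv ℝ (tst μ b n x) y e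
      - I * fderiv ℝ (tst μ b n x) y (I • e))))
      = fun y => (1 / 2 : ℂ) * ((c y * fderiv ℝ (tst μ b n x) y e)
        - I * (c y * fderiv ℝ (tst μ b n x) y (I • e))) := by
    ext y; ring
  rw [h3, integral_const_mul, integral_sub h1 (h2.const_mul I), integral_const_mul,
    fderiv_mconv' μ b n hc, fderiv_mconv' μ b n hc]
  ring

lemma dzb_mconv (n : ℕ) {c : E → ℂ} (hc : LocallyIntegrable c μ) (x e : E) :
    dzb e (mconv μ b n c) x = - ∫ y, c y * dzb e (tst μ b n x) y ∂μ := by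
  unfold dzb
  have h1 := integrable_mul_fderiv_tst μ b n hc x e
  have h2 := integrable_mul_fderiv_tst μ b n hc x (I • e)
  have h3 : (fun y => c y * (1 / 2 * (fderiv ℝ (tst μ b n x) y e
      + I * fderiv ℝ (tst μ b n x) y (I • e))))
      = fun y => (1 / 2 : ℂ) * ((c y * fderiv ℝ (tst μ b n x) y e)
        + I * (c y * fderiv ℝ (tst μ b n x) y (I • e))) := by
    ext y; ring
  rw [h3, integral_const_mul, integral_add h1 (h2.const_mul I), integral_const_mul,
    fderiv_mconv' μ b n hc, fderiv_mconv' μ b n hc]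
  ring

lemma trans_cont {c : E → ℂ} (hc : MemLp c 2 μ) :
    Tendsto (fun y => eLpNorm (fun x => c (x - y) - c x) 2 μ) (𝓝 0) (𝓝 0) := by
  have : ProperSpace E := FiniteDimensional.proper ℂ E
  let G : C(E, C(E, E)) :=
    (ContinuousMap.mk (fun a : E × E => a.2 - a.1) (by fun_prop)).curry
  have hG : ∀ y, MeasurePreserving (G y) μ μ := fun y => measurePreserving_sub_right μ y
  have h0 := (continuous_const (y := hc.toLp c)).compMeasurePreservingLp (μ := μ) (ν := μ)
    (p := 2) G.continuous hG (by simp)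
  have h1 := (h0.tendsto 0)
  rw [Lp.tendsto_Lp_iff_tendsto_eLpNorm'] at h1
  refine h1.congr fun y => ?_
  apply eLpNorm_congr_ae
  have e1 := Lp.coeFn_compMeasurePreserving (hc.toLp c) (hG y)
  have e2 := Lp.coeFn_compMeasurePreserving (hc.toLp c) (hG 0)
  have e3 := (hG y).quasiMeasurePreserving.ae_eq_comp hc.coeFn_toLp
  have e4 := (hG 0).quasiMeasurePreserving.ae_eq_comp hc.coeFn_toLp
  filter_upwards [e1, e2, e3, e4] with x h1 h2 h3 h4
  simp only [Pi.sub_apply, h1, h2, h3, h4]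
  simp [G]

lemma jensen_pt (n : ℕ) {h : E → ℂ} (hh : AEStronglyMeasurable h μ) :
    ‖∫ y, (moll μ b n y : ℂ) * h y ∂μ‖ₑ ^ 2
      ≤ ∫⁻ y, ENNReal.ofReal (moll μ b n y) * ‖h y‖ₑ ^ 2 ∂μ := by
  have hm : Measurable (fun y => ENNReal.ofReal (moll μ b n y)) :=
    (contDiff_moll μ b n).continuous.measurable.ennreal_ofReal
  set ν := μ.withDensity (fun y => ENNReal.ofReal (moll μ b n y)) with hν
  have hi : Integrable (moll μ b n) μ :=
    (contDiff_moll μ b n).continuous.integrable_of_hasCompactSupport (hcs_moll μ b n)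
  have hp : IsProbabilityMeasure ν := by
    refine ⟨?_⟩
    rw [hν, withDensity_apply _ MeasurableSet.univ, Measure.restrict_univ,
      ← ofReal_integral_eq_lintegral_ofReal hi (Eventually.of_forall (moll_nonneg μ b n)),
      moll_integral]
    simp
  have hac : ν ≪ μ := withDensity_absolutelyContinuous _ _
  have key := eLpNorm_le_eLpNorm_of_exponent_le (μ := ν) (p := 1) (q := 2) (by norm_num)
    (hh.mono_ac hac)
  have e1 : ‖∫ y, (moll μ b n y : ℂ) * h y ∂μ‖ₑ ≤ eLpNorm h 1 ν := by
    refine (enorm_integral_le_lintegral_enorm _).trans ?_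
    rw [eLpNorm_one_eq_lintegral_enorm, hν,
      lintegral_withDensity_eq_lintegral_mul₀' hm.aemeasurable
        ((hh.mono_ac hac).enorm)]
    apply le_of_eq
    congr 1; ext y
    simp only [enorm_mul, Pi.mul_apply]
    congr 1
    rw [← ofReal_norm, Complex.norm_real, Real.norm_of_nonneg (moll_nonneg μ b n y)]
  calc _ ≤ (eLpNorm h 2 ν) ^ 2 := by gcongr; exact e1.trans key
    _ = _ := by
      rw [eLpNorm_eq_lintegral_rpow_enorm_toReal (by simp) (by simp)]
      simp only [ENNReal.toReal_ofNat]
      rw [← ENNReal.rpow_natCast, ← ENNReal.rpow_mul]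
      norm_num
      rw [hν, lintegral_withDensity_eq_lintegral_mul₀' hm.aemeasurable
        ((hh.mono_ac hac).enorm.pow_const 2)]
      rfl

lemma eLpNorm_sq {c : E → ℂ} {ν : Measure E} : eLpNorm c 2 ν ^ 2 = ∫⁻ x, ‖c x‖ₑ ^ 2 ∂ν := by
  rw [eLpNorm_eq_lintegral_rpow_enorm_toReal (by simp) (by simp)]
  simp only [ENNReal.toReal_ofNat]
  rw [← ENNReal.rpow_natCast, ← ENNReal.rpow_mul]
  norm_num

lemma mconv_flip (n : ℕ) (c : E → ℂ) (x : E) :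
    mconv μ b n c x = ∫ y, (moll μ b n y : ℂ) * c (x - y) ∂μ := by
  unfold mconv
  rw [← integral_sub_left_eq_self _ μ x]
  congr 1; ext y; simp [mul_comm]

lemma mconv_congr (n : ℕ) {c c' : E → ℂ} (h : c =ᵐ[μ] c') : mconv μ b n c = mconv μ b n c' := by
  ext x
  apply integral_congr_ae
  filter_upwards [h] with y hy
  rw [hy]

lemma mconv_sub_le (n : ℕ) {c : E → ℂ} (hc : MemLp c 2 μ) (δ : ENNReal)
    (hδ : ∀ y, ‖y‖ ≤ (∑ j, ‖b j‖) / (n + 1) → eLpNorm (fun x => c (x - y) - c x) 2 μ ≤ δ) :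
    eLpNorm (mconv μ b n c - c) 2 μ ≤ δ := by
  have : ProperSpace E := FiniteDimensional.proper ℂ E
  obtain ⟨c', hc', hcc⟩ := hc.1
  have hcL : MemLp c' 2 μ := hc.ae_eq hcc
  rw [mconv_congr μ b n hcc, eLpNorm_congr_ae (EventuallyEq.rfl.sub hcc)]
  have hδ' : ∀ y, ‖y‖ ≤ (∑ j, ‖b j‖) / (n + 1) →
      eLpNorm (fun x => c' (x - y) - c' x) 2 μ ≤ δ := by
    intro y hy
    refine le_of_eq_of_le (eLpNorm_congr_ae ?_) (hδ y hy)
    have e3 := (measurePreserving_sub_right μ y).quasiMeasurePreserving.ae_eq_comp hcc.symm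
    filter_upwards [hcc, e3] with x h1 h2
    simp only [Function.comp] at h2
    rw [h2, h1]
  have hloc : LocallyIntegrable c' μ := hcL.locallyIntegrable (by norm_num)
  have hi : Integrable (fun y => (moll μ b n y : ℂ)) μ :=
    (contDiff_mollC μ b n).continuous.integrable_of_hasCompactSupport (hcs_mollC μ b n)
  have h1 : ∀ x, mconv μ b n c' x - c' x
      = ∫ y, (moll μ b n y : ℂ) * (c' (x - y) - c' x) ∂μ := by
    intro x
    have hintg : Integrable (fun y => (moll μ b n y : ℂ) * c' (x - y)) μ := by
      have h := (hcs_mollC μ b n).convolutionExists_right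
        (ContinuousLinearMap.mul ℝ ℂ) hloc (contDiff_mollC μ b n).continuous x
      have h2 := h.integrable_swap
      simpa [mul_comm] using h2
    simp only [mul_sub]
    rw [integral_sub hintg (hi.mul_const _), ← mconv_flip, integral_mul_const]
    have : ∫ y, (moll μ b n y : ℂ) ∂μ = 1 := by
      rw [integral_complex_ofReal, moll_integral]; simp
    rw [this, one_mul]
  have h2 : eLpNorm (mconv μ b n c' - c') 2 μ ^ 2 ≤ δ ^ 2 := by
    rw [eLpNorm_sq]
    simp only [Pi.sub_apply, h1]
    calc _ ≤ ∫⁻ x, ∫⁻ y, ENNReal.ofReal (moll μ b n y) * ‖c' (x - y) - c' x‖ₑ ^ 2 ∂μ ∂μ := by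
          apply lintegral_mono
          intro x
          apply jensen_pt
          exact ((hc'.comp_measurable (measurable_const.sub measurable_id)).sub
            stronglyMeasurable_const).aestronglyMeasurable
      _ = ∫⁻ y, ∫⁻ x, ENNReal.ofReal (moll μ b n y) * ‖c' (x - y) - c' x‖ₑ ^ 2 ∂μ ∂μ := by
          apply lintegral_lintegral_swap
          apply Measurable.aemeasurable
          change Measurable (fun p : E × E =>
            ENNReal.ofReal (moll μ b n p.2) * ‖c' (p.1 - p.2) - c' p.1‖ₑ ^ 2)
          have m1 : Measurable (fun p : E × E => ENNReal.ofReal (moll μ b n p.2)) :=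
            ((contDiff_moll μ b n).continuous.measurable.comp
              measurable_snd).ennreal_ofReal
          have m2 : Measurable (fun p : E × E => ‖c' (p.1 - p.2) - c' p.1‖ₑ) :=
            ((hc'.measurable.comp (measurable_fst.sub measurable_snd)).sub
              (hc'.measurable.comp measurable_fst)).enorm
          exact m1.mul (m2.pow_const 2)
      _ ≤ ∫⁻ y, ENNReal.ofReal (moll μ b n y) * δ ^ 2 ∂μ := by
          apply lintegral_mono
          intro y
          dsimp only
          rw [lintegral_const_mul']
          · by_cases h0 : moll μ b n y = 0
            · simp [h0]
            · gcongr
              rw [← eLpNorm_sq]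
              gcongr
              exact hδ' y (moll_supp μ b h0)
          · simp
      _ = δ ^ 2 := by
          rw [lintegral_mul_const _
              (contDiff_moll μ b n).continuous.measurable.ennreal_ofReal,
            ← ofReal_integral_eq_lintegral_ofReal
              ((contDiff_moll μ b n).continuous.integrable_of_hasCompactSupport (hcs_moll μ b n))
              (Eventually.of_forall (moll_nonneg μ b n)), moll_integral]
          simp
  exact (ENNReal.pow_le_pow_left_iff (by simp)).1 h2

lemma mconv_tendsto {c : E → ℂ} (hc : MemLp c 2 μ) :
    Tendsto (fun n => eLpNorm (mconv μ b n c - c) 2 μ) atTop (𝓝 0) := by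
  rw [ENNReal.tendsto_nhds_zero]
  intro δ hδ
  have h1 := (ENNReal.tendsto_nhds_zero.1 (trans_cont μ hc)) δ hδ
  rw [Metric.eventually_nhds_iff_ball] at h1
  obtain ⟨r, hr, h1⟩ := h1
  have h2 : Tendsto (fun n : ℕ => (∑ j, ‖b j‖) / ((n : ℝ) + 1)) atTop (𝓝 0) :=
    ((tendsto_const_div_atTop_nhds_zero_nat (∑ j, ‖b j‖)).comp (tendsto_add_atTop_nat 1)).congr
      (by intro n; simp)
  filter_upwards [h2.eventually (gt_mem_nhds hr)] with n hn
  apply mconv_sub_le μ b n hc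
  intro y hy
  apply h1
  rw [mem_ball_zero_iff]
  exact hy.trans_lt hn

end SteinAux

set_option linter.unusedSectionVars false
set_option linter.unusedSimpArgs false

namespace SteinAux

section L2tools

variable {X : Type*} [MeasurableSpace X] {ν : Measure X}

lemma memLp_mul_bdd {f w : X → ℂ} (hf : MemLp f 2 ν) (hw : AEStronglyMeasurable w ν) {C : ℝ}
    (hC : ∀ x, ‖w x‖ ≤ C) : MemLp (fun x => w x * f x) 2 ν := by
  refine MemLp.of_le_mul (c := C) hf (hw.mul hf.1) (Eventually.of_forall fun x => ?_)
  rw [norm_mul]; gcongr; exact hC x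

lemma integrable_norm_sq {f : X → ℂ} (hf : MemLp f 2 ν) : Integrable (fun x => ‖f x‖ ^ 2) ν :=
  hf.integrable_norm_pow (by norm_num)

/-- convergence in `L²` -/
def L2t (ν : Measure X) (f : ℕ → X → ℂ) (g : X → ℂ) : Prop :=
  (∀ n, MemLp (f n) 2 ν) ∧ MemLp g 2 ν ∧ Tendsto (fun n => eLpNorm (f n - g) 2 ν) atTop (𝓝 0)

lemma L2t.add {f f' : ℕ → X → ℂ} {g g' : X → ℂ} (h : L2t ν f g) (h' : L2t ν f' g') :
    L2t ν (fun n x => f n x + f' n x) (fun x => g x + g' x) := by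
  refine ⟨fun n => (h.1 n).add (h'.1 n), h.2.1.add h'.2.1, ?_⟩
  have := h.2.2.add h'.2.2
  rw [add_zero] at this
  refine tendsto_of_tendsto_of_tendsto_of_le_of_le tendsto_const_nhds this
    (fun n => bot_le) (fun n => ?_)
  have e : (fun x => f n x + f' n x) - (fun x => g x + g' x) = (f n - g) + (f' n - g') := by
    ext x; simp; ring
  rw [e]
  exact eLpNorm_add_le ((h.1 n).1.sub h.2.1.1) ((h'.1 n).1.sub h'.2.1.1) (by norm_num)

lemma L2t.zero : L2t ν (fun _ _ => 0) (fun _ => 0) := by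
  refine ⟨fun _ => MemLp.zero', MemLp.zero', ?_⟩
  have : ((fun _ => 0 : X → ℂ) - fun _ => 0) = 0 := by ext; simp
  simp [this]

lemma L2t.sum {ι : Type*} (s : Finset ι) {f : ι → ℕ → X → ℂ} {g : ι → X → ℂ}
    (h : ∀ i, L2t ν (f i) (g i)) :
    L2t ν (fun n x => ∑ i ∈ s, f i n x) (fun x => ∑ i ∈ s, g i x) := by
  classical
  induction s using Finset.induction_on with
  | empty => simpa using L2t.zero
  | insert i s hi ih =>
    simp only [Finset.sum_insert hi]
    exact (h i).add ih

lemma L2t.mul_bdd {f : ℕ → X → ℂ} {g w : X → ℂ} (h : L2t ν f g) (hw : AEStronglyMeasurable w ν)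
    {C : ℝ} (hC : ∀ x, ‖w x‖ ≤ C) :
    L2t ν (fun n x => w x * f n x) (fun x => w x * g x) := by
  refine ⟨fun n => memLp_mul_bdd (h.1 n) hw hC, memLp_mul_bdd h.2.1 hw hC, ?_⟩
  have h2 := ENNReal.Tendsto.const_mul (a := ENNReal.ofReal C) h.2.2 (Or.inr (by simp))
  rw [mul_zero] at h2
  refine tendsto_of_tendsto_of_tendsto_of_le_of_le tendsto_const_nhds h2
    (fun n => bot_le) (fun n => ?_)
  refine eLpNorm_le_mul_eLpNorm_of_ae_le_mul (Eventually.of_forall fun x => ?_) 2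
  simp only [Pi.sub_apply, ← mul_sub, norm_mul]
  gcongr; exact hC x

lemma norm_toLp_sq {f : X → ℂ} (hf : MemLp f 2 ν) : ‖hf.toLp f‖ ^ 2 = ∫ x, ‖f x‖ ^ 2 ∂ν := by
  rw [Lp.norm_toLp, hf.eLpNorm_eq_integral_rpow_norm (by simp) (by simp)]
  have h0 : 0 ≤ ∫ x, ‖f x‖ ^ 2 ∂ν := integral_nonneg fun x => by positivity
  simp only [ENNReal.toReal_ofNat]
  norm_num
  rw [ENNReal.toReal_ofReal (by positivity), ← Real.rpow_natCast, ← Real.rpow_mul h0]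
  norm_num

lemma L2t.integral_sq {f : ℕ → X → ℂ} {g : X → ℂ} (h : L2t ν f g) :
    Tendsto (fun n => ∫ x, ‖f n x‖ ^ 2 ∂ν) atTop (𝓝 (∫ x, ‖g x‖ ^ 2 ∂ν)) := by
  have h1 : Tendsto (fun n => (h.1 n).toLp (f n)) atTop (𝓝 (h.2.1.toLp g)) := by
    rw [Lp.tendsto_Lp_iff_tendsto_eLpNorm'']
    exact h.2.2
  have h2 := (h1.norm).pow 2
  rw [norm_toLp_sq] at h2
  refine h2.congr fun n => norm_toLp_sq _

end L2tools

section cutoff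

variable {E : Type*} [NormedAddCommGroup E] [NormedSpace ℂ E] [FiniteDimensional ℂ E]
variable {F : Type*} [NormedAddCommGroup F] [NormedSpace ℝ F]

lemma contDiff_smul_of_tsupport {n : ℕ∞ω} {Ω : Set E} (hΩ : IsOpen Ω) {θ : E → ℝ} {f : E → F}
    (hθ : ContDiffOn ℝ n θ Ω) (hs : tsupport θ ⊆ Ω) (hf : ContDiffOn ℝ n f Ω) :
    ContDiff ℝ n (fun x => θ x • f x) := by
  rw [contDiff_iff_contDiffAt]
  intro x
  by_cases hx : x ∈ Ω
  · exact ((hθ x hx).contDiffAt (hΩ.mem_nhds hx)).smul ((hf x hx).contDiffAt (hΩ.mem_nhds hx))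
  · have : (fun x => θ x • f x) =ᶠ[𝓝 x] fun _ => 0 := by
      have h1 : x ∉ tsupport θ := fun h => hx (hs h)
      have h2 := notMem_tsupport_iff_eventuallyEq.1 h1
      filter_upwards [h2] with y hy
      simp [hy]
    exact contDiffAt_const.congr_of_eventuallyEq this

lemma continuous_smul_of_tsupport {Ω : Set E} (hΩ : IsOpen Ω) {θ : E → ℝ} {f : E → F}
    (hθ : ContinuousOn θ Ω) (hs : tsupport θ ⊆ Ω) (hf : ContinuousOn f Ω) :
    Continuous (fun x => θ x • f x) := by
  rw [← contDiff_zero (𝕜 := ℝ)]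
  exact contDiff_smul_of_tsupport hΩ (contDiffOn_zero.2 hθ) hs (contDiffOn_zero.2 hf)

lemma exists_cutoff {K Ω : Set E} (hK : IsCompact K) (hΩ : IsOpen Ω) (hKΩ : K ⊆ Ω) :
    ∃ θ : E → ℝ, ContDiff ℝ ∞ θ ∧ HasCompactSupport θ ∧ tsupport θ ⊆ Ω ∧
      (∃ S, IsOpen S ∧ K ⊆ S ∧ S ⊆ Ω ∧ ∀ x ∈ S, θ x = 1) ∧ ∀ x, θ x ∈ Icc (0:ℝ) 1 := by
  have : ProperSpace E := FiniteDimensional.proper ℂ E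
  have : FiniteDimensional ℝ E := FiniteDimensional.complexToReal E
  obtain ⟨L, hL, hKL, hLΩ⟩ := exists_compact_between hK hΩ hKΩ
  obtain ⟨L', hL', hLL', hLΩ'⟩ := exists_compact_between hL hΩ hLΩ
  obtain ⟨f, hf1, hf0, hf01⟩ := exists_contMDiffMap_one_nhds_of_subset_interior
    (n := ⊤) (modelWithCornersSelf ℝ E) (s := K) (t := L) hK.isClosed hKL
  have hsupp : tsupport f ⊆ L := by
    apply closure_minimal _ hL.isClosed
    intro x hx
    by_contra h
    exact hx (hf0 x h)
  refine ⟨f, ?_, hL.of_isClosed_subset (isClosed_tsupport _) hsupp, hsupp.trans hLΩ, ?_, hf01⟩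
  · exact f.contMDiff.contDiff
  · obtain ⟨S, hS, hSo, hKS⟩ := eventually_nhdsSet_iff_exists.1 hf1
    exact ⟨S ∩ Ω, hS.inter hΩ, subset_inter hSo hKΩ, inter_subset_right, fun x hx => hKS x hx.1⟩

end cutoff

end SteinAux

set_option linter.unusedSectionVars false
set_option linter.unusedSimpArgs false

namespace SteinAux

variable {E : Type*} [NormedAddCommGroup E] [NormedSpace ℂ E]
  [FiniteDimensional ℂ E] [MeasurableSpace E] [BorelSpace E]
  (μ : Measure E) [μ.IsAddHaarMeasure] {N : ℕ} (b : Module.Basis (Fin N) ℂ E)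

lemma two_le_inf : (2 : ℕ∞ω) ≤ ∞ := WithTop.coe_le_coe.2 (le_top : (2 : ℕ∞) ≤ ⊤)

/-- shorthand -/
def dzR (e : E) (φ : E → ℝ) (x : E) : ℂ := dz e (fun y => (φ y : ℂ)) x

lemma continuous_dzR {φ : E → ℝ} (hφ : ContDiff ℝ 2 φ) (e : E) : Continuous (dzR e φ) :=
  (contDiff_dz (k := 1) (contDiff_ofReal hφ) (by norm_num) e).continuous

lemma sq_add_le (a c : ℂ) : ‖a‖ ^ 2 ≤ 2 * ‖a + c‖ ^ 2 + 2 * ‖c‖ ^ 2 := by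
  have h : ‖a‖ ≤ ‖a + c‖ + ‖c‖ := by
    calc ‖a‖ = ‖(a + c) - c‖ := by ring_nf
      _ ≤ _ := norm_sub_le _ _
  have h0 := norm_nonneg a
  nlinarith [sq_nonneg (‖a + c‖ - ‖c‖)]

lemma K1 {φ η : E → ℝ} (hφ : ContDiff ℝ 2 φ) (hη : ContDiff ℝ 2 η) (S : Set E)
    (hlevi : ∀ x ∈ S, ∀ v : Fin N → ℂ,
      2 * ‖∑ j, dzR (b j) η x * v j‖ ^ 2 + Real.exp (η x) * ∑ j, ‖v j‖ ^ 2
        ≤ 1 / 4 * levi φ x (∑ j, v j • b j))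
    (α : Fin N → E → ℂ) (hα : ∀ j, ContDiff ℝ 2 (α j)) (hc : ∀ j, HasCompactSupport (α j))
    (hS : ∀ j, ∀ x ∉ S, α j x = 0) :
    ∫ x, (∑ j, ‖α j x‖ ^ 2) * Real.exp (η x - φ x) ∂μ ≤
      ∫ x, (2 * ‖∑ j, dz (b j) (α j) x + ∑ j, (dzR (b j) η x - dzR (b j) φ x) * α j x‖ ^ 2
        + 1 / 2 * ∑ j, ∑ k, ‖dzb (b k) (α j) x - dzb (b j) (α k) x‖ ^ 2)
        * Real.exp (-φ x) ∂μ := by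
  have hb := basic_ineq μ (fun j => b j) hφ α hα hc
  have cη : ∀ j, Continuous (dzR (b j) η) := fun j => continuous_dzR hη _
  have cφ : ∀ j, Continuous (dzR (b j) φ) := fun j => continuous_dzR hφ _
  have cα : ∀ j, Continuous (α j) := fun j => (hα j).continuous
  have cdz : ∀ j k, Continuous (dz (b j) (α k)) := fun j k =>
    (contDiff_dz (k := 1) (hα k) (by norm_num) _).continuous
  have cdzb : ∀ j k, Continuous (dzb (b j) (α k)) := fun j k =>
    (contDiff_dzb (k := 1) (hα k) (by norm_num) _).continuous
  have cdel : ∀ j, Continuous (del φ (b j) (α j)) := fun j => by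
    unfold del; exact (cdz j j).sub ((cφ j).mul (cα j))
  have cφ' := hφ.continuous
  have cη' := hη.continuous
  -- support
  set K : Set E := ⋃ j, tsupport (α j) with hK
  have hKc : IsCompact K := isCompact_iUnion fun j => hc j
  have zα : ∀ x ∉ K, ∀ j, α j x = 0 := fun x hx j => by
    by_contra h
    exact hx (mem_iUnion.2 ⟨j, subset_tsupport _ h⟩)
  have zdz : ∀ x ∉ K, ∀ j k, dz (b j) (α k) x = 0 := fun x hx j k =>
    dz_zero_of_notMem _ (fun h => hx (mem_iUnion.2 ⟨k, h⟩))
  have zdzb : ∀ x ∉ K, ∀ j k, dzb (b j) (α k) x = 0 := fun x hx j k =>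
    dzb_zero_of_notMem _ (fun h => hx (mem_iUnion.2 ⟨k, h⟩))
  have hintg : ∀ F : E → ℝ, Continuous F → (∀ x ∉ K, F x = 0) → Integrable F μ := by
    intro F hF h0
    refine hF.integrable_of_hasCompactSupport (HasCompactSupport.of_support_subset_isCompact hKc ?_)
    intro x hx
    by_contra h
    exact hx (h0 x h)
  have clevi : Continuous fun x => levi φ x (∑ j, α j x • b j) := by
    have h2 : Continuous (fderiv ℝ (fderiv ℝ φ)) :=
      (hφ.fderiv_right (m := 1) (by norm_num)).continuous_fderiv (by simp)
    have h3 : Continuous fun x => ∑ j, α j x • b j := by fun_prop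
    unfold levi
    have h4 : Continuous fun x => (I : ℂ) • ∑ j, α j x • b j := h3.const_smul I
    exact ((h2.clm_apply h3).clm_apply h3).add ((h2.clm_apply h4).clm_apply h4)
  -- pointwise
  have i1 : Integrable (fun x => 1 / 4 * levi φ x (∑ j, α j x • b j) * Real.exp (-φ x)) μ := by
    apply hintg
    · fun_prop
    · intro x hx; simp [zα x hx, levi]
  have i2 : Integrable (fun x => (‖∑ j, del φ (b j) (α j) x‖ ^ 2
      + 1 / 2 * ∑ j, ∑ k, ‖dzb (b k) (α j) x - dzb (b j) (α k) x‖ ^ 2) * Real.exp (-φ x)) μ := by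
    apply hintg
    · fun_prop
    · intro x hx; simp [zα x hx, zdz x hx, zdzb x hx, del]
  have i3 : Integrable (fun x => (∑ j, ‖α j x‖ ^ 2) * Real.exp (η x - φ x)) μ := by
    apply hintg
    · fun_prop
    · intro x hx; simp [zα x hx]
  have i4 : Integrable (fun x => (2 * ‖∑ j, dz (b j) (α j) x
      + ∑ j, (dzR (b j) η x - dzR (b j) φ x) * α j x‖ ^ 2
        + 1 / 2 * ∑ j, ∑ k, ‖dzb (b k) (α j) x - dzb (b j) (α k) x‖ ^ 2)
        * Real.exp (-φ x)) μ := by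
    apply hintg
    · fun_prop
    · intro x hx; simp [zα x hx, zdz x hx, zdzb x hx]
  have hpt : ∀ x, (∑ j, ‖α j x‖ ^ 2) * Real.exp (η x - φ x) +
      (‖∑ j, del φ (b j) (α j) x‖ ^ 2
      + 1 / 2 * ∑ j, ∑ k, ‖dzb (b k) (α j) x - dzb (b j) (α k) x‖ ^ 2) * Real.exp (-φ x)
      ≤ 1 / 4 * levi φ x (∑ j, α j x • b j) * Real.exp (-φ x) +
      (2 * ‖∑ j, dz (b j) (α j) x + ∑ j, (dzR (b j) η x - dzR (b j) φ x) * α j x‖ ^ 2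
        + 1 / 2 * ∑ j, ∑ k, ‖dzb (b k) (α j) x - dzb (b j) (α k) x‖ ^ 2)
        * Real.exp (-φ x) := by
    intro x
    have hl : 2 * ‖∑ j, dzR (b j) η x * α j x‖ ^ 2 + Real.exp (η x) * ∑ j, ‖α j x‖ ^ 2
        ≤ 1 / 4 * levi φ x (∑ j, α j x • b j) := by
      by_cases hx : x ∈ S
      · exact hlevi x hx _
      · simp [fun j => hS j x hx, levi]
    have hs := sq_add_le (∑ j, del φ (b j) (α j) x) (∑ j, dzR (b j) η x * α j x)
    have he : ∑ j, del φ (b j) (α j) x + ∑ j, dzR (b j) η x * α j x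
        = ∑ j, dz (b j) (α j) x + ∑ j, (dzR (b j) η x - dzR (b j) φ x) * α j x := by
      rw [← Finset.sum_add_distrib, ← Finset.sum_add_distrib]
      refine Finset.sum_congr rfl fun j _ => ?_
      simp only [del, dzR]; ring
    rw [he] at hs
    rw [show η x - φ x = η x + -φ x by ring, Real.exp_add]
    have hp := (Real.exp_pos (-φ x)).le
    have := mul_le_mul_of_nonneg_right (add_le_add hl hs) hp
    nlinarith [this]
  have := integral_mono (i3.add i2) (i1.add i4) hpt
  simp only [Pi.add_apply] at this
  rw [integral_add i3 i2, integral_add i1 i4] at this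
  linarith


lemma mconv_support (n : ℕ) {c : E → ℂ} {x : E} (h : mconv μ b n c x ≠ 0) :
    x ∈ cthickening ((∑ j, ‖b j‖) / (n + 1)) (tsupport c) := by
  by_contra hx
  apply h
  unfold mconv
  rw [← integral_zero E ℂ (μ := μ)]
  congr 1; ext y
  by_contra h0
  apply hx
  have h1 : c y ≠ 0 := left_ne_zero_of_mul h0
  have h2 : tst μ b n x y ≠ 0 := right_ne_zero_of_mul h0
  refine mem_cthickening_of_dist_le x y _ _ (subset_tsupport _ h1) ?_
  rw [dist_eq_norm]
  exact tst_supp μ b h2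

lemma L2t_mconv {c : E → ℂ} (hc : MemLp c 2 μ) (hs : HasCompactSupport c) :
    L2t μ (fun n => mconv μ b n c) c := by
  have : ProperSpace E := FiniteDimensional.proper ℂ E
  refine ⟨fun n => ?_, hc, mconv_tendsto μ b hc⟩
  exact (contDiff_mconv μ b n (hc.locallyIntegrable (by norm_num))).continuous.memLp_of_hasCompactSupport
    (hcs_mconv μ b n hs)

lemma K2 {φ η : E → ℝ} (hφ : ContDiff ℝ 2 φ) (hη : ContDiff ℝ 2 η)
    (hφc : HasCompactSupport φ) (hηc : HasCompactSupport η) (S : Set E) (hSo : IsOpen S)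
    (hlevi : ∀ x ∈ S, ∀ v : Fin N → ℂ,
      2 * ‖∑ j, dzR (b j) η x * v j‖ ^ 2 + Real.exp (η x) * ∑ j, ‖v j‖ ^ 2
        ≤ 1 / 4 * levi φ x (∑ j, v j • b j))
    (c : Fin N → E → ℂ) (hc : ∀ j, MemLp (c j) 2 μ) (hcc : ∀ j, HasCompactSupport (c j))
    (hcS : ∀ j, tsupport (c j) ⊆ S)
    (G : E → ℂ) (hG : MemLp G 2 μ) (hGc : HasCompactSupport G)
    (H : Fin N → Fin N → E → ℂ) (hH : ∀ j k, MemLp (H j k) 2 μ)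
    (hHc : ∀ j k, HasCompactSupport (H j k))
    (h1 : ∀ v : E → ℂ, ContDiff ℝ 2 v → HasCompactSupport v →
      ∑ j, ∫ x, c j x * dz (b j) v x ∂μ = ∫ x, G x * v x ∂μ)
    (h2 : ∀ v : E → ℂ, ContDiff ℝ 2 v → HasCompactSupport v → ∀ j k,
      ∫ x, c j x * dzb (b k) v x ∂μ - ∫ x, c k x * dzb (b j) v x ∂μ = - ∫ x, H j k x * v x ∂μ) :
    ∑ j, ∫ x, ‖((Real.exp ((η x - φ x) / 2) : ℝ) : ℂ) * c j x‖ ^ 2 ∂μ ≤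
      2 * ∫ x, ‖((Real.exp (-φ x / 2) : ℝ) : ℂ)
          * (-1 * G x + ∑ j, (dzR (b j) η x - dzR (b j) φ x) * c j x)‖ ^ 2 ∂μ
        + 1 / 2 * ∑ j, ∑ k, ∫ x, ‖((Real.exp (-φ x / 2) : ℝ) : ℂ) * H j k x‖ ^ 2 ∂μ := by
  have : ProperSpace E := FiniteDimensional.proper ℂ E
  have cφ' := hφ.continuous
  have cη' := hη.continuous
  have cη : ∀ j, Continuous (dzR (b j) η) := fun j => continuous_dzR hη _
  have cφ : ∀ j, Continuous (dzR (b j) φ) := fun j => continuous_dzR hφ _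
  obtain ⟨Cφ, hCφ⟩ := hφc.exists_bound_of_continuous cφ'
  obtain ⟨Cη, hCη⟩ := hηc.exists_bound_of_continuous cη'
  have lloc : ∀ {f : E → ℂ}, MemLp f 2 μ → LocallyIntegrable f μ :=
    fun h => h.locallyIntegrable (by norm_num)
  -- weights
  set w : E → ℂ := fun x => ((Real.exp ((η x - φ x) / 2) : ℝ) : ℂ) with hw
  set w0 : E → ℂ := fun x => ((Real.exp (-φ x / 2) : ℝ) : ℂ) with hw0
  have cw : Continuous w := by fun_prop
  have cw0 : Continuous w0 := by fun_prop
  have nw : ∀ x, ‖w x‖ ^ 2 = Real.exp (η x - φ x) := by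
    intro x
    simp only [hw, Complex.norm_real, Real.norm_eq_abs, Real.abs_exp]
    rw [← Real.exp_nat_mul]; congr 1; push_cast; ring
  have nw0 : ∀ x, ‖w0 x‖ ^ 2 = Real.exp (-φ x) := by
    intro x
    simp only [hw0, Complex.norm_real, Real.norm_eq_abs, Real.abs_exp]
    rw [← Real.exp_nat_mul]; congr 1; push_cast; ring
  have bw : ∀ x, ‖w x‖ ≤ Real.exp ((Cη + Cφ) / 2) := by
    intro x
    simp only [hw, Complex.norm_real, Real.norm_eq_abs, Real.abs_exp]
    have a1 := abs_le.1 (hCφ x); have a2 := abs_le.1 (hCη x)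
    apply Real.exp_le_exp.2; linarith
  have bw0 : ∀ x, ‖w0 x‖ ≤ Real.exp (Cφ / 2) := by
    intro x
    simp only [hw0, Complex.norm_real, Real.norm_eq_abs, Real.abs_exp]
    have a1 := abs_le.1 (hCφ x)
    apply Real.exp_le_exp.2; linarith
  have hzero : ∀ (ψ : E → ℝ), HasCompactSupport ψ → ∀ e, HasCompactSupport (dzR e ψ) := by
    intro ψ h e
    exact hcs_dz e (h.comp_left (g := fun x : ℝ => (x : ℂ)) (by simp))
  have hbd : ∀ j, ∃ C, ∀ x, ‖dzR (b j) η x - dzR (b j) φ x‖ ≤ C := fun j =>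
    ((hzero η hηc _).sub (hzero φ hφc _)).exists_bound_of_continuous ((cη j).sub (cφ j))
  choose Cd hCd using hbd
  -- limits
  have L1 : ∀ j, L2t μ (fun n x => w x * mconv μ b n (c j) x) (fun x => w x * c j x) := fun j =>
    (L2t_mconv μ b (hc j) (hcc j)).mul_bdd cw.aestronglyMeasurable bw
  have L2 : L2t μ (fun n x => w0 x * (-1 * mconv μ b n G x + ∑ j, (dzR (b j) η x - dzR (b j) φ x)
      * mconv μ b n (c j) x)) (fun x => w0 x * (-1 * G x + ∑ j, (dzR (b j) η x - dzR (b j) φ x)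
      * c j x)) := by
    refine L2t.mul_bdd ?_ cw0.aestronglyMeasurable bw0
    refine L2t.add ?_ (L2t.sum _ fun j => ?_)
    · exact (L2t_mconv μ b hG hGc).mul_bdd (w := fun _ => -1) aestronglyMeasurable_const
        (C := 1) (by simp)
    · exact (L2t_mconv μ b (hc j) (hcc j)).mul_bdd
        ((cη j).sub (cφ j)).aestronglyMeasurable (hCd j)
  have L3 : ∀ j k, L2t μ (fun n x => w0 x * mconv μ b n (H j k) x) (fun x => w0 x * H j k x) :=
    fun j k => (L2t_mconv μ b (hH j k) (hHc j k)).mul_bdd cw0.aestronglyMeasurable bw0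
  have T1 := tendsto_finsetSum Finset.univ fun j _ => (L1 j).integral_sq
  have T2 := L2.integral_sq
  have T3 := tendsto_finsetSum Finset.univ fun j _ =>
    tendsto_finsetSum Finset.univ fun k _ => (L3 j k).integral_sq
  refine le_of_tendsto_of_tendsto T1 ((T2.const_mul 2).add (T3.const_mul (1 / 2))) ?_
  -- eventual support
  have hK : IsCompact (⋃ j, tsupport (c j)) := isCompact_iUnion fun j => hcc j
  obtain ⟨δ, hδ, hδS⟩ := hK.exists_cthickening_subset_open hSo (iUnion_subset hcS)
  have hM : Tendsto (fun n : ℕ => (∑ j, ‖b j‖) / ((n : ℝ) + 1)) atTop (𝓝 0) :=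
    ((tendsto_const_div_atTop_nhds_zero_nat (∑ j, ‖b j‖)).comp (tendsto_add_atTop_nat 1)).congr
      (by intro n; simp)
  filter_upwards [hM.eventually (gt_mem_nhds hδ)] with n hn
  have hα : ∀ j, ContDiff ℝ 2 (mconv μ b n (c j)) := fun j =>
    (contDiff_mconv μ b n (lloc (hc j))).of_le two_le_inf
  have k1 := K1 μ b hφ hη S hlevi (fun j => mconv μ b n (c j)) hα
    (fun j => hcs_mconv μ b n (hcc j)) (by
      intro j x hx
      by_contra h0
      apply hx
      apply hδS
      refine cthickening_mono hn.le _ ?_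
      exact cthickening_subset_of_subset _ (subset_iUnion (fun j => tsupport (c j)) j)
        (mconv_support μ b n h0))
  have ct : ∀ x, ContDiff ℝ 2 (tst μ b n x) := fun x =>
    (contDiff_tst μ b n x).of_le two_le_inf
  have e1 : ∀ x, ∑ j, dz (b j) (mconv μ b n (c j)) x = -1 * mconv μ b n G x := by
    intro x
    have := h1 (tst μ b n x) (ct x) (hcs_tst μ b n x)
    simp only [fun j => dz_mconv μ b n (lloc (hc j)) x (b j), Finset.sum_neg_distrib]
    rw [this]; simp [mconv, tst]
  have e2 : ∀ j k x, dzb (b k) (mconv μ b n (c j)) x - dzb (b j) (mconv μ b n (c k)) x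
      = mconv μ b n (H j k) x := by
    intro j k x
    have := h2 (tst μ b n x) (ct x) (hcs_tst μ b n x) j k
    rw [dzb_mconv μ b n (lloc (hc j)), dzb_mconv μ b n (lloc (hc k))]
    have h3 : mconv μ b n (H j k) x = ∫ y, H j k y * tst μ b n x y ∂μ := rfl
    rw [h3]; linear_combination -this
  simp only [e1, e2] at k1
  have M1 := fun j => integrable_norm_sq ((L1 j).1 n)
  have M2 := integrable_norm_sq (L2.1 n)
  have M3 := fun j k => integrable_norm_sq ((L3 j k).1 n)
  rw [← integral_finsetSum _ fun j _ => M1 j]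
  have r3 : ∑ j, ∑ k, ∫ x, ‖w0 x * mconv μ b n (H j k) x‖ ^ 2 ∂μ
      = ∫ x, ∑ j, ∑ k, ‖w0 x * mconv μ b n (H j k) x‖ ^ 2 ∂μ := by
    rw [integral_finsetSum _ fun j _ => integrable_finsetSum _ fun k _ => M3 j k]
    refine Finset.sum_congr rfl fun j _ => ?_
    rw [integral_finsetSum _ fun k _ => M3 j k]
  rw [r3, ← integral_const_mul, ← integral_const_mul, ← integral_add (M2.const_mul 2)
    ((integrable_finsetSum _ fun j _ => integrable_finsetSum _ fun k _ => M3 j k).const_mul _)]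
  refine le_of_eq_of_le ?_ (k1.trans_eq ?_)
  · congr 1; ext x
    simp only [norm_mul, mul_pow, nw, ← Finset.mul_sum]
    ring
  · congr 1; ext x
    rw [norm_mul, mul_pow, nw0]
    simp only [norm_mul (w0 _), mul_pow, nw0, ← Finset.mul_sum]
    ring

end SteinAux

set_option linter.unusedSectionVars false
set_option linter.unusedSimpArgs false

namespace SteinAux

variable {E : Type*} [NormedAddCommGroup E] [NormedSpace ℂ E]
  [FiniteDimensional ℂ E] [MeasurableSpace E] [BorelSpace E]
  (μ : Measure E) [μ.IsAddHaarMeasure] {N : ℕ} (b : Module.Basis (Fin N) ℂ E)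

/-- test functions -/
def IsTest (Ω : Set E) (v : E → ℂ) : Prop :=
  ContDiff ℝ 2 v ∧ HasCompactSupport v ∧ tsupport v ⊆ Ω

lemma memLp_mul_cc {f w : E → ℂ} (hf : MemLp f 2 μ) (hw : Continuous w)
    (hc : HasCompactSupport w) : MemLp (fun x => w x * f x) 2 μ := by
  obtain ⟨C, hC⟩ := hc.exists_bound_of_continuous hw
  exact memLp_mul_bdd hf hw.aestronglyMeasurable hC

lemma integrable_mul_cc {f w : E → ℂ} (hf : MemLp f 2 μ) (hw : Continuous w)
    (hc : HasCompactSupport w) : Integrable (fun x => w x * f x) μ := by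
  have : ProperSpace E := FiniteDimensional.proper ℂ E
  have := (hf.locallyIntegrable (by norm_num)).integrable_smul_left_of_hasCompactSupport hw hc
  simpa using this

lemma dzR_levi_congr {φ ψ : E → ℝ} {x : E} (h : φ =ᶠ[𝓝 x] ψ) :
    (∀ e, dzR e φ x = dzR e ψ x) ∧ ∀ v, levi φ x v = levi ψ x v := by
  constructor
  · intro e
    apply dz_congr
    filter_upwards [h] with y hy; rw [hy]
  · intro v
    unfold levi
    rw [(h.fderiv (𝕜 := ℝ)).fderiv_eq]

lemma K3 {Ω : Set E} (hΩ : IsOpen Ω) {φ η χ : E → ℝ} (hφ : ContDiffOn ℝ 2 φ Ω)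
    (hη : ContDiffOn ℝ 2 η Ω)
    (hlevi : ∀ x ∈ Ω, ∀ v : Fin N → ℂ,
      2 * ‖∑ j, dzR (b j) η x * v j‖ ^ 2 + Real.exp (η x) * ∑ j, ‖v j‖ ^ 2
        ≤ 1 / 4 * levi φ x (∑ j, v j • b j))
    (hχ : ContDiff ℝ 2 χ) (hχc : HasCompactSupport χ) (hχs : tsupport χ ⊆ Ω)
    (β : Fin N → E → ℂ) (hβ : ∀ j, MemLp (β j) 2 μ) (a : E → ℂ) (ha : MemLp a 2 μ)
    (T1 : ∀ v, IsTest Ω v →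
      ∑ j, ∫ x, β j x * (((Real.exp ((η x - φ x) / 2) : ℝ) : ℂ) * dz (b j) v x) ∂μ
        = ∫ x, a x * (((Real.exp (η x - φ x / 2) : ℝ) : ℂ) * v x) ∂μ)
    (T2 : ∀ v, IsTest Ω v → ∀ j k,
      ∫ x, β j x * (((Real.exp ((φ x - η x) / 2) : ℝ) : ℂ) * dzb (b k) v x) ∂μ
        = ∫ x, β k x * (((Real.exp ((φ x - η x) / 2) : ℝ) : ℂ) * dzb (b j) v x) ∂μ) :
    ∑ j, ∫ x, ‖(χ x : ℂ) * β j x‖ ^ 2 ∂μ ≤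
      2 * ∫ x, ‖-1 * ((χ x : ℂ) * a x)
          + ∑ j, ((Real.exp (-η x / 2) : ℝ) : ℂ) * dzR (b j) χ x * β j x‖ ^ 2 ∂μ
        + 1 / 2 * ∑ j, ∑ k, ∫ x, ‖((Real.exp (-η x / 2) : ℝ) : ℂ) *
          (dzb (b k) (fun y => (χ y : ℂ)) x * β j x
            - dzb (b j) (fun y => (χ y : ℂ)) x * β k x)‖ ^ 2 ∂μ := by
  obtain ⟨θ, hθ, hθc, hθΩ, ⟨S, hSo, hKS, hSΩ, hθ1⟩, hθ01⟩ := exists_cutoff hχc hΩ hχs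
  have hθ2 : ContDiff ℝ 2 θ := hθ.of_le two_le_inf
  obtain ⟨φ', hφ'⟩ : ∃ φ', φ' = fun x => θ x • φ x := ⟨_, rfl⟩
  obtain ⟨η', hη'⟩ : ∃ η', η' = fun x => θ x • η x := ⟨_, rfl⟩
  have cφ : ContDiff ℝ 2 φ' := hφ' ▸ contDiff_smul_of_tsupport hΩ hθ2.contDiffOn hθΩ hφ
  have cη : ContDiff ℝ 2 η' := hη' ▸ contDiff_smul_of_tsupport hΩ hθ2.contDiffOn hθΩ hη
  have sφ : HasCompactSupport φ' := hφ' ▸ hθc.smul_right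
  have sη : HasCompactSupport η' := hη' ▸ hθc.smul_right
  have eφ : ∀ x ∈ S, φ' x = φ x := fun x hx => by simp [hφ', hθ1 x hx]
  have eη : ∀ x ∈ S, η' x = η x := fun x hx => by simp [hη', hθ1 x hx]
  have hlevi' : ∀ x ∈ S, ∀ v : Fin N → ℂ,
      2 * ‖∑ j, dzR (b j) η' x * v j‖ ^ 2 + Real.exp (η' x) * ∑ j, ‖v j‖ ^ 2
        ≤ 1 / 4 * levi φ' x (∑ j, v j • b j) := by
    intro x hx v
    have h1 := dzR_levi_congr (eventually_of_mem (hSo.mem_nhds hx) eφ)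
    have h2 := dzR_levi_congr (eventually_of_mem (hSo.mem_nhds hx) eη)
    rw [h1.2, eη x hx]
    simp only [h2.1]
    exact hlevi x (hSΩ hx) v
  clear hφ' hη' hlevi hφ hη
  -- weights
  set P : E → ℂ := fun x => ((Real.exp (φ' x / 2) : ℝ) : ℂ) with hP
  set Q : E → ℂ := fun x => ((Real.exp (η' x / 2) : ℝ) : ℂ) with hQ
  have P0 : ∀ x, P x ≠ 0 := fun x => by simp [hP]
  have Q0 : ∀ x, Q x ≠ 0 := fun x => by simp [hQ]
  have cP : Continuous P := by have := cφ.continuous; fun_prop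
  have cQ : Continuous Q := by have := cη.continuous; fun_prop
  have i1 : ∀ x, ((Real.exp ((η' x - φ' x) / 2) : ℝ) : ℂ) = Q x / P x := fun x => by
    rw [sub_div, Real.exp_sub]; simp only [hP, hQ]; push_cast; rfl
  have i2 : ∀ x, ((Real.exp (η' x - φ' x / 2) : ℝ) : ℂ) = Q x ^ 2 / P x := fun x => by
    rw [Real.exp_sub, show η' x = η' x / 2 + η' x / 2 by ring, Real.exp_add]; push_cast
    simp only [hP, hQ]; push_cast; ring
  have i3 : ∀ x, ((Real.exp ((φ' x - η' x) / 2) : ℝ) : ℂ) = P x / Q x := fun x => by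
    rw [sub_div, Real.exp_sub]; simp only [hP, hQ]; push_cast; rfl
  have i4 : ∀ x, ((Real.exp (-η' x / 2) : ℝ) : ℂ) = 1 / Q x := fun x => by
    rw [neg_div, Real.exp_neg]; push_cast; simp [hQ]
  have i5 : ∀ x, ((Real.exp (-φ' x / 2) : ℝ) : ℂ) = 1 / P x := fun x => by
    rw [neg_div, Real.exp_neg]; push_cast; simp [hP]
  have i6 : ∀ x, ((Real.exp (-(η' x - φ' x)) : ℝ) : ℂ) = P x ^ 2 / Q x ^ 2 := fun x => by
    rw [show -(η' x - φ' x) = (φ' x / 2 + φ' x / 2) - (η' x / 2 + η' x / 2) by ring,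
      Real.exp_sub, Real.exp_add, Real.exp_add]; simp only [hP, hQ]; push_cast; ring
  -- the function s
  set X : E → ℂ := fun x => (χ x : ℂ) with hX
  have cX : ContDiff ℝ 2 X := contDiff_ofReal hχ
  have hXc : HasCompactSupport X := hχc.comp_left (g := fun x : ℝ => (x : ℂ)) (by simp)
  have hXt : tsupport X ⊆ tsupport χ := by
    apply closure_mono
    intro x hx h0; exact hx (by simp [hX, h0])
  set W : E → ℂ := fun x => ((Real.exp (-(η' x - φ' x)) : ℝ) : ℂ) with hW
  have cW : ContDiff ℝ 2 W := contDiff_ofReal ((cη.sub cφ).neg.exp)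
  set s : E → ℂ := fun x => X x * W x with hs
  have cs : ContDiff ℝ 2 s := cX.mul cW
  have hsc : HasCompactSupport s := hXc.mul_right
  have hst : tsupport s ⊆ tsupport χ := (tsupport_mul_subset_left).trans hXt
  have dW : ∀ x e, dz e W x = (dzR e φ' x - dzR e η' x) * W x := by
    intro x e
    have h := dz_exp_neg (φ := fun y => η' y - φ' y) (x := x)
      ((cη.differentiable (by simp) x).sub (cφ.differentiable (by simp) x)) e
    have h3 := dz_sub e ((contDiff_ofReal cη).differentiable (by simp) x)
      ((contDiff_ofReal cφ).differentiable (by simp) x)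
    simp only [hW]
    rw [h]
    have h4 : dz e (fun y => ((η' y - φ' y : ℝ) : ℂ)) x = dzR e η' x - dzR e φ' x := by
      simp only [dzR]; rw [← h3]; simp
    rw [h4]; ring
  have ds : ∀ x e, dz e s x = W x * (dz e X x + X x * (dzR e φ' x - dzR e η' x)) := by
    intro x e
    simp only [hs]
    rw [dz_mul e (cX.differentiable (by simp) x) (cW.differentiable (by simp) x), dW]
    ring
  have zX : ∀ x ∉ S, X x = 0 := fun x hx =>
    image_eq_zero_of_notMem_tsupport (fun h => hx (hKS (hXt h)))
  have zdz : ∀ x ∉ S, ∀ e, dz e X x = 0 := fun x hx e =>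
    dz_zero_of_notMem _ (fun h => hx (hKS (hXt h)))
  have zdzb : ∀ x ∉ S, ∀ e, dzb e X x = 0 := fun x hx e =>
    dzb_zero_of_notMem _ (fun h => hx (hKS (hXt h)))
  have cdX : ∀ e, Continuous (dz e X) := fun e =>
    (contDiff_dz (k := 1) cX (by norm_num) e).continuous
  have cdbX : ∀ e, Continuous (dzb e X) := fun e =>
    (contDiff_dzb (k := 1) cX (by norm_num) e).continuous
  have cds : ∀ e, Continuous (dz e s) := fun e =>
    (contDiff_dz (k := 1) cs (by norm_num) e).continuous
  have cX0 := cX.continuous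
  have cs0 := cs.continuous
  -- c, G, H
  obtain ⟨c, hc⟩ : ∃ c : Fin N → E → ℂ, c = fun j x => (X x * (P x / Q x)) * β j x := ⟨_, rfl⟩
  obtain ⟨G, hG⟩ : ∃ G : E → ℂ, G = fun x => (X x * P x) * a x
    - ∑ j, (dz (b j) s x * (Q x / P x)) * β j x := ⟨_, rfl⟩
  obtain ⟨H, hH⟩ : ∃ H : Fin N → Fin N → E → ℂ, H = fun j k x =>
    (dzb (b k) X x * (P x / Q x)) * β j x - (dzb (b j) X x * (P x / Q x)) * β k x := ⟨_, rfl⟩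
  have cPQ : Continuous fun x => P x / Q x := cP.div cQ Q0
  have cQP : Continuous fun x => Q x / P x := cQ.div cP P0
  have mc : ∀ j, MemLp (c j) 2 μ := fun j => by
    rw [hc]; exact memLp_mul_cc μ (hβ j) (cX0.mul cPQ) hXc.mul_right
  have sc : ∀ j, tsupport (c j) ⊆ tsupport χ := fun j => by
    rw [hc]; exact tsupport_mul_subset_left.trans (tsupport_mul_subset_left.trans hXt)
  have hcomp : ∀ {f : E → ℂ}, (∀ x ∉ tsupport χ, f x = 0) → HasCompactSupport f := by
    intro f hf
    refine HasCompactSupport.of_support_subset_isCompact hχc ?_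
    intro x hx; by_contra h; exact hx (hf x h)
  have key := K2 μ b cφ cη sφ sη S hSo hlevi' c mc
    (fun j => hχc.of_isClosed_subset (isClosed_tsupport _) (sc j))
    (fun j => (sc j).trans hKS) G ?_ ?_ H ?_ ?_ ?_ ?_
  · refine le_of_eq_of_le ?_ (key.trans_eq ?_)
    · refine Finset.sum_congr rfl fun j _ => ?_
      congr 1; ext x
      have := P0 x; have := Q0 x
      have e : X x * β j x = Q x / P x * (X x * (P x / Q x) * β j x) := by field_simp
      rw [i1, hc]
      exact congrArg (fun z => ‖z‖ ^ 2) e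
    · congr 1
      · congr 2; ext x
        congr 2
        rw [i5, hG]
        simp only [ds, hc, dzR]
        have hp := P0 x; have hq := Q0 x
        have : ∀ j, ((Real.exp (-η x / 2) : ℝ) : ℂ) * dz (b j) (fun y => (χ y : ℂ)) x * β j x
            = 1 / Q x * dz (b j) X x * β j x := by
          intro j
          by_cases hx : x ∈ S
          · rw [← i4, eη x hx]
          · have := zdz x hx (b j)
            simp only [hX] at this ⊢
            rw [this]; simp
        simp only [this]
        have e0 : W x = P x ^ 2 / Q x ^ 2 := i6 x
        rw [e0, mul_add, neg_one_mul, neg_sub, mul_sub, Finset.mul_sum, Finset.mul_sum]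
        rw [sub_add_eq_add_sub, ← Finset.sum_add_distrib, sub_eq_add_neg, add_comm]
        congr 1
        · simp only [hX]; field_simp
        · refine Finset.sum_congr rfl fun j _ => ?_
          field_simp
          ring
      · congr 1
        refine Finset.sum_congr rfl fun j _ => Finset.sum_congr rfl fun k _ => ?_
        congr 1; ext x
        congr 2
        rw [i5, hH]
        have hp := P0 x; have hq := Q0 x
        by_cases hx : x ∈ S
        · rw [← eη x hx, i4]; field_simp
        · have h1 := zdzb x hx (b j); have h2 := zdzb x hx (b k)
          simp only [hX] at h1 h2
          simp [h1, h2, hX]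
  · rw [hG]
    refine (memLp_mul_cc μ ha (cX0.mul cP) hXc.mul_right).sub ?_
    exact memLp_finsetSum _ fun j _ =>
      memLp_mul_cc μ (hβ j) ((cds _).mul cQP) (hcs_dz _ hsc).mul_right
  · apply hcomp
    intro x hx
    have h1 : X x = 0 := image_eq_zero_of_notMem_tsupport (fun h => hx (hXt h))
    have h2 : ∀ j, dz (b j) s x = 0 := fun j => dz_zero_of_notMem _ (fun h => hx (hst h))
    simp [hG, h1, h2]
  · intro j k
    rw [hH]
    exact (memLp_mul_cc μ (hβ j) ((cdbX _).mul cPQ) (hcs_dzb _ hXc).mul_right).sub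
      (memLp_mul_cc μ (hβ k) ((cdbX _).mul cPQ) (hcs_dzb _ hXc).mul_right)
  · intro j k
    apply hcomp
    intro x hx
    have h2 : ∀ j, dzb (b j) X x = 0 := fun j => dzb_zero_of_notMem _ (fun h => hx (hXt h))
    simp [hH, h2]
  · intro v cv hv
    have cv0 := cv.continuous
    have cdv : ∀ e, Continuous (dz e v) := fun e =>
      (contDiff_dz (k := 1) cv (by norm_num) e).continuous
    have t := T1 (fun x => s x * v x) ⟨cs.mul cv, hsc.mul_right,
      tsupport_mul_subset_left.trans (hst.trans hχs)⟩
    have zs : ∀ x ∉ S, s x = 0 := fun x hx => by simp [hs, zX x hx]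
    have zdsv : ∀ x ∉ S, ∀ e, dz e (fun x => s x * v x) x = 0 := fun x hx e =>
      dz_zero_of_notMem _ (fun h => hx (hKS (hst (tsupport_mul_subset_left h))))
    have r1 : ∀ j, ∫ x, β j x * (((Real.exp ((η x - φ x) / 2) : ℝ) : ℂ)
          * dz (b j) (fun x => s x * v x) x) ∂μ
        = ∫ x, c j x * dz (b j) v x ∂μ
          + ∫ x, (dz (b j) s x * (Q x / P x)) * β j x * v x ∂μ := by
      intro j
      rw [← integral_add]
      · congr 1; ext x
        by_cases hx : x ∈ S
        · rw [← eη x hx, ← eφ x hx, i1,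
            dz_mul _ (cs.differentiable (by simp) x) (cv.differentiable (by simp) x)]
          have e0 : W x = P x ^ 2 / Q x ^ 2 := i6 x
          have e1 : s x = X x * W x := rfl
          simp only [hc, e1, e0]
          have hp := P0 x; have hq := Q0 x
          field_simp
          try ring
        · rw [zdsv x hx]
          have h2 : dz (b j) s x = 0 := dz_zero_of_notMem _ (fun h => hx (hKS (hst h)))
          simp [hc, zX x hx, h2]
      · rw [hc]
        refine (integrable_mul_cc μ (hβ j) ((cX0.mul cPQ).mul (cdv (b j)))
          hXc.mul_right.mul_right).congr (Eventually.of_forall fun x => ?_)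
        simp only [Pi.mul_apply]; ring
      · refine (integrable_mul_cc μ (hβ j) (((cds (b j)).mul cQP).mul cv0)
          (hcs_dz _ hsc).mul_right.mul_right).congr (Eventually.of_forall fun x => ?_)
        simp only [Pi.mul_apply]; ring
    simp only [r1, Finset.sum_add_distrib] at t
    have r2 : ∫ x, a x * (((Real.exp (η x - φ x / 2) : ℝ) : ℂ) * (s x * v x)) ∂μ
        = ∫ x, (X x * P x) * a x * v x ∂μ := by
      congr 1; ext x
      by_cases hx : x ∈ S
      · rw [← eη x hx, ← eφ x hx, i2]
        have e0 : W x = P x ^ 2 / Q x ^ 2 := i6 x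
        simp only [hs, e0]
        have hp := P0 x; have hq := Q0 x
        field_simp
      · simp [zs x hx, zX x hx]
    rw [r2] at t
    have r3 : ∫ x, G x * v x ∂μ = ∫ x, (X x * P x) * a x * v x ∂μ
        - ∑ j, ∫ x, (dz (b j) s x * (Q x / P x)) * β j x * v x ∂μ := by
      have j1 : Integrable (fun x => (X x * P x) * a x * v x) μ := by
        refine (integrable_mul_cc μ ha ((cX0.mul cP).mul cv0)
          hXc.mul_right.mul_right).congr (Eventually.of_forall fun x => ?_)
        simp only [Pi.mul_apply]; ring
      have j2 : ∀ j, Integrable (fun x => (dz (b j) s x * (Q x / P x)) * β j x * v x) μ := by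
        intro j
        refine (integrable_mul_cc μ (hβ j) (((cds (b j)).mul cQP).mul cv0)
          (hcs_dz _ hsc).mul_right.mul_right).congr (Eventually.of_forall fun x => ?_)
        simp only [Pi.mul_apply]; ring
      rw [← integral_finsetSum _ fun j _ => j2 j,
        ← integral_sub j1 (integrable_finsetSum _ fun j _ => j2 j)]
      congr 1; ext x
      simp only [hG, sub_mul, Finset.sum_mul]
    rw [r3, ← t]; ring
  · intro v cv hv j k
    have cv0 := cv.continuous
    have cdv : ∀ e, Continuous (dzb e v) := fun e =>
      (contDiff_dzb (k := 1) cv (by norm_num) e).continuous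
    have t := T2 (fun x => X x * v x) ⟨cX.mul cv, hXc.mul_right,
      tsupport_mul_subset_left.trans (hXt.trans hχs)⟩ j k
    have zdXv : ∀ x ∉ S, ∀ e, dzb e (fun x => X x * v x) x = 0 := fun x hx e =>
      dzb_zero_of_notMem _ (fun h => hx (hKS (hXt (tsupport_mul_subset_left h))))
    have j1 : ∀ j k, Integrable (fun x => c j x * dzb (b k) v x) μ := by
      intro j k
      rw [hc]
      refine (integrable_mul_cc μ (hβ j) ((cX0.mul cPQ).mul (cdv (b k)))
          hXc.mul_right.mul_right).congr (Eventually.of_forall fun x => ?_)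
      simp only [Pi.mul_apply]; ring
    have j2 : ∀ j k, Integrable (fun x => (dzb (b k) X x * (P x / Q x)) * β j x * v x) μ := by
      intro j k
      refine (integrable_mul_cc μ (hβ j) (((cdbX (b k)).mul cPQ).mul cv0)
          (hcs_dzb _ hXc).mul_right.mul_right).congr (Eventually.of_forall fun x => ?_)
      simp only [Pi.mul_apply]; ring
    have r1 : ∀ j k, ∫ x, β j x * (((Real.exp ((φ x - η x) / 2) : ℝ) : ℂ)
          * dzb (b k) (fun x => X x * v x) x) ∂μ
        = ∫ x, c j x * dzb (b k) v x ∂μ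
          + ∫ x, (dzb (b k) X x * (P x / Q x)) * β j x * v x ∂μ := by
      intro j k
      rw [← integral_add (j1 j k) (j2 j k)]
      congr 1; ext x
      by_cases hx : x ∈ S
      · rw [← eη x hx, ← eφ x hx, i3,
            dzb_mul _ (cX.differentiable (by simp) x) (cv.differentiable (by simp) x)]
        simp only [hc]
        ring
      · rw [zdXv x hx, zdzb x hx]
        simp [hc, zX x hx]
    rw [r1, r1] at t
    have r3 : ∫ x, H j k x * v x ∂μ = ∫ x, (dzb (b k) X x * (P x / Q x)) * β j x * v x ∂μ
        - ∫ x, (dzb (b j) X x * (P x / Q x)) * β k x * v x ∂μ := by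
      rw [← integral_sub (j2 j k) (j2 k j)]
      congr 1; ext x
      simp only [hH, sub_mul]
    rw [r3]; linear_combination t

end SteinAux

set_option linter.unusedSectionVars false
set_option linter.unusedSimpArgs false

namespace SteinAux

variable {E : Type*} [NormedAddCommGroup E] [NormedSpace ℂ E]
  [FiniteDimensional ℂ E] [MeasurableSpace E] [BorelSpace E]
  (μ : Measure E) [μ.IsAddHaarMeasure] {N : ℕ} (b : Module.Basis (Fin N) ℂ E)

lemma cont_weight {Ω : Set E} (hΩ : IsOpen Ω) {g w : E → ℂ} (hg : Continuous g)
    (hs : tsupport g ⊆ Ω) (hw : ContinuousOn w Ω) : Continuous (fun x => w x * g x) := by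
  rw [continuous_iff_continuousAt]
  intro x
  by_cases hx : x ∈ Ω
  · exact ((hw x hx).continuousAt (hΩ.mem_nhds hx)).mul hg.continuousAt
  · have h1 : x ∉ tsupport g := fun h => hx (hs h)
    have h2 : (fun x => w x * g x) =ᶠ[𝓝 x] fun _ => 0 := by
      filter_upwards [notMem_tsupport_iff_eventuallyEq.1 h1] with y hy
      simp [hy]
    exact h2.continuousAt

/-- a sequence of cutoff functions adapted to `η` -/
def CutSeq (Ω : Set E) (η : E → ℝ) (χ : ℕ → E → ℝ) : Prop :=
  ∀ n, ContDiff ℝ 2 (χ n) ∧ HasCompactSupport (χ n) ∧ tsupport (χ n) ⊆ Ω ∧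
    (∀ x, 0 ≤ χ n x ∧ χ n x ≤ 1) ∧
    (∀ x ∈ Ω, ∀ j, ‖dzR (b j) (χ n) x‖ ^ 2 ≤ Real.exp (η x))

lemma exp_mul_le {t : ℝ} {z : ℂ} (h : ‖z‖ ^ 2 ≤ Real.exp t) :
    ‖((Real.exp (-t / 2) : ℝ) : ℂ) * z‖ ≤ 1 := by
  have h1 : ‖z‖ ≤ Real.exp (t / 2) := by
    apply le_of_sq_le_sq _ (Real.exp_pos _).le
    rw [← Real.exp_nat_mul]; simpa [mul_div_cancel₀] using h
  rw [norm_mul, Complex.norm_of_nonneg (Real.exp_pos _).le]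
  calc _ ≤ Real.exp (-t / 2) * Real.exp (t / 2) := by gcongr
    _ = 1 := by rw [← Real.exp_add]; ring_nf; simp

lemma K4 {Ω : Set E} (hΩ : IsOpen Ω) {φ η : E → ℝ} (hφ : ContDiffOn ℝ 2 φ Ω)
    (hη : ContDiffOn ℝ 2 η Ω)
    (hlevi : ∀ x ∈ Ω, ∀ v : Fin N → ℂ,
      2 * ‖∑ j, dzR (b j) η x * v j‖ ^ 2 + Real.exp (η x) * ∑ j, ‖v j‖ ^ 2
        ≤ 1 / 4 * levi φ x (∑ j, v j • b j))
    {χ : ℕ → E → ℝ} (hχ : CutSeq b Ω η χ) (hχ1 : ∀ x ∈ Ω, ∀ᶠ n in atTop, χ n =ᶠ[𝓝 x] fun _ => 1)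
    (β : Fin N → E → ℂ) (hβ : ∀ j, MemLp (β j) 2 μ) (a : E → ℂ) (ha : MemLp a 2 μ)
    (zβ : ∀ j, ∀ x ∉ Ω, β j x = 0) (za : ∀ x ∉ Ω, a x = 0)
    (T1 : ∀ v, IsTest Ω v →
      ∑ j, ∫ x, β j x * (((Real.exp ((η x - φ x) / 2) : ℝ) : ℂ) * dz (b j) v x) ∂μ
        = ∫ x, a x * (((Real.exp (η x - φ x / 2) : ℝ) : ℂ) * v x) ∂μ)
    (T2 : ∀ v, IsTest Ω v → ∀ j k,
      ∫ x, β j x * (((Real.exp ((φ x - η x) / 2) : ℝ) : ℂ) * dzb (b k) v x) ∂μ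
        = ∫ x, β k x * (((Real.exp ((φ x - η x) / 2) : ℝ) : ℂ) * dzb (b j) v x) ∂μ) :
    ∑ j, ∫ x, ‖β j x‖ ^ 2 ∂μ ≤ 2 * ∫ x, ‖a x‖ ^ 2 ∂μ := by
  have key := fun n => K3 μ b hΩ hφ hη hlevi (hχ n).1 (hχ n).2.1 (hχ n).2.2.1 β hβ a ha T1 T2
  have cX : ∀ n, ContDiff ℝ 2 (fun x => (χ n x : ℂ)) := fun n => contDiff_ofReal (hχ n).1
  have hXt : ∀ n, tsupport (fun x => (χ n x : ℂ)) ⊆ Ω := fun n => by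
    refine (closure_mono ?_ : _ ⊆ tsupport (χ n)).trans (hχ n).2.2.1
    intro x hx h0; exact hx (by simp [h0])
  have cw : ContinuousOn (fun x => ((Real.exp (-η x / 2) : ℝ) : ℂ)) Ω := by
    have := hη.continuousOn; fun_prop
  have tdz : ∀ n e, tsupport (dz e (fun x => (χ n x : ℂ))) ⊆ Ω := fun n e => by
    refine (closure_minimal ?_ (isClosed_tsupport _)).trans (hXt n)
    intro x hx; by_contra h; exact hx (dz_zero_of_notMem _ h)
  have tdzb : ∀ n e, tsupport (dzb e (fun x => (χ n x : ℂ))) ⊆ Ω := fun n e => by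
    refine (closure_minimal ?_ (isClosed_tsupport _)).trans (hXt n)
    intro x hx; by_contra h; exact hx (dzb_zero_of_notMem _ h)
  have c1 : ∀ n e, Continuous fun x => ((Real.exp (-η x / 2) : ℝ) : ℂ) * dzR e (χ n) x :=
    fun n e => cont_weight hΩ (continuous_dzR (hχ n).1 e) (tdz n e) cw
  have c2 : ∀ n e, Continuous fun x => ((Real.exp (-η x / 2) : ℝ) : ℂ) *
      dzb e (fun y => (χ n y : ℂ)) x :=
    fun n e => cont_weight hΩ (contDiff_dzb (k := 1) (cX n) (by norm_num) e).continuous (tdzb n e) cw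
  have b1 : ∀ n x j, ‖((Real.exp (-η x / 2) : ℝ) : ℂ) * dzR (b j) (χ n) x‖ ≤ 1 := by
    intro n x j
    by_cases hx : x ∈ Ω
    · exact exp_mul_le ((hχ n).2.2.2.2 x hx j)
    · have : dzR (b j) (χ n) x = 0 := dz_zero_of_notMem _ fun h => hx (hXt n h)
      simp [this]
  have nb : ∀ n x j, ‖dzb (b j) (fun y => (χ n y : ℂ)) x‖ = ‖dzR (b j) (χ n) x‖ := by
    intro n x j; rw [dzb_ofReal, RCLike.norm_conj]; rfl
  have b2 : ∀ n x j, ‖((Real.exp (-η x / 2) : ℝ) : ℂ) * dzb (b j) (fun y => (χ n y : ℂ)) x‖ ≤ 1 := by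
    intro n x j
    have := b1 n x j
    rw [norm_mul] at this ⊢
    rwa [nb]
  have b0 : ∀ n x, ‖(χ n x : ℂ)‖ ≤ 1 := fun n x => by
    rw [Complex.norm_of_nonneg ((hχ n).2.2.2.1 x).1]; exact ((hχ n).2.2.2.1 x).2
  have e1 : ∀ x ∈ Ω, ∀ᶠ n in atTop, χ n x = 1 ∧ (∀ j, dzR (b j) (χ n) x = 0) ∧
      ∀ j, dzb (b j) (fun y => (χ n y : ℂ)) x = 0 := by
    intro x hx
    filter_upwards [hχ1 x hx] with n hn
    have hn' : (fun y => (χ n y : ℂ)) =ᶠ[𝓝 x] fun _ => 1 := by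
      filter_upwards [hn] with y hy; simp [hy]
    refine ⟨hn.eq_of_nhds, fun j => ?_, fun j => ?_⟩
    · exact (dz_congr _ hn').trans (by simp [dz])
    · exact (dzb_congr _ hn').trans (by simp [dzb])
  have A1 : ∀ j, Tendsto (fun n => ∫ x, ‖(χ n x : ℂ) * β j x‖ ^ 2 ∂μ) atTop
      (𝓝 (∫ x, ‖β j x‖ ^ 2 ∂μ)) := by
    intro j
    refine tendsto_integral_of_dominated_convergence (fun x => ‖β j x‖ ^ 2) ?_
      (integrable_norm_sq (hβ j)) ?_ ?_
    · intro n
      exact (((cX n).continuous.aestronglyMeasurable.mul (hβ j).1).norm.pow 2)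
    · intro n
      refine Eventually.of_forall fun x => ?_
      rw [Real.norm_of_nonneg (by positivity), norm_mul]
      gcongr
      exact mul_le_of_le_one_left (norm_nonneg _) (b0 n x)
    · refine Eventually.of_forall fun x => ?_
      by_cases hx : x ∈ Ω
      · refine tendsto_const_nhds.congr' ?_
        filter_upwards [e1 x hx] with n hn
        simp [hn.1]
      · simp [zβ j x hx]
  have A2 : Tendsto (fun n => ∫ x, ‖-1 * ((χ n x : ℂ) * a x)
          + ∑ j, ((Real.exp (-η x / 2) : ℝ) : ℂ) * dzR (b j) (χ n) x * β j x‖ ^ 2 ∂μ) atTop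
      (𝓝 (∫ x, ‖a x‖ ^ 2 ∂μ)) := by
    have hm : MemLp (fun x => ‖a x‖ + ∑ j, ‖β j x‖) 2 μ :=
      ha.norm.add (memLp_finsetSum _ fun j _ => (hβ j).norm)
    refine tendsto_integral_of_dominated_convergence (fun x => (‖a x‖ + ∑ j, ‖β j x‖) ^ 2) ?_
      ?_ ?_ ?_
    · intro n
      refine AEStronglyMeasurable.pow (AEStronglyMeasurable.norm (AEStronglyMeasurable.add ?_ ?_)) 2
      · exact ((cX n).continuous.aestronglyMeasurable.mul ha.1).const_mul _
      · exact Finset.aestronglyMeasurable_fun_sum _ fun j _ =>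
          ((c1 n (b j)).aestronglyMeasurable.mul (hβ j).1)
    · exact hm.integrable_sq
    · intro n
      refine Eventually.of_forall fun x => ?_
      rw [Real.norm_of_nonneg (by positivity)]
      gcongr
      refine (norm_add_le _ _).trans (add_le_add ?_ ((norm_sum_le _ _).trans
        (Finset.sum_le_sum fun j _ => ?_)))
      · simp only [neg_mul, one_mul, norm_neg, norm_mul]
        exact mul_le_of_le_one_left (norm_nonneg _) (b0 n x)
      · rw [norm_mul]
        exact mul_le_of_le_one_left (norm_nonneg _) (b1 n x j)
    · refine Eventually.of_forall fun x => ?_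
      by_cases hx : x ∈ Ω
      · refine tendsto_const_nhds.congr' ?_
        filter_upwards [e1 x hx] with n hn
        simp [hn.1, hn.2.1]
      · simp [zβ _ x hx, za x hx]
  have A3 : ∀ j k, Tendsto (fun n => ∫ x, ‖((Real.exp (-η x / 2) : ℝ) : ℂ) *
          (dzb (b k) (fun y => (χ n y : ℂ)) x * β j x
            - dzb (b j) (fun y => (χ n y : ℂ)) x * β k x)‖ ^ 2 ∂μ) atTop (𝓝 0) := by
    intro j k
    have hm : MemLp (fun x => ‖β j x‖ + ‖β k x‖) 2 μ := (hβ j).norm.add (hβ k).norm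
    rw [show (0:ℝ) = ∫ x, (0:ℝ) ∂μ by simp]
    have re : ∀ n x, ((Real.exp (-η x / 2) : ℝ) : ℂ) *
          (dzb (b k) (fun y => (χ n y : ℂ)) x * β j x
            - dzb (b j) (fun y => (χ n y : ℂ)) x * β k x) =
          (((Real.exp (-η x / 2) : ℝ) : ℂ) * dzb (b k) (fun y => (χ n y : ℂ)) x) * β j x -
          (((Real.exp (-η x / 2) : ℝ) : ℂ) * dzb (b j) (fun y => (χ n y : ℂ)) x) * β k x :=
      fun n x => by ring
    simp only [re]
    refine tendsto_integral_of_dominated_convergence (fun x => (‖β j x‖ + ‖β k x‖) ^ 2) ?_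
      ?_ ?_ ?_
    · intro n
      refine AEStronglyMeasurable.pow (AEStronglyMeasurable.norm (AEStronglyMeasurable.sub ?_ ?_)) 2
      · exact (c2 n (b k)).aestronglyMeasurable.mul (hβ j).1
      · exact (c2 n (b j)).aestronglyMeasurable.mul (hβ k).1
    · exact hm.integrable_sq
    · intro n
      refine Eventually.of_forall fun x => ?_
      rw [Real.norm_of_nonneg (by positivity)]
      gcongr
      refine (norm_sub_le _ _).trans (add_le_add ?_ ?_)
      · rw [norm_mul]
        exact mul_le_of_le_one_left (norm_nonneg _) (b2 n x k)
      · rw [norm_mul]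
        exact mul_le_of_le_one_left (norm_nonneg _) (b2 n x j)
    · refine Eventually.of_forall fun x => ?_
      by_cases hx : x ∈ Ω
      · refine tendsto_const_nhds.congr' ?_
        filter_upwards [e1 x hx] with n hn
        simp [hn.2.2]
      · simp [zβ _ x hx]
  have L := tendsto_finsetSum (Finset.univ) fun j _ => A1 j
  have R := (A2.const_mul 2).add ((tendsto_finsetSum (Finset.univ) fun j _ =>
    tendsto_finsetSum (Finset.univ) fun k _ => A3 j k).const_mul (1 / 2))
  have := le_of_tendsto_of_tendsto' L R key
  simpa using this

end SteinAux

set_option linter.unusedSectionVars false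
set_option linter.unusedSimpArgs false

namespace SteinAux

variable {E : Type*} [NormedAddCommGroup E] [NormedSpace ℂ E]
  [FiniteDimensional ℂ E] [MeasurableSpace E] [BorelSpace E]
  (μ : Measure E) [μ.IsAddHaarMeasure] {N : ℕ} (b : Module.Basis (Fin N) ℂ E)

lemma riesz_aux {V H : Type*} [AddCommGroup V] [Module ℂ V] [NormedAddCommGroup H]
    [InnerProductSpace ℂ H] [CompleteSpace H] (T : V →ₗ[ℂ] H) (l : V →ₗ[ℂ] ℂ) (C : ℝ)
    (h : ∀ v, ‖l v‖ ≤ C * ‖T v‖) : ∃ u : H, ∀ v, l v = inner ℂ u (T v) := by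
  obtain ⟨g, hg⟩ := T.rangeRestrict.exists_rightInverse_of_surjective (LinearMap.range_rangeRestrict T)
  have hg' : ∀ y : LinearMap.range T, T (g y) = y := fun y => by
    have := congrArg (fun f => ((f y : LinearMap.range T) : H)) hg
    simpa using this
  let l' : LinearMap.range T →L[ℂ] ℂ := (l ∘ₗ g).mkContinuous C (fun y => by
    have := h (g y); rw [hg'] at this; simpa using this)
  obtain ⟨L, hL, -⟩ := exists_extension_norm_eq (LinearMap.range T) l'
  refine ⟨(InnerProductSpace.toDual ℂ H).symm L, fun v => ?_⟩
  rw [InnerProductSpace.toDual_symm_apply]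
  have h1 := hL ⟨T v, LinearMap.mem_range_self T v⟩
  rw [h1]
  have h2 := h (v - g ⟨T v, LinearMap.mem_range_self T v⟩)
  rw [map_sub T, hg'] at h2
  simp only [sub_self, norm_zero, mul_zero, norm_le_zero_iff, map_sub] at h2
  rw [sub_eq_zero] at h2
  rw [h2]; rfl

lemma proj_aux {H : Type*} [NormedAddCommGroup H]
    [InnerProductSpace ℂ H] [CompleteSpace H] (S : Set H) (y : H) :
    ∃ z : H, (∀ s ∈ S, inner ℂ s z = 0) ∧
      ∀ w : H, (∀ s ∈ S, inner ℂ s w = 0) → inner ℂ w y = inner ℂ w z := by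
  have memZ : ∀ y : H, y ∈ (Submodule.span ℂ S)ᗮ ↔ ∀ s ∈ S, inner ℂ s y = 0 := by
    intro y
    constructor
    · intro hy s hs; exact hy s (Submodule.subset_span hs)
    · intro h s hs
      induction hs using Submodule.span_induction with
      | mem x hx => exact h x hx
      | zero => simp
      | add x y _ _ h1 h2 => rw [inner_add_left, h1, h2, add_zero]
      | smul c x _ h1 => rw [inner_smul_left, h1, mul_zero]
  refine ⟨(Submodule.span ℂ S)ᗮ.starProjection y,
    (memZ _).1 (Submodule.starProjection_apply_mem _ _), fun w hw => ?_⟩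
  have hw' := (memZ w).2 hw
  have h := Submodule.sub_starProjection_mem_orthogonal (K := (Submodule.span ℂ S)ᗮ) y w hw'
  rw [inner_sub_right, sub_eq_zero] at h
  exact h

lemma inner_ae {X : Type*} [MeasurableSpace X] {ν : Measure X} (x y : Lp ℂ 2 ν) {f g : X → ℂ}
    (hx : x =ᵐ[ν] f) (hy : y =ᵐ[ν] g) : inner ℂ x y = ∫ t, g t * conj (f t) ∂ν := by
  rw [L2.inner_def]
  refine integral_congr_ae ?_
  filter_upwards [hx, hy] with t h1 h2
  simp [h1, h2, RCLike.inner_apply]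

lemma isTest_conj {Ω : Set E} {v : E → ℂ} (h : IsTest Ω v) : IsTest Ω (fun x => conj (v x)) := by
  have e : tsupport (fun x => conj (v x)) = tsupport v := by
    unfold tsupport; congr 1; ext x; simp
  refine ⟨Complex.conjCLE.contDiff.comp h.1, ?_, ?_⟩
  · unfold HasCompactSupport; rw [e]; exact h.2.1
  · rw [e]; exact h.2.2

lemma tsupport_dz {f : E → ℂ} (e : E) : tsupport (dz e f) ⊆ tsupport f := by
  refine closure_minimal ?_ (isClosed_tsupport _)
  intro x hx; by_contra h; exact hx (dz_zero_of_notMem _ h)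

lemma tsupport_dzb {f : E → ℂ} (e : E) : tsupport (dzb e f) ⊆ tsupport f := by
  refine closure_minimal ?_ (isClosed_tsupport _)
  intro x hx; by_contra h; exact hx (dzb_zero_of_notMem _ h)

lemma memLp_weight {Ω : Set E} (hΩ : IsOpen Ω) {g w : E → ℂ} (hg : Continuous g)
    (hc : HasCompactSupport g) (hs : tsupport g ⊆ Ω) (hw : ContinuousOn w Ω) :
    MemLp (fun x => w x * g x) 2 (μ.restrict Ω) :=
  ((cont_weight hΩ hg hs hw).memLp_of_hasCompactSupport hc.mul_left).restrict Ω

lemma ibp_dz {f g : E → ℂ} (hf : ContDiff ℝ 1 f) (hg : ContDiff ℝ 1 g) (hc : HasCompactSupport g)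
    (e : E) : ∫ x, f x * dz e g x ∂μ = - ∫ x, dz e f x * g x ∂μ := by
  have h := integral_dz_zero μ (hf.mul hg) hc.mul_left e
  have cf : Continuous (dz e f) := (contDiff_dz (k := 0) hf (by norm_num) e).continuous
  have cg : Continuous (dz e g) := (contDiff_dz (k := 0) hg (by norm_num) e).continuous
  have e1 : ∀ x, dz e (fun y => f y * g y) x = dz e f x * g x + f x * dz e g x := fun x =>
    dz_mul e (hf.differentiable (by simp) x) (hg.differentiable (by simp) x)
  have h' : ∫ x, (dz e f x * g x + f x * dz e g x) ∂μ = 0 := by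
    rw [← h]; congr 1; ext x; exact (e1 x).symm
  rw [integral_add] at h'
  · linear_combination h'
  · exact (cf.mul hg.continuous).integrable_of_hasCompactSupport hc.mul_left
  · exact (hf.continuous.mul cg).integrable_of_hasCompactSupport (hcs_dz _ hc).mul_left

lemma ibp_dzb {f g : E → ℂ} (hf : ContDiff ℝ 1 f) (hg : ContDiff ℝ 1 g) (hc : HasCompactSupport g)
    (e : E) : ∫ x, f x * dzb e g x ∂μ = - ∫ x, dzb e f x * g x ∂μ := by
  have h := integral_dzb_zero μ (hf.mul hg) hc.mul_left e
  have cf : Continuous (dzb e f) := (contDiff_dzb (k := 0) hf (by norm_num) e).continuous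
  have cg : Continuous (dzb e g) := (contDiff_dzb (k := 0) hg (by norm_num) e).continuous
  have e1 : ∀ x, dzb e (fun y => f y * g y) x = dzb e f x * g x + f x * dzb e g x := fun x =>
    dzb_mul e (hf.differentiable (by simp) x) (hg.differentiable (by simp) x)
  have h' : ∫ x, (dzb e f x * g x + f x * dzb e g x) ∂μ = 0 := by
    rw [← h]; congr 1; ext x; exact (e1 x).symm
  rw [integral_add] at h'
  · linear_combination h'
  · exact (cf.mul hg.continuous).integrable_of_hasCompactSupport hc.mul_left
  · exact (hf.continuous.mul cg).integrable_of_hasCompactSupport (hcs_dzb _ hc).mul_left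

lemma ibp_dzb_dzb {f g : E → ℂ} (hf : ContDiff ℝ 2 f) (hg : ContDiff ℝ 2 g)
    (hc : HasCompactSupport g) (d e : E) :
    ∫ x, dzb d f x * dzb e g x ∂μ = ∫ x, dzb e f x * dzb d g x ∂μ := by
  have hfd : ∀ d, ContDiff ℝ 1 (dzb d f) := fun d => contDiff_dzb (k := 1) hf (by norm_num) d
  rw [ibp_dzb μ (hfd d) (hg.of_le (by norm_num)) hc e, ibp_dzb μ (hfd e) (hg.of_le (by norm_num)) hc d]
  congr 2; ext x
  rw [dzb_dzb_comm hf]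

/-- integral over `Ω` equals the full integral -/
lemma setInt_eq {Ω : Set E} {F : E → ℂ} (h : ∀ x ∉ Ω, F x = 0) :
    ∫ x in Ω, F x ∂μ = ∫ x, F x ∂μ :=
  setIntegral_eq_integral_of_forall_compl_eq_zero h

end SteinAux

set_option linter.unusedSectionVars false
set_option linter.unusedSimpArgs false

namespace SteinAux

variable {E : Type*} [NormedAddCommGroup E] [NormedSpace ℂ E]
  [FiniteDimensional ℂ E] [MeasurableSpace E] [BorelSpace E]
  (μ : Measure E) [μ.IsAddHaarMeasure] {N : ℕ} (b : Module.Basis (Fin N) ℂ E)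

set_option maxHeartbeats 1000000 in
theorem l2_existence {Ω : Set E} (hΩ : IsOpen Ω) {φ η : E → ℝ} (hφ : ContDiffOn ℝ 2 φ Ω)
    (hη : ContDiffOn ℝ 2 η Ω)
    (hlevi : ∀ x ∈ Ω, ∀ v : Fin N → ℂ,
      2 * ‖∑ j, dzR (b j) η x * v j‖ ^ 2 + Real.exp (η x) * ∑ j, ‖v j‖ ^ 2
        ≤ 1 / 4 * levi φ x (∑ j, v j • b j))
    {χ : ℕ → E → ℝ} (hχ : CutSeq b Ω η χ) (hχ1 : ∀ x ∈ Ω, ∀ᶠ n in atTop, χ n =ᶠ[𝓝 x] fun _ => 1)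
    (f : Fin N → E → ℂ)
    (hf : ∀ j, MemLp (fun x => ((Real.exp ((η x - φ x) / 2) : ℝ) : ℂ) * f j x) 2 (μ.restrict Ω))
    (hcl : ∀ v, IsTest Ω v → ∀ j k,
      ∫ x in Ω, f j x * dzb (b k) v x ∂μ = ∫ x in Ω, f k x * dzb (b j) v x ∂μ) :
    ∃ u : E → ℂ, MemLp (fun x => ((Real.exp (η x - φ x / 2) : ℝ) : ℂ) * u x) 2 (μ.restrict Ω) ∧
      ∀ v, IsTest Ω v → ∀ j, ∫ x in Ω, u x * dzb (b j) v x ∂μ = - ∫ x in Ω, f j x * v x ∂μ := by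
  classical
  set ν := μ.restrict Ω with hν
  -- weights
  obtain ⟨A, hA⟩ : ∃ A : E → ℂ, A = fun x => ((Real.exp ((φ x - η x) / 2) : ℝ) : ℂ) := ⟨_, rfl⟩
  obtain ⟨B, hB⟩ : ∃ B : E → ℂ, B = fun x => ((Real.exp ((η x - φ x) / 2) : ℝ) : ℂ) := ⟨_, rfl⟩
  obtain ⟨C, hC⟩ : ∃ C : E → ℂ, C = fun x => ((Real.exp (η x - φ x / 2) : ℝ) : ℂ) := ⟨_, rfl⟩
  obtain ⟨C', hC'⟩ : ∃ C' : E → ℂ, C' = fun x => ((Real.exp (-(η x - φ x / 2)) : ℝ) : ℂ) := ⟨_, rfl⟩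
  have AB : ∀ x, A x * B x = 1 := fun x => by
    simp only [hA, hB]; rw [← ofReal_mul, ← Real.exp_add]; ring_nf; simp
  have CC : ∀ x, C x * C' x = 1 := fun x => by
    simp only [hC, hC']; rw [← ofReal_mul, ← Real.exp_add]; ring_nf; simp
  have rA : ∀ x, conj (A x) = A x := fun x => by rw [hA]; exact conj_ofReal _
  have rB : ∀ x, conj (B x) = B x := fun x => by rw [hB]; exact conj_ofReal _
  have rC : ∀ x, conj (C x) = C x := fun x => by rw [hC]; exact conj_ofReal _
  have rC' : ∀ x, conj (C' x) = C' x := fun x => by rw [hC']; exact conj_ofReal _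
  have cφ := hφ.continuousOn
  have cη := hη.continuousOn
  have cA : ContinuousOn A Ω := by rw [hA]; fun_prop
  have cB : ContinuousOn B Ω := by rw [hB]; fun_prop
  have cC : ContinuousOn C Ω := by rw [hC]; fun_prop
  have cC' : ContinuousOn C' Ω := by rw [hC']; fun_prop
  have hf' : ∀ j, MemLp (fun x => B x * f j x) 2 ν := fun j => by rw [hB]; exact hf j
  -- test function facts
  have tdz : ∀ {v}, IsTest Ω v → ∀ e, Continuous (dz e v) ∧ HasCompactSupport (dz e v) ∧
      tsupport (dz e v) ⊆ Ω := fun hv e =>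
    ⟨(contDiff_dz (k := 1) hv.1 (by norm_num) e).continuous, hcs_dz _ hv.2.1,
      (tsupport_dz e).trans hv.2.2⟩
  have tdzb : ∀ {v}, IsTest Ω v → ∀ e, Continuous (dzb e v) ∧ HasCompactSupport (dzb e v) ∧
      tsupport (dzb e v) ⊆ Ω := fun hv e =>
    ⟨(contDiff_dzb (k := 1) hv.1 (by norm_num) e).continuous, hcs_dzb _ hv.2.1,
      (tsupport_dzb e).trans hv.2.2⟩
  have z0 : ∀ {g : E → ℂ}, tsupport g ⊆ Ω → ∀ x ∉ Ω, g x = 0 := fun hg x hx =>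
    image_eq_zero_of_notMem_tsupport fun h => hx (hg h)
  -- the set S'
  let SS : Set (PiLp 2 fun _ : Fin N => Lp ℂ 2 ν) := {s | ∃ v, IsTest Ω v ∧ ∃ j k, 
    ∀ i, s i =ᵐ[ν] fun x => (if i = j then A x * dz (b k) v x else 0)
      - (if i = k then A x * dz (b j) v x else 0)}
  have mS : ∀ {v}, IsTest Ω v → ∀ j k i, MemLp (fun x => (if i = j then A x * dz (b k) v x else 0)
      - (if i = k then A x * dz (b j) v x else 0)) 2 ν := by
    intro v hv j k i
    have m1 : ∀ e, MemLp (fun x => A x * dz e v x) 2 ν := fun e =>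
      memLp_weight μ hΩ (tdz hv e).1 (tdz hv e).2.1 (tdz hv e).2.2 cA
    refine MemLp.sub (f := fun x => if i = j then A x * dz (b k) v x else 0)
      (g := fun x => if i = k then A x * dz (b j) v x else 0) ?_ ?_
    · by_cases h : i = j
      · simpa [h] using m1 (b k)
      · simp [h]
    · by_cases h : i = k
      · simpa [h] using m1 (b j)
      · simp [h]
  -- inner product with S'
  have inS : ∀ {v}, IsTest Ω v → ∀ j k, ∀ s : PiLp 2 fun _ : Fin N => Lp ℂ 2 ν,
      (∀ i, s i =ᵐ[ν] fun x => (if i = j then A x * dz (b k) v x else 0)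
      - (if i = k then A x * dz (b j) v x else 0)) → ∀ y : PiLp 2 fun _ : Fin N => Lp ℂ 2 ν,
      inner ℂ s y = ∫ x, y j x * (A x * dzb (b k) (fun x => conj (v x)) x) ∂ν
        - ∫ x, y k x * (A x * dzb (b j) (fun x => conj (v x)) x) ∂ν := by
    intro v hv j k s hs y
    have m1 : ∀ e, MemLp (fun x => A x * dz e v x) 2 ν := fun e =>
      memLp_weight μ hΩ (tdz hv e).1 (tdz hv e).2.1 (tdz hv e).2.2 cA
    rw [PiLp.inner_apply]
    have e1 : ∀ i, inner ℂ (s i) (y i) = (if i = j then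
        ∫ x, y i x * (A x * dzb (b k) (fun x => conj (v x)) x) ∂ν else 0)
        - (if i = k then ∫ x, y i x * (A x * dzb (b j) (fun x => conj (v x)) x) ∂ν else 0) := by
      intro i
      have ii : ∀ e, Integrable (fun x => y i x * (A x * dzb e (fun x => conj (v x)) x)) ν := by
        intro e
        have h1 := L2.integrable_inner (𝕜 := ℂ) ((m1 e).toLp _) (y i)
        refine h1.congr ?_
        filter_upwards [(m1 e).coeFn_toLp] with x hx
        rw [RCLike.inner_apply, hx, dzb_conj]
        simp [rA]
      rw [inner_ae (s i) (y i) (hs i) (ae_eq_refl _)]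
      have e2 : ∀ x, y i x * conj ((if i = j then A x * dz (b k) v x else 0)
          - (if i = k then A x * dz (b j) v x else 0)) =
          (if i = j then y i x * (A x * dzb (b k) (fun x => conj (v x)) x) else 0)
        - (if i = k then y i x * (A x * dzb (b j) (fun x => conj (v x)) x) else 0) := by
        intro x
        simp only [dzb_conj]
        split_ifs <;> simp [rA, mul_sub]
      simp only [e2]
      by_cases h1 : i = j <;> by_cases h2 : i = k <;> simp only [h1, h2, if_true, if_false]
      · subst h1; subst h2; simp
      · subst h1; simp [h2]
      · subst h2; simp [h1, integral_neg]
      · simp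
    simp only [e1, Finset.sum_sub_distrib, Finset.sum_ite_eq', Finset.mem_univ, if_true]
  let Z : Set (PiLp 2 fun _ : Fin N => Lp ℂ 2 ν) := {y | ∀ s ∈ SS, inner ℂ s y = 0}
  have memZ : ∀ y, y ∈ Z ↔ ∀ s ∈ SS, inner ℂ s y = 0 := fun y => Iff.rfl
  -- elements of Z satisfy T2
  have ZT2 : ∀ y ∈ Z, ∀ v, IsTest Ω v → ∀ j k,
      ∫ x, y j x * (A x * dzb (b k) v x) ∂ν = ∫ x, y k x * (A x * dzb (b j) v x) ∂ν := by
    intro y hy v hv j k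
    have hv' := isTest_conj hv
    have h := (memZ y).1 hy (WithLp.toLp 2 fun i => (mS hv' j k i).toLp _)
      ⟨_, hv', j, k, fun i => (mS hv' j k i).coeFn_toLp⟩
    rw [inS hv' j k _ (fun i => (mS hv' j k i).coeFn_toLp)] at h
    simp only [Complex.conj_conj] at h
    linear_combination h
  -- elements Bw
  have mB : ∀ {w}, IsTest Ω w → ∀ e, MemLp (fun x => B x * dzb e w x) 2 ν := fun hw e =>
    memLp_weight μ hΩ (tdzb hw e).1 (tdzb hw e).2.1 (tdzb hw e).2.2 cB
  have BZ : ∀ {w} (hw : IsTest Ω w), (WithLp.toLp 2 fun i => (mB hw (b i)).toLp _ :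
      PiLp 2 fun _ : Fin N => Lp ℂ 2 ν) ∈ Z := by
    intro w hw
    rw [memZ]
    rintro s ⟨v, hv, j, k, hs⟩
    rw [inS hv j k s hs]
    have hv' := isTest_conj hv
    have e : ∀ i l, ∫ x, ((mB hw (b i)).toLp _ : E → ℂ) x *
        (A x * dzb (b l) (fun x => conj (v x)) x) ∂ν =
        ∫ x, dzb (b l) (fun x => conj (v x)) x * dzb (b i) w x ∂μ := by
      intro i l
      rw [← setInt_eq μ (Ω := Ω)]
      · refine integral_congr_ae ?_
        filter_upwards [(mB hw (b i)).coeFn_toLp] with x hx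
        rw [hx]
        linear_combination (dzb (b l) (fun x => conj (v x)) x * dzb (b i) w x) * AB x
      · intro x hx
        rw [z0 (tdzb hw (b i)).2.2 x hx, mul_zero]
    change ∫ x, ((mB hw (b j)).toLp _ : E → ℂ) x * (A x * dzb (b k) (fun x => conj (v x)) x) ∂ν - 
      ∫ x, ((mB hw (b k)).toLp _ : E → ℂ) x * (A x * dzb (b j) (fun x => conj (v x)) x) ∂ν = 0
    rw [e, e, ibp_dzb_dzb μ hv'.1 hw.1 hw.2.1, sub_self]
  -- the graph
  let Γ : Submodule ℂ ((PiLp 2 fun _ : Fin N => Lp ℂ 2 ν) × Lp ℂ 2 ν) :=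
    { carrier := {p | ∃ α : Fin N → E → ℂ, (∀ j, IsTest Ω (α j)) ∧
        (∀ j, p.1 j =ᵐ[ν] fun x => A x * α j x) ∧
        p.2 =ᵐ[ν] fun x => - (C' x * ∑ j, dz (b j) (α j) x)}
      zero_mem' := by
        refine ⟨fun _ _ => 0, fun _ => ⟨contDiff_const, HasCompactSupport.zero, by simp [tsupport]⟩,
          fun j => ?_, ?_⟩
        · filter_upwards [Lp.coeFn_zero ℂ 2 ν] with x hx; simpa using hx
        · have : ∀ e x, dz e (fun _ : E => (0:ℂ)) x = 0 := by simp [dz]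
          filter_upwards [Lp.coeFn_zero ℂ 2 ν] with x hx; simpa [this] using hx
      add_mem' := by
        rintro p q ⟨α, h1, h2, h3⟩ ⟨α', h1', h2', h3'⟩
        refine ⟨fun j x => α j x + α' j x, fun j => ⟨(h1 j).1.add (h1' j).1,
          (h1 j).2.1.add (h1' j).2.1, (tsupport_add _ _).trans
          (union_subset (h1 j).2.2 (h1' j).2.2)⟩, fun j => ?_, ?_⟩
        · filter_upwards [h2 j, h2' j, Lp.coeFn_add (p.1 j) (q.1 j)] with x k1 k2 k3
          simp only [Prod.fst_add, PiLp.add_apply]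
          rw [k3, Pi.add_apply, k1, k2]; ring
        · filter_upwards [h3, h3', Lp.coeFn_add p.2 q.2] with x k1 k2 k3
          simp only [Prod.snd_add]
          rw [k3, Pi.add_apply, k1, k2]
          have : ∀ j, dz (b j) (fun x => α j x + α' j x) x = dz (b j) (α j) x + dz (b j) (α' j) x := by
            intro j
            simp only [dz]
            rw [fderiv_fun_add ((h1 j).1.differentiable (by simp) x)
              ((h1' j).1.differentiable (by simp) x)]
            simp only [add_apply]; ring
          simp only [this, Finset.sum_add_distrib]; ring
      smul_mem' := by
        rintro c p ⟨α, h1, h2, h3⟩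
        refine ⟨fun j x => c * α j x, fun j => ⟨contDiff_const.mul (h1 j).1,
          (h1 j).2.1.mul_left, (tsupport_mul_subset_right).trans (h1 j).2.2⟩, fun j => ?_, ?_⟩
        · filter_upwards [h2 j, Lp.coeFn_smul c (p.1 j)] with x k1 k3
          simp only [Prod.smul_fst, PiLp.smul_apply]
          rw [k3, Pi.smul_apply, k1, smul_eq_mul]; ring
        · filter_upwards [h3, Lp.coeFn_smul c p.2] with x k1 k3
          simp only [Prod.smul_snd]
          rw [k3, Pi.smul_apply, k1, smul_eq_mul]
          have : ∀ j, dz (b j) (fun x => c * α j x) x = c * dz (b j) (α j) x := by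
            intro j
            rw [dz_mul _ (differentiableAt_const c) ((h1 j).1.differentiable (by simp) x)]
            simp [dz]
          simp only [this, ← Finset.mul_sum]; ring }
  -- estimate
  have est : ∀ p ∈ Γ, ∀ z ∈ Z, (∀ w ∈ Z, inner ℂ w p.1 = inner ℂ w z) → ‖z‖ ^ 2 ≤ 2 * ‖p.2‖ ^ 2 := by
    rintro p ⟨α, h1, h2, h3⟩ z hz hpz
    have mz : ∀ j, MemLp (Ω.indicator (z j)) 2 μ := fun j =>
      (memLp_indicator_iff_restrict hΩ.measurableSet).2 (Lp.memLp (z j))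
    have ma : MemLp (Ω.indicator p.2) 2 μ :=
      (memLp_indicator_iff_restrict hΩ.measurableSet).2 (Lp.memLp p.2)
    have ei : ∀ (g h : E → ℂ), ∫ x, Ω.indicator g x * h x ∂μ = ∫ x, g x * h x ∂ν := by
      intro g h
      rw [hν, ← integral_indicator hΩ.measurableSet]
      congr 1; ext x
      by_cases hx : x ∈ Ω <;> simp [hx]
    have en : ∀ g : Lp ℂ 2 ν, ∫ x, ‖Ω.indicator g x‖ ^ 2 ∂μ = ‖g‖ ^ 2 := by
      intro g
      have h := norm_toLp_sq (Lp.memLp g)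
      rw [Lp.toLp_coeFn] at h
      rw [h]
      refine Eq.trans ?_ (integral_indicator (μ := μ) (f := fun x => ‖g x‖ ^ 2) hΩ.measurableSet)
      congr 1; ext x
      by_cases hx : x ∈ Ω <;> simp [hx]
    have key := K4 μ b hΩ hφ hη hlevi hχ hχ1 (fun j => Ω.indicator (z j)) mz _ ma
      (fun j x hx => indicator_of_notMem hx _) (fun x hx => indicator_of_notMem hx _) ?_ ?_
    · simp only [en] at key
      rw [PiLp.norm_sq_eq_of_L2]; exact key
    · intro v hv
      simp only [ei]
      have hv' := isTest_conj hv
      have h := hpz _ (BZ hv')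
      rw [PiLp.inner_apply, PiLp.inner_apply] at h
      have k1 : ∀ j, inner ℂ ((mB hv' (b j)).toLp _) (z j) =
          ∫ x, z j x * (((Real.exp ((η x - φ x) / 2) : ℝ) : ℂ) * dz (b j) v x) ∂ν := by
        intro j
        rw [inner_ae _ _ (mB hv' (b j)).coeFn_toLp (ae_eq_refl _)]
        congr 1; ext x
        rw [dzb_conj, map_mul, rB, conj_conj, hB]
      have k2 : ∀ j, inner ℂ ((mB hv' (b j)).toLp _) (p.1 j) =
          - ∫ x, v x * dz (b j) (α j) x ∂μ := by
        intro j
        rw [inner_ae _ _ (mB hv' (b j)).coeFn_toLp (h2 j), ibp_dz μ (hv.1.of_le (by norm_num))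
          ((h1 j).1.of_le (by norm_num)) (h1 j).2.1, neg_neg, ← setInt_eq μ (Ω := Ω)]
        · congr 1; ext x
          rw [dzb_conj, map_mul, rB, conj_conj]
          linear_combination (dz (b j) v x * α j x) * AB x
        · intro x hx
          rw [z0 (h1 j).2.2 x hx, mul_zero]
      change ∑ j, inner ℂ ((mB hv' (b j)).toLp _) (p.1 j) =
        ∑ j, inner ℂ ((mB hv' (b j)).toLp _) (z j) at h
      simp only [k1, k2] at h
      rw [← h]
      rw [integral_congr_ae (g := fun x => - ∑ j, v x * dz (b j) (α j) x), integral_neg,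
        Finset.sum_neg_distrib, integral_finsetSum]
      · congr 1
        refine Finset.sum_congr rfl fun j _ => ?_
        rw [setInt_eq]
        intro x hx
        rw [z0 hv.2.2 x hx, zero_mul]
      · intro j _
        exact ((hv.1.continuous.mul (tdz (h1 j) (b j)).1).integrable_of_hasCompactSupport
          (tdz (h1 j) (b j)).2.1.mul_left).integrableOn
      · filter_upwards [h3] with x hx
        have := CC x
        simp only [hC] at this
        rw [hx, ← Finset.mul_sum]
        linear_combination (- v x * ∑ j, dz (b j) (α j) x) * this
    · intro v hv j k
      simp only [ei]
      have := ZT2 z hz v hv j k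
      simpa only [hA] using this
  -- functional
  let F : PiLp 2 fun _ : Fin N => Lp ℂ 2 ν := WithLp.toLp 2 fun i => (hf' i).toLp _
  have FZ : F ∈ Z := by
    rw [memZ]
    rintro s ⟨v, hv, j, k, hs⟩
    rw [inS hv j k s hs]
    have hv' := isTest_conj hv
    have e : ∀ i l, ∫ x, ((hf' i).toLp _ : E → ℂ) x *
        (A x * dzb (b l) (fun x => conj (v x)) x) ∂ν =
        ∫ x, f i x * dzb (b l) (fun x => conj (v x)) x ∂ν := by
      intro i l
      refine integral_congr_ae ?_
      filter_upwards [(hf' i).coeFn_toLp] with x hx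
      rw [hx]
      linear_combination (dzb (b l) (fun x => conj (v x)) x * f i x) * AB x
    change ∫ x, ((hf' j).toLp _ : E → ℂ) x * (A x * dzb (b k) (fun x => conj (v x)) x) ∂ν - 
      ∫ x, ((hf' k).toLp _ : E → ℂ) x * (A x * dzb (b j) (fun x => conj (v x)) x) ∂ν = 0
    rw [e, e, hcl _ hv' j k, sub_self]
  obtain ⟨u0, hu0⟩ := riesz_aux ((LinearMap.snd ℂ _ _).comp Γ.subtype)
    ((innerₛₗ ℂ F).comp ((LinearMap.fst ℂ _ _).comp Γ.subtype)) (2 * ‖F‖) (by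
      rintro ⟨p, hp⟩
      obtain ⟨z, hz, hz2⟩ := proj_aux SS p.1
      have h := est p hp z hz hz2
      have e : inner ℂ F p.1 = inner ℂ F z := hz2 F FZ
      change ‖inner ℂ F p.1‖ ≤ 2 * ‖F‖ * ‖p.2‖
      rw [e]
      refine (norm_inner_le_norm _ _).trans ?_
      rw [mul_comm 2, mul_assoc]
      gcongr
      apply le_of_sq_le_sq _ (by positivity)
      nlinarith [sq_nonneg ‖p.2‖])
  refine ⟨fun x => C' x * u0 x, ?_, ?_⟩
  · have : (fun x => ((Real.exp (η x - φ x / 2) : ℝ) : ℂ) * (C' x * u0 x)) = u0 := by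
      ext x
      have := CC x
      simp only [hC] at this
      rw [← mul_assoc, this, one_mul]
    rw [this]; exact Lp.memLp u0
  · intro v hv j
    have hv' := isTest_conj hv
    have m1 : ∀ i, MemLp (fun x => A x * (if i = j then conj (v x) else 0)) 2 ν := fun i => by
      by_cases h : i = j
      · simp only [h, if_true]
        exact memLp_weight μ hΩ hv'.1.continuous hv'.2.1 hv'.2.2 cA
      · simp [h]
    have m2 : MemLp (fun x => - (C' x * dz (b j) (fun x => conj (v x)) x)) 2 ν :=
      (memLp_weight μ hΩ (tdz hv' (b j)).1 (tdz hv' (b j)).2.1 (tdz hv' (b j)).2.2 cC').neg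
    have hmem : ((WithLp.toLp 2 fun i => (m1 i).toLp _, m2.toLp _) :
        (PiLp 2 fun _ : Fin N => Lp ℂ 2 ν) × Lp ℂ 2 ν) ∈ Γ := by
      refine ⟨fun i x => if i = j then conj (v x) else 0, fun i => ?_, fun i => ?_, ?_⟩
      · by_cases h : i = j
        · simpa only [h, if_true] using hv'
        · simp only [h, if_false]
          exact ⟨contDiff_const, HasCompactSupport.zero, by simp [tsupport]⟩
      · exact (m1 i).coeFn_toLp
      · have : ∀ x, ∑ i, dz (b i) (fun x => if i = j then conj (v x) else 0) x
            = dz (b j) (fun x => conj (v x)) x := by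
          intro x
          rw [Finset.sum_eq_single j]
          · simp
          · intro i _ h; simp [h, dz]
          · simp
        simp only [this]
        exact m2.coeFn_toLp
    have h := hu0 ⟨_, hmem⟩
    change inner ℂ F (WithLp.toLp 2 fun i => (m1 i).toLp _) = inner ℂ u0 (m2.toLp _) at h
    rw [PiLp.inner_apply] at h
    change ∑ i, inner ℂ ((hf' i).toLp _) ((m1 i).toLp _) = _ at h
    rw [Finset.sum_eq_single j, inner_ae _ _ (hf' j).coeFn_toLp (m1 j).coeFn_toLp,
      inner_ae _ _ (ae_eq_refl _) m2.coeFn_toLp] at h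
    · have h' := congrArg conj h
      rw [← integral_conj, ← integral_conj] at h'
      have q1 : ∀ x, conj ((A x * if j = j then conj (v x) else 0) * conj (B x * f j x))
          = f j x * v x := by
        intro x
        simp only [if_true, map_mul, rA, rB, conj_conj]
        linear_combination (f j x * v x) * AB x
      have q2 : ∀ x, conj (-(C' x * dz (b j) (fun x => conj (v x)) x) * conj (u0 x))
          = - (C' x * u0 x * dzb (b j) v x) := by
        intro x
        rw [dz_conj]
        simp only [map_mul, map_neg, rC', conj_conj]
        ring
      have h2 : ∫ x, f j x * v x ∂ν = ∫ x, - (C' x * u0 x * dzb (b j) v x) ∂ν :=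
        (integral_congr_ae (Eventually.of_forall fun x => (q1 x).symm)).trans
          (h'.trans (integral_congr_ae (Eventually.of_forall q2)))
      rw [integral_neg] at h2
      linear_combination h2
    · intro i _ hi
      rw [inner_ae _ _ (hf' i).coeFn_toLp (m1 i).coeFn_toLp]
      simp [hi]
    · simp

end SteinAux

set_option linter.unusedSectionVars false
set_option linter.unusedSimpArgs false

namespace SteinAux

variable {E : Type*} [NormedAddCommGroup E] [NormedSpace ℂ E]
  [FiniteDimensional ℂ E] [MeasurableSpace E] [BorelSpace E]
  (μ : Measure E) [μ.IsAddHaarMeasure] {N : ℕ} (b : Module.Basis (Fin N) ℂ E)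

lemma rot_mp (c : ℂ) (hc : ‖c‖ = 1) : MeasurePreserving (fun y : E => c • y) μ μ := by
  have : ProperSpace E := FiniteDimensional.proper ℂ E
  have : FiniteDimensional ℝ E := FiniteDimensional.complexToReal E
  let L : E →ₗ[ℝ] E := ((LinearMap.lsmul ℂ E c).restrictScalars ℝ)
  have hL : ∀ y, L y = c • y := fun y => rfl
  have hc0 : c ≠ 0 := by rintro rfl; simp at hc
  have himg : L '' ball 0 1 = ball 0 1 := by
    ext y; constructor
    · rintro ⟨z, hz, rfl⟩
      simpa [hL, norm_smul, hc] using hz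
    · intro hy
      refine ⟨c⁻¹ • y, ?_, ?_⟩
      · simpa [norm_smul, hc] using hy
      · rw [hL, smul_inv_smul₀ hc0]
  have h1 := Measure.addHaar_image_linearMap μ L (ball 0 1)
  rw [himg] at h1
  have hpos : μ (ball (0:E) 1) ≠ 0 := (measure_ball_pos μ 0 one_pos).ne'
  have hfin : μ (ball (0:E) 1) ≠ ⊤ := measure_ball_lt_top.ne
  have h2 : ENNReal.ofReal |LinearMap.det L| = 1 := by
    have : 1 * μ (ball (0:E) 1) = ENNReal.ofReal |LinearMap.det L| * μ (ball (0:E) 1) := by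
      rw [one_mul]; exact h1
    exact ((ENNReal.mul_left_inj hpos hfin).1 this).symm
  have h3 : |LinearMap.det L| = 1 := by
    have := congrArg ENNReal.toReal h2
    rwa [ENNReal.toReal_ofReal (abs_nonneg _), ENNReal.toReal_one] at this
  have h4 : LinearMap.det L ≠ 0 := by intro h; simp [h] at h3
  refine ⟨measurable_const_smul c, ?_⟩
  have := Measure.map_linearMap_addHaar_eq_smul_addHaar μ h4
  rw [abs_inv, h3] at this
  rw [inv_one, ENNReal.ofReal_one, one_smul] at this
  exact this

lemma mean_value (n : ℕ) {w : E → ℂ} (hw : Continuous w) (x : E)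
    (hd : ∀ y, ‖y‖ ≤ (∑ j, ‖b j‖) / (n + 1) → ∀ ζ ∈ closedBall (0:ℂ) 1, DifferentiableAt ℂ (fun ζ : ℂ => w (x - ζ • y)) ζ) :
    mconv μ b n w x = w x := by
  have : ProperSpace E := FiniteDimensional.proper ℂ E
  rw [mconv_flip]
  set I0 := ∫ y, (moll μ b n y : ℂ) * w (x - y) ∂μ with hI0
  have h1 : ∀ θ : ℝ, ∫ y, (moll μ b n y : ℂ) * w (x - circleMap 0 1 θ • y) ∂μ = I0 := by
    intro θ
    have hc : ‖circleMap 0 1 θ‖ = 1 := by simp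
    have hc0 : circleMap 0 1 θ ≠ 0 := by intro h; simp [h] at hc
    have := (rot_mp μ (circleMap 0 1 θ) hc).integral_comp
      (MeasurableEquiv.smul₀ (circleMap 0 1 θ) hc0).measurableEmbedding
      (fun y => (moll μ b n y : ℂ) * w (x - y))
    rw [hI0, ← this]
    simp only [moll_smul μ b n _ hc]
  have h2 : ∫ θ in (0:ℝ)..2 * Real.pi, ∫ y, (moll μ b n y : ℂ) * w (x - circleMap 0 1 θ • y) ∂μ
      = (2 * Real.pi) • I0 := by
    simp only [h1]; simp
  have hcont : Continuous (fun p : ℝ × E => (moll μ b n p.2 : ℂ) * w (x - circleMap 0 1 p.1 • p.2)) := by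
    exact ((contDiff_mollC μ b n).continuous.comp continuous_snd).mul (hw.comp (by fun_prop))
  rw [intervalIntegral_integral_swap] at h2
  · have h3 : ∀ y, ∫ θ in (0:ℝ)..2 * Real.pi, (moll μ b n y : ℂ) * w (x - circleMap 0 1 θ • y)
        = (2 * Real.pi) • ((moll μ b n y : ℂ) * w x) := by
      intro y
      rw [intervalIntegral.integral_const_mul]
      by_cases hy : moll μ b n y = 0
      · simp [hy]
      have h4 : Real.circleAverage (fun ζ : ℂ => w (x - ζ • y)) 0 1 = w x := by
        have := DiffContOnCl.circleAverage (f := fun ζ : ℂ => w (x - ζ • y)) (c := 0) (R := 1) ?_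
        · simpa using this
        · rw [abs_one]
          refine DifferentiableOn.diffContOnCl ?_
          rw [closure_ball _ one_ne_zero]
          exact fun ζ hζ => (hd y (moll_supp μ b hy) ζ hζ).differentiableWithinAt
      rw [Real.circleAverage_def] at h4
      have hpi : (2 * Real.pi) ≠ 0 := by positivity
      rw [inv_smul_eq_iff₀ hpi] at h4
      rw [h4]; simp only [Complex.real_smul]; ring
    simp only [h3] at h2
    rw [integral_smul] at h2
    have hpi : (2 * Real.pi) ≠ 0 := by positivity
    have h5 := smul_right_injective ℂ hpi h2
    rw [← h5, integral_mul_const, integral_complex_ofReal, moll_integral]; simp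
  · have hK : IsCompact (Icc 0 (2 * Real.pi) ×ˢ tsupport (moll μ b n)) :=
      isCompact_Icc.prod (hcs_moll μ b n)
    have hi := hcont.continuousOn.integrableOn_compact (μ := volume.prod μ) hK
    rw [Function.uncurry_def]
    have hsub : (uIoc 0 (2 * Real.pi)) ×ˢ (univ : Set E) ⊆ (Icc 0 (2 * Real.pi)) ×ˢ univ := by
      rw [uIoc_of_le (by positivity)]
      exact prod_mono Ioc_subset_Icc_self le_rfl
    have : IntegrableOn (fun p : ℝ × E => (moll μ b n p.2 : ℂ) * w (x - circleMap 0 1 p.1 • p.2))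
        ((Icc 0 (2 * Real.pi)) ×ˢ univ) (volume.prod μ) := by
      refine hi.of_forall_diff_eq_zero (measurableSet_Icc.prod MeasurableSet.univ) ?_
      rintro ⟨θ, y⟩ ⟨⟨h1, _⟩, h2⟩
      have : y ∉ tsupport (moll μ b n) := fun h => h2 ⟨h1, h⟩
      simp [image_eq_zero_of_notMem_tsupport this]
    have := this.mono_set hsub
    rw [IntegrableOn, ← Measure.prod_restrict, Measure.restrict_univ] at this
    exact this


lemma holo_of_dzb {f : E → ℂ} {x : E} (hf : DifferentiableAt ℝ f x)
    (h : ∀ j, dzb (b j) f x = 0) : DifferentiableAt ℂ f x := by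
  have key : ∀ e, dzb e f x = 0 → fderiv ℝ f x (I • e) = I * fderiv ℝ f x e := by
    intro e he
    simp only [dzb] at he
    have h2 : fderiv ℝ f x e + I * fderiv ℝ f x (I • e) = 0 := by
      have := he
      linear_combination 2 * this
    linear_combination (-I) * h2 + (fderiv ℝ f x (I • e)) * (Complex.I_mul_I)
  rw [differentiableAt_iff_restrictScalars ℝ hf]
  let L : E →ₗ[ℂ] ℂ := b.constr ℂ (fun j => fderiv ℝ f x (b j))
  have hL : ∀ v, L v = fderiv ℝ f x v := by
    intro v
    have hv := b.sum_repr v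
    conv_rhs => rw [← hv]
    rw [map_sum]
    simp only [L, Module.Basis.constr_apply_fintype]
    refine Finset.sum_congr rfl fun j _ => ?_
    rw [Module.Basis.equivFun_apply]
    set c := b.repr v j
    have hc : c • b j = c.re • b j + c.im • (I • b j) := by
      conv_lhs => rw [← Complex.re_add_im c]
      rw [add_smul, mul_smul]; rfl
    rw [hc, map_add, map_smul, map_smul, key _ (h j)]
    simp only [Complex.real_smul, smul_eq_mul]
    conv_lhs => rw [← Complex.re_add_im c]
    ring
  refine ⟨LinearMap.toContinuousLinearMap L, ?_⟩
  ext v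
  simp [hL]

lemma mconv_lim (n : ℕ) {c : E → ℂ} (hc : MemLp c 2 μ) (x : E) :
    Tendsto (fun m => mconv μ b n (mconv μ b m c) x) atTop (𝓝 (mconv μ b n c x)) := by
  have : ProperSpace E := FiniteDimensional.proper ℂ E
  have ht : MemLp (tst μ b n x) 2 μ :=
    (contDiff_tst μ b n x).continuous.memLp_of_hasCompactSupport (hcs_tst μ b n x)
  have hcl : LocallyIntegrable c μ := hc.locallyIntegrable (by norm_num)
  have hintg : ∀ w, LocallyIntegrable w μ → Integrable (fun y => w y * tst μ b n x y) μ := by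
    intro w hw
    have := hw.integrable_smul_left_of_hasCompactSupport (contDiff_tst μ b n x).continuous (hcs_tst μ b n x)
    simpa [smul_eq_mul, mul_comm] using this
  rw [tendsto_iff_edist_tendsto_0]
  have hb : ∀ m, edist (mconv μ b n (mconv μ b m c) x) (mconv μ b n c x)
      ≤ eLpNorm (mconv μ b m c - c) 2 μ * eLpNorm (tst μ b n x) 2 μ := by
    intro m
    rw [edist_eq_enorm_sub]
    have hm : LocallyIntegrable (mconv μ b m c) μ := (contDiff_mconv μ b m hcl).continuous.locallyIntegrable
    have e1 : mconv μ b n (mconv μ b m c) x - mconv μ b n c x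
        = ∫ y, ((mconv μ b m c - c) y) * tst μ b n x y ∂μ := by
      have := integral_sub (hintg _ hm) (hintg _ hcl)
      simp only [Pi.sub_apply, sub_mul]
      rw [this]; rfl
    rw [e1]
    refine (enorm_integral_le_lintegral_enorm _).trans ?_
    rw [← eLpNorm_one_eq_lintegral_enorm]
    have := eLpNorm_smul_le_mul_eLpNorm (p := 2) (q := 2) (r := 1) (μ := μ) (f := tst μ b n x) (φ := mconv μ b m c - c)
      ht.1 (hm.aestronglyMeasurable.sub hc.1)
    exact this
  have hlim := ENNReal.Tendsto.mul_const (mconv_tendsto μ b hc) (b := eLpNorm (tst μ b n x) 2 μ)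
    (Or.inr ht.2.ne)
  rw [zero_mul] at hlim
  exact tendsto_of_tendsto_of_tendsto_of_le_of_le tendsto_const_nhds hlim (fun _ => zero_le) hb


lemma weyl_local {u : E → ℂ} {x₀ : E} {r : ℝ} (hr : 0 < r)
    (hu : MemLp u 2 (μ.restrict (closedBall x₀ (3 * r))))
    (hw : ∀ v, IsTest (ball x₀ (3 * r)) v → ∀ j, ∫ x, (closedBall x₀ (3 * r)).indicator u x * dzb (b j) v x ∂μ = 0) :
    ∃ h : E → ℂ, DifferentiableOn ℂ h (ball x₀ r) ∧ u =ᵐ[μ.restrict (ball x₀ r)] h := by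
  have : ProperSpace E := FiniteDimensional.proper ℂ E
  set c := (closedBall x₀ (3 * r)).indicator u with hcdef
  have hc : MemLp c 2 μ := (memLp_indicator_iff_restrict measurableSet_closedBall).2 hu
  have hcl : LocallyIntegrable c μ := hc.locallyIntegrable (by norm_num)
  set R : ℕ → ℝ := fun n => (∑ j, ‖b j‖) / (n + 1) with hR
  have hRlim : Tendsto R atTop (𝓝 0) := by
    have := (tendsto_one_div_add_atTop_nhds_zero_nat (𝕜 := ℝ)).const_mul (∑ j, ‖b j‖)
    simpa [hR, div_eq_mul_inv] using this
  obtain ⟨n₀, hn₀⟩ := eventually_atTop.1 (hRlim.eventually (gt_mem_nhds (show (0:ℝ) < r from hr)))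
  have hsm : ∀ n, ContDiff ℝ ∞ (mconv μ b n c) := fun n => contDiff_mconv μ b n hcl
  have hol : ∀ n ≥ n₀, ∀ x ∈ ball x₀ (2 * r), DifferentiableAt ℂ (mconv μ b n c) x := by
    intro n hn x hx
    refine holo_of_dzb b ((hsm n).differentiable (by simp) x) fun j => ?_
    rw [dzb_mconv μ b n hcl, hw, neg_zero]
    refine ⟨(contDiff_tst μ b n x).of_le two_le_inf, hcs_tst μ b n x, ?_⟩
    refine (tst_tsupport μ b n x).trans (closedBall_subset_ball' ?_)
    have h1 : R n < r := hn₀ n hn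
    have h2 := mem_ball.1 hx
    show R n + _ < _
    linarith
  have hmv : ∀ n ≥ n₀, ∀ m ≥ n₀, ∀ x ∈ ball x₀ r, mconv μ b n (mconv μ b m c) x = mconv μ b m c x := by
    intro n hn m hm x hx
    refine mean_value μ b n (hsm m).continuous x fun y hy ζ hζ => ?_
    have h1 : R n < r := hn₀ n hn
    have hy' : ‖y‖ ≤ R n := hy
    have hζ' : ‖ζ‖ ≤ 1 := by simpa using hζ
    have hmem : x - ζ • y ∈ ball x₀ (2 * r) := by
      rw [mem_ball, dist_eq_norm]
      have e : x - ζ • y - x₀ = (x - x₀) - ζ • y := by abel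
      rw [e]
      have h3 := norm_sub_le (x - x₀) (ζ • y)
      have h4 : ‖ζ • y‖ ≤ ‖y‖ := by
        rw [norm_smul]; exact mul_le_of_le_one_left (norm_nonneg _) hζ'
      have h5 : ‖x - x₀‖ < r := by simpa [dist_eq_norm] using hx
      linarith
    have h6 : DifferentiableAt ℂ (fun ζ : ℂ => x - ζ • y) ζ := by fun_prop
    exact DifferentiableAt.comp ζ (f := fun ζ : ℂ => x - ζ • y) (hol m hm _ hmem) h6
  have heq : ∀ m ≥ n₀, ∀ x ∈ ball x₀ r, mconv μ b m c x = mconv μ b n₀ c x := by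
    have : ∀ n ≥ n₀, ∀ x ∈ ball x₀ r, Tendsto (fun m => mconv μ b m c x) atTop (𝓝 (mconv μ b n c x)) := by
      intro n hn x hx
      refine (mconv_lim μ b n hc x).congr' ?_
      filter_upwards [eventually_ge_atTop n₀] with m hm
      exact hmv n hn m hm x hx
    intro m hm x hx
    exact tendsto_nhds_unique (this m hm x hx) (this n₀ le_rfl x hx)
  refine ⟨mconv μ b n₀ c, fun x hx => (hol n₀ le_rfl x ?_).differentiableWithinAt, ?_⟩
  · exact ball_subset_ball (by linarith) hx
  have hz : eLpNorm (mconv μ b n₀ c - c) 2 (μ.restrict (ball x₀ r)) = 0 := by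
    refine le_antisymm (ge_of_tendsto (mconv_tendsto μ b hc) ?_) zero_le
    filter_upwards [eventually_ge_atTop n₀] with m hm
    calc eLpNorm (mconv μ b n₀ c - c) 2 (μ.restrict (ball x₀ r))
        = eLpNorm (mconv μ b m c - c) 2 (μ.restrict (ball x₀ r)) := by
          refine eLpNorm_congr_ae ?_
          refine (ae_restrict_iff' measurableSet_ball).2 (ae_of_all _ fun x hx => ?_)
          simp [heq m hm x hx]
      _ ≤ _ := eLpNorm_mono_measure _ Measure.restrict_le_self
  rw [eLpNorm_eq_zero_iff (((hsm n₀).continuous.aestronglyMeasurable.sub hc.1).restrict) (by norm_num)] at hz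
  filter_upwards [hz, ae_restrict_mem measurableSet_ball] with x h1 h2
  have h3 : c x = u x := by
    rw [hcdef, indicator_of_mem]
    exact (ball_subset_closedBall.trans (closedBall_subset_closedBall (by linarith))) h2
  rw [← h3]
  exact (sub_eq_zero.1 h1).symm

theorem weyl {Ω : Set E} (hΩ : IsOpen Ω) {u : E → ℂ}
    (hu : ∀ K ⊆ Ω, IsCompact K → MemLp u 2 (μ.restrict K))
    (hw : ∀ v, IsTest Ω v → ∀ j, ∫ x in Ω, u x * dzb (b j) v x ∂μ = 0) :
    ∃ H : E → ℂ, DifferentiableOn ℂ H Ω ∧ u =ᵐ[μ.restrict Ω] H := by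
  have : ProperSpace E := FiniteDimensional.proper ℂ E
  have hloc : ∀ x ∈ Ω, ∃ r > 0, ball x r ⊆ Ω ∧ ∃ h : E → ℂ, DifferentiableOn ℂ h (ball x r) ∧
      u =ᵐ[μ.restrict (ball x r)] h := by
    intro x hx
    obtain ⟨ε, hε, hb⟩ := Metric.isOpen_iff.1 hΩ x hx
    have hsub : closedBall x (3 * (ε / 4)) ⊆ Ω :=
      (closedBall_subset_ball (by linarith)).trans hb
    refine ⟨ε / 4, by positivity, (ball_subset_ball (by linarith)).trans hb, ?_⟩
    refine weyl_local μ b (by positivity) (hu _ hsub (isCompact_closedBall _ _)) ?_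
    intro v hv j
    rw [← hw v ⟨hv.1, hv.2.1, hv.2.2.trans (ball_subset_closedBall.trans hsub)⟩ j, ← setInt_eq μ (Ω := Ω)]
    · refine setIntegral_congr_fun hΩ.measurableSet fun y hy => ?_
      by_cases h : y ∈ closedBall x (3 * (ε / 4))
      · simp only [indicator_of_mem h]
      · have : dzb (b j) v y = 0 := dzb_zero_of_notMem _ fun h' => h (ball_subset_closedBall (hv.2.2 h'))
        simp [this]
    · intro y hy
      rw [indicator_of_notMem (fun h => hy (hsub h)), zero_mul]
  choose! r hr0 hrΩ h hhol hae using hloc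
  have hagree : ∀ x ∈ Ω, ∀ y ∈ ball x (r x), h y y = h x y := by
    intro x hx y hy
    have hyΩ := hrΩ x hx hy
    have hU : IsOpen (ball x (r x) ∩ ball y (r y)) := isOpen_ball.inter isOpen_ball
    have ha : u =ᵐ[μ.restrict (ball x (r x) ∩ ball y (r y))] h y :=
      ae_restrict_of_ae_restrict_of_subset inter_subset_right (hae y hyΩ)
    have hb : u =ᵐ[μ.restrict (ball x (r x) ∩ ball y (r y))] h x :=
      ae_restrict_of_ae_restrict_of_subset inter_subset_left (hae x hx)
    have h1 : h y =ᵐ[μ.restrict (ball x (r x) ∩ ball y (r y))] h x := ha.symm.trans hb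
    exact Measure.eqOn_open_of_ae_eq h1 hU ((hhol y hyΩ).continuousOn.mono inter_subset_right)
      ((hhol x hx).continuousOn.mono inter_subset_left) ⟨hy, mem_ball_self (hr0 y hyΩ)⟩
  refine ⟨fun x => h x x, fun x hx => ?_, ?_⟩
  · have h1 : DifferentiableAt ℂ (h x) x :=
      (hhol x hx).differentiableAt (ball_mem_nhds x (hr0 x hx))
    refine (h1.congr_of_eventuallyEq ?_).differentiableWithinAt
    filter_upwards [ball_mem_nhds x (hr0 x hx)] with y hy
    exact hagree x hx y hy
  · show ∀ᵐ x ∂(μ.restrict Ω), u x = h x x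
    rw [ae_restrict_iff' hΩ.measurableSet, ae_iff]
    refine measure_null_of_locally_null _ fun x hx => ?_
    have hxΩ : x ∈ Ω := by by_contra h'; exact hx (fun h'' => absurd h'' h')
    refine ⟨_ ∩ ball x (r x), inter_mem self_mem_nhdsWithin
      (mem_nhdsWithin_of_mem_nhds (ball_mem_nhds x (hr0 x hxΩ))), ?_⟩
    have := hae x hxΩ
    rw [EventuallyEq, ae_restrict_iff' measurableSet_ball, ae_iff] at this
    refine measure_mono_null ?_ this
    rintro y ⟨h1, h2⟩
    simp only [mem_setOf_eq] at h1 ⊢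
    intro h3; apply h1; intro _
    rw [h3 h2, hagree x hxΩ y h2]

end SteinAux

set_option linter.unusedSectionVars false
set_option linter.unusedSimpArgs false

namespace SteinAux

variable {E : Type*} [NormedAddCommGroup E] [NormedSpace ℂ E]
  [FiniteDimensional ℂ E] [MeasurableSpace E] [BorelSpace E]
  (μ : Measure E) [μ.IsAddHaarMeasure] {N : ℕ} (b : Module.Basis (Fin N) ℂ E)

lemma hasFDerivAt_fderiv_comp {φ : E → ℝ} {x : E} (hφ : ContDiffAt ℝ 2 φ x) {h h' : ℝ → ℝ} {h'' : ℝ}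
    (h1 : ∀ᶠ t in 𝓝 (φ x), HasDerivAt h (h' t) t) (h2 : HasDerivAt h' h'' (φ x)) :
    HasFDerivAt (fderiv ℝ (fun y => h (φ y)))
      (h' (φ x) • fderiv ℝ (fderiv ℝ φ) x + (h'' • fderiv ℝ φ x).smulRight (fderiv ℝ φ x)) x := by
  have hd : ∀ᶠ y in 𝓝 x, DifferentiableAt ℝ φ y := by
    filter_upwards [hφ.eventually (by simp)] with y hy
    exact hy.differentiableAt (by norm_num)
  have e : fderiv ℝ (fun y => h (φ y)) =ᶠ[𝓝 x] fun y => h' (φ y) • fderiv ℝ φ y := by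
    filter_upwards [hd, hφ.continuousAt.eventually h1] with y hy hy1
    have := (hy1.comp_hasFDerivAt y hy.hasFDerivAt).fderiv
    exact this
  have hdd : DifferentiableAt ℝ (fderiv ℝ φ) x :=
    (hφ.fderiv_right (m := 1) (by norm_num)).differentiableAt (by norm_num)
  have a1 : HasFDerivAt (fun y => h' (φ y)) (h'' • fderiv ℝ φ x) x :=
    h2.comp_hasFDerivAt x (hφ.differentiableAt (by norm_num)).hasFDerivAt
  exact (a1.smul hdd.hasFDerivAt).congr_of_eventuallyEq e

lemma levi_comp {φ : E → ℝ} {x : E} (hφ : ContDiffAt ℝ 2 φ x) {h h' : ℝ → ℝ} {h'' : ℝ}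
    (h1 : ∀ᶠ t in 𝓝 (φ x), HasDerivAt h (h' t) t) (h2 : HasDerivAt h' h'' (φ x)) (v : E) :
    levi (fun y => h (φ y)) x v = h' (φ x) * levi φ x v
      + h'' * ((fderiv ℝ φ x v) ^ 2 + (fderiv ℝ φ x (I • v)) ^ 2) := by
  rw [levi, (hasFDerivAt_fderiv_comp hφ h1 h2).fderiv, levi]
  simp
  ring

lemma dz_lin (f : E → ℂ) (x : E) (v : Fin N → ℂ) :
    ∑ j, dz (b j) f x * v j = dz (∑ j, v j • b j) f x := by
  have key : ∀ (c : ℂ) e, fderiv ℝ f x (c • e) = c.re * fderiv ℝ f x e + c.im * fderiv ℝ f x (I • e) := by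
    intro c e
    have hc : c • e = c.re • e + c.im • (I • e) := by
      conv_lhs => rw [← Complex.re_add_im c]
      rw [add_smul, mul_smul]; rfl
    rw [hc, map_add, map_smul, map_smul]; simp
  simp only [dz, Finset.smul_sum, map_sum]
  rw [Finset.mul_sum, ← Finset.sum_sub_distrib, Finset.mul_sum]
  refine Finset.sum_congr rfl fun j _ => ?_
  rw [key (v j), ← mul_smul, key (I * v j)]
  simp only [Complex.mul_re, Complex.mul_im, Complex.I_re, Complex.I_im]
  conv_lhs => rw [← Complex.re_add_im (v j)]
  push_cast
  linear_combination (-(1/2) * ((v j).im) * (fderiv ℝ f x (I • b j))) * (Complex.I_mul_I)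

lemma fderiv_ofReal {φ : E → ℝ} {x : E} (hφ : DifferentiableAt ℝ φ x) (v : E) :
    fderiv ℝ (fun y => (φ y : ℂ)) x v = (fderiv ℝ φ x v : ℂ) := by
  have := (Complex.ofRealCLM.hasFDerivAt.comp x hφ.hasFDerivAt).fderiv
  have h2 : fderiv ℝ (fun y => (φ y : ℂ)) x = Complex.ofRealCLM ∘L fderiv ℝ φ x := this
  rw [h2]; simp

lemma norm_dzR_sq {φ : E → ℝ} {x : E} (hφ : DifferentiableAt ℝ φ x) (e : E) :
    ‖dzR e φ x‖ ^ 2 = 1 / 4 * ((fderiv ℝ φ x e) ^ 2 + (fderiv ℝ φ x (I • e)) ^ 2) := by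
  rw [dzR, dz, fderiv_ofReal hφ, fderiv_ofReal hφ, norm_mul, mul_pow, ← Complex.normSq_eq_norm_sq (_ - _),
    Complex.normSq_apply]
  simp
  ring

lemma coord_bound : ∃ A > 0, ∀ v : Fin N → ℂ, ∑ j, ‖v j‖ ^ 2 ≤ A * ‖∑ j, v j • b j‖ ^ 2 := by
  let L := LinearMap.toContinuousLinearMap (b.equivFun : E →ₗ[ℂ] (Fin N → ℂ))
  refine ⟨N * (‖L‖ + 1) ^ 2 + 1, by positivity, fun v => ?_⟩
  have h1 : ∀ j, ‖v j‖ ≤ (‖L‖ + 1) * ‖∑ j, v j • b j‖ := by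
    intro j
    have h2 : L (∑ j, v j • b j) = v := by
      show b.equivFun (∑ j, v j • b j) = v
      rw [← b.equivFun_symm_apply, LinearEquiv.apply_symm_apply]
    calc ‖v j‖ ≤ ‖v‖ := norm_le_pi_norm v j
      _ = ‖L (∑ j, v j • b j)‖ := by rw [h2]
      _ ≤ ‖L‖ * ‖∑ j, v j • b j‖ := L.le_opNorm _
      _ ≤ _ := by gcongr; linarith
  calc ∑ j, ‖v j‖ ^ 2 ≤ ∑ j : Fin N, ((‖L‖ + 1) * ‖∑ j, v j • b j‖) ^ 2 := by
        gcongr with j; exact h1 j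
    _ = N * (‖L‖ + 1) ^ 2 * ‖∑ j, v j • b j‖ ^ 2 := by simp; ring
    _ ≤ _ := by gcongr; linarith

lemma exists_bound_deriv_smoothTransition : ∃ M > 0, ∀ t, |deriv Real.smoothTransition t| ≤ M ∧
    (deriv Real.smoothTransition t ≠ 0 → 0 ≤ t ∧ t ≤ 1) := by
  have hsub : ∀ t, deriv Real.smoothTransition t ≠ 0 → 0 ≤ t ∧ t ≤ 1 := by
    intro t ht
    by_contra h
    apply ht
    rw [not_and_or, not_le, not_le] at h
    rcases h with h | h
    · have : Real.smoothTransition =ᶠ[𝓝 t] fun _ => 0 := by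
        filter_upwards [gt_mem_nhds h] with s hs
        exact Real.smoothTransition.zero_of_nonpos hs.le
      rw [this.deriv_eq]; simp
    · have : Real.smoothTransition =ᶠ[𝓝 t] fun _ => 1 := by
        filter_upwards [lt_mem_nhds h] with s hs
        exact Real.smoothTransition.one_of_one_le hs.le
      rw [this.deriv_eq]; simp
  have hc : Continuous (deriv Real.smoothTransition) :=
    (Real.smoothTransition.contDiff (n := 1)).continuous_deriv (by norm_num)
  obtain ⟨M, hM⟩ := (isCompact_Icc (a := (0:ℝ)) (b := 1)).exists_bound_of_continuousOn hc.continuousOn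
  refine ⟨|M| + 1, by positivity, fun t => ⟨?_, hsub t⟩⟩
  by_cases ht : deriv Real.smoothTransition t = 0
  · rw [ht, abs_zero]; positivity
  · have := hM t (hsub t ht)
    rw [Real.norm_eq_abs] at this
    linarith [le_abs_self M]


lemma contDiff_of_tsup {F : Type*} [NormedAddCommGroup F] [NormedSpace ℝ F] {n : ℕ∞ω} {f : E → F}
    (h : ∀ x ∈ tsupport f, ContDiffAt ℝ n f x) : ContDiff ℝ n f := by
  rw [contDiff_iff_contDiffAt]
  intro x
  by_cases hx : x ∈ tsupport f
  · exact h x hx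
  · exact contDiffAt_const.congr_of_eventuallyEq (notMem_tsupport_iff_eventuallyEq.1 hx)

set_option maxHeartbeats 800000 in
theorem solve_dbar {W : Set E} (hW : IsOpen W) {Ψ : E → ℝ} (hΨ : ContDiffOn ℝ 2 Ψ W) {κ c : ℝ} (hκ : 0 < κ)
    (hlev : ∀ x ∈ W, ∀ v, κ * ‖v‖ ^ 2 ≤ levi Ψ x v) (hK : IsCompact {x ∈ W | Ψ x ≤ c})
    (f : Fin N → E → ℂ) (hfm : ∀ j, AEStronglyMeasurable (f j) (μ.restrict {x ∈ W | Ψ x < c}))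
    {M : ℝ} (hfb : ∀ j, ∀ x ∈ {x ∈ W | Ψ x < c}, ‖f j x‖ ≤ M)
    (hcl : ∀ v, IsTest {x ∈ W | Ψ x < c} v → ∀ j k,
      ∫ x in {x ∈ W | Ψ x < c}, f j x * dzb (b k) v x ∂μ = ∫ x in {x ∈ W | Ψ x < c}, f k x * dzb (b j) v x ∂μ) :
    ∃ u : E → ℂ, (∀ K ⊆ {x ∈ W | Ψ x < c}, IsCompact K → MemLp u 2 (μ.restrict K)) ∧
      ∀ v, IsTest {x ∈ W | Ψ x < c} v → ∀ j,
        ∫ x in {x ∈ W | Ψ x < c}, u x * dzb (b j) v x ∂μ = -∫ x in {x ∈ W | Ψ x < c}, f j x * v x ∂μ := by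
  classical
  have : ProperSpace E := FiniteDimensional.proper ℂ E
  have hΩ : IsOpen {x ∈ W | Ψ x < c} := hΨ.continuousOn.isOpen_inter_preimage hW isOpen_Iio
  set K₁ := {x ∈ W | Ψ x ≤ c} with hK₁
  set Ω := {x ∈ W | Ψ x < c} with hΩdef
  have hΩK : Ω ⊆ K₁ := fun x hx => ⟨hx.1, hx.2.le⟩
  have hKW : K₁ ⊆ W := fun x hx => hx.1
  have hat : ∀ x ∈ Ω, ContDiffAt ℝ 2 Ψ x := fun x hx => hΨ.contDiffAt (hW.mem_nhds hx.1)
  have hdat : ∀ x ∈ Ω, DifferentiableAt ℝ Ψ x := fun x hx => (hat x hx).differentiableAt (by norm_num)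
  -- constants
  obtain ⟨A, hA, hAb⟩ := coord_bound b
  obtain ⟨M₀, hM₀, hT⟩ := exists_bound_deriv_smoothTransition
  obtain ⟨M₁, hM₁, hDb⟩ : ∃ M₁ > 0, ∀ x ∈ K₁, ∀ j, ‖dzR (b j) Ψ x‖ ≤ M₁ := by
    have hcont : ContinuousOn (fderiv ℝ Ψ) W := hΨ.continuousOn_fderiv_of_isOpen hW (by norm_num)
    obtain ⟨M, hM⟩ := hK.exists_bound_of_continuousOn (hcont.mono hKW)
    refine ⟨|M| * (∑ j, ‖b j‖) + 1, by positivity, fun x hx j => ?_⟩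
    have hd : DifferentiableAt ℝ Ψ x :=
      (hΨ.contDiffAt (hW.mem_nhds hx.1)).differentiableAt (by norm_num)
    have h1 : ‖dzR (b j) Ψ x‖ ≤ |M| * ‖b j‖ := by
      rw [← abs_of_nonneg (norm_nonneg (dzR (b j) Ψ x))]
      refine abs_le_of_sq_le_sq ?_ (by positivity)
      rw [norm_dzR_sq hd]
      have h2 : ∀ e, ‖e‖ = ‖b j‖ → (fderiv ℝ Ψ x e) ^ 2 ≤ (|M| * ‖b j‖) ^ 2 := by
        intro e he
        rw [← sq_abs, ← Real.norm_eq_abs]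
        have h3 := (fderiv ℝ Ψ x).le_opNorm e
        rw [he] at h3
        have h4 : ‖fderiv ℝ Ψ x‖ ≤ |M| := (hM x hx).trans (le_abs_self M)
        gcongr
        exact h3.trans (by gcongr)
      have h5 := h2 (b j) rfl
      have h6 := h2 (I • b j) (by simp [norm_smul])
      nlinarith [sq_nonneg (|M| * ‖b j‖)]
    have h7 : ‖b j‖ ≤ ∑ j, ‖b j‖ := Finset.single_le_sum (f := fun j => ‖b j‖) (fun i _ => norm_nonneg _) (Finset.mem_univ j)
    have h8 : |M| * ‖b j‖ ≤ |M| * ∑ j, ‖b j‖ := by gcongr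
    linarith
  obtain ⟨R, hR0, hR⟩ : ∃ R > 0, ∀ x ∈ Ω, c - Ψ x ≤ R := by
    obtain ⟨M, hM⟩ := hK.exists_bound_of_continuousOn (hΨ.continuousOn.mono hKW)
    refine ⟨|c| + |M| + 1, by positivity, fun x hx => ?_⟩
    have h1 := hM x (hΩK hx)
    rw [Real.norm_eq_abs] at h1
    have := neg_abs_le (Ψ x); have := le_abs_self c; have := le_abs_self M
    linarith
  set B : ℝ := (2 * M₀ * M₁) ^ 2 with hB
  have hB0 : 0 < B := by positivity
  set C : ℝ := 4 * R + 4 * A * B / κ with hC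
  have hC0 : 0 < C := by positivity
  set d : E → ℝ := fun x => c - Ψ x with hd
  have hd0 : ∀ x ∈ Ω, 0 < d x := fun x hx => sub_pos.2 hx.2
  have hdC : ContDiffOn ℝ 2 d Ω := contDiffOn_const.sub (hΨ.mono fun x hx => hx.1)
  set φ : E → ℝ := fun x => C / d x with hφ
  set η : E → ℝ := fun x => Real.log B - 2 * Real.log (d x) with hη
  have hexp : ∀ x ∈ Ω, Real.exp (η x) = B / d x ^ 2 := by
    intro x hx
    rw [hη]
    simp only
    rw [Real.exp_sub, Real.exp_log hB0, two_mul, Real.exp_add, Real.exp_log (hd0 x hx), sq]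
  have hφC : ContDiffOn ℝ 2 φ Ω := contDiffOn_const.div hdC fun x hx => (hd0 x hx).ne'
  have hηC : ContDiffOn ℝ 2 η Ω :=
    contDiffOn_const.sub (contDiffOn_const.mul (hdC.log fun x hx => (hd0 x hx).ne'))
  have hlevi : ∀ x ∈ Ω, ∀ v : Fin N → ℂ, 2 * ‖∑ j, dzR (b j) η x * v j‖ ^ 2
      + Real.exp (η x) * ∑ j, ‖v j‖ ^ 2 ≤ 1 / 4 * levi φ x (∑ j, v j • b j) := by
    intro x hx v
    have hdx := hd0 x hx
    set w := ∑ j, v j • b j with hw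
    set P := (fderiv ℝ Ψ x w) ^ 2 + (fderiv ℝ Ψ x (I • w)) ^ 2 with hP
    have e1 : levi φ x w = C / d x ^ 2 * levi Ψ x w + 2 * C / d x ^ 3 * P := by
      refine levi_comp (hat x hx) (h := fun t => C / (c - t)) (h' := fun t => C / (c - t) ^ 2) ?_ ?_ w
      · filter_upwards [gt_mem_nhds (show Ψ x < c from hx.2)] with t ht
        have hne : c - t ≠ 0 := (sub_pos.2 ht).ne'
        have := (hasDerivAt_const t C).div ((hasDerivAt_id t).const_sub c) hne
        refine this.congr_deriv ?_
        simp
      · have hne : c - Ψ x ≠ 0 := hdx.ne'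
        have := (hasDerivAt_const (Ψ x) C).div (((hasDerivAt_id (Ψ x)).const_sub c).pow 2) (pow_ne_zero 2 hne)
        refine this.congr_deriv ?_
        simp only [hd]
        simp
        field_simp
    have e2 : ‖∑ j, dzR (b j) η x * v j‖ ^ 2 = P / d x ^ 2 := by
      have : ∑ j, dzR (b j) η x * v j = dzR w η x := dz_lin b _ x v
      have hdη : HasFDerivAt η ((2 / d x) • fderiv ℝ Ψ x) x := by
        have h1 : HasFDerivAt d (-fderiv ℝ Ψ x) x := (hdat x hx).hasFDerivAt.const_sub c
        have h2 := ((h1.log hdx.ne').const_mul 2).const_sub (Real.log B)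
        refine h2.congr_fderiv ?_
        ext e; simp; field_simp
      rw [this, norm_dzR_sq hdη.differentiableAt, hdη.fderiv]
      simp [hP]; field_simp; ring
    rw [e1, e2, hexp x hx]
    have hPn : 0 ≤ P := by positivity
    have h1 := hlev x hx.1 w
    have h2 := hAb v
    have h3 : d x ≤ R := hR x hx
    have h4 : 2 * (P / d x ^ 2) ≤ 1 / 4 * (2 * C / d x ^ 3 * P) := by
      have : 1 / 4 * (2 * C / d x ^ 3 * P) - 2 * (P / d x ^ 2) = P * (C - 4 * d x) / (2 * d x ^ 3) := by
        field_simp; ring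
      have h5 : 0 ≤ P * (C - 4 * d x) / (2 * d x ^ 3) := by
        have : 0 ≤ C - 4 * d x := by
          have : 0 ≤ 4 * A * B / κ := by positivity
          linarith
        positivity
      linarith
    have h5 : B / d x ^ 2 * ∑ j, ‖v j‖ ^ 2 ≤ 1 / 4 * (C / d x ^ 2 * levi Ψ x w) := by
      have h6 : B * ∑ j, ‖v j‖ ^ 2 ≤ 1 / 4 * (C * levi Ψ x w) := by
        have h7 : C * (κ * ‖w‖ ^ 2) ≤ C * levi Ψ x w := by gcongr
        have h8 : 4 * (B * (A * ‖w‖ ^ 2)) ≤ C * (κ * ‖w‖ ^ 2) := by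
          have : C * (κ * ‖w‖ ^ 2) = 4 * R * κ * ‖w‖ ^ 2 + 4 * (B * (A * ‖w‖ ^ 2)) := by
            rw [hC]; field_simp
          have : 0 ≤ 4 * R * κ * ‖w‖ ^ 2 := by positivity
          linarith
        have h9 : B * ∑ j, ‖v j‖ ^ 2 ≤ B * (A * ‖w‖ ^ 2) := by gcongr
        linarith
      have : B / d x ^ 2 * ∑ j, ‖v j‖ ^ 2 = (B * ∑ j, ‖v j‖ ^ 2) / d x ^ 2 := by ring
      rw [this]
      have : 1 / 4 * (C / d x ^ 2 * levi Ψ x w) = (1 / 4 * (C * levi Ψ x w)) / d x ^ 2 := by ring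
      rw [this]
      gcongr
    linarith
  -- cutoffs
  set χ : ℕ → E → ℝ := fun n x => if x ∈ Ω then Real.smoothTransition (n * d x - 1) else 0 with hχdef
  have hχeq : ∀ n, ∀ x ∈ Ω, χ n =ᶠ[𝓝 x] fun y => Real.smoothTransition (n * d y - 1) := by
    intro n x hx
    filter_upwards [hΩ.mem_nhds hx] with y hy
    simp [hχdef, hy]
  have hsupp : ∀ n, tsupport (χ n) ⊆ Ω ∧ HasCompactSupport (χ n) := by
    intro n
    have hKn : IsCompact (K₁ ∩ {x ∈ K₁ | Ψ x ∈ {t | 1 ≤ n * (c - t)}}) := by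
      refine hK.inter_right ?_
      exact (hΨ.continuousOn.mono hKW).preimage_isClosed_of_isClosed hK.isClosed
        (t := {t : ℝ | 1 ≤ n * (c - t)}) (isClosed_le continuous_const (by fun_prop))
    have hsub : Function.support (χ n) ⊆ K₁ ∩ {x ∈ K₁ | Ψ x ∈ {t | 1 ≤ n * (c - t)}} := by
      intro x hx
      have hxΩ : x ∈ Ω := by by_contra h; simp [hχdef, h] at hx
      refine ⟨hΩK hxΩ, hΩK hxΩ, ?_⟩
      by_contra h
      apply hx
      simp only [mem_setOf_eq, not_le] at h
      simp only [hχdef, hxΩ, if_true]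
      refine Real.smoothTransition.zero_of_nonpos ?_
      simp only [hd]; linarith
    refine ⟨(closure_minimal hsub hKn.isClosed).trans ?_, HasCompactSupport.of_support_subset_isCompact hKn hsub⟩
    rintro x ⟨h1, _, h2⟩
    refine ⟨h1.1, ?_⟩
    simp only [mem_setOf_eq] at h2
    by_contra h
    have : (n:ℝ) * (c - Ψ x) ≤ 0 := mul_nonpos_of_nonneg_of_nonpos (by positivity) (by linarith)
    linarith
  have hχ : CutSeq b Ω η χ := by
    intro n
    have hcat : ∀ x ∈ Ω, ContDiffAt ℝ 2 (χ n) x := by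
      intro x hx
      refine ContDiffAt.congr_of_eventuallyEq ?_ (hχeq n x hx)
      refine Real.smoothTransition.contDiffAt.comp x ?_
      exact (contDiffAt_const.mul (hdC.contDiffAt (hΩ.mem_nhds hx))).sub contDiffAt_const
    refine ⟨contDiff_of_tsup fun x hx => hcat x ((hsupp n).1 hx), (hsupp n).2, (hsupp n).1, ?_, ?_⟩
    · intro x
      by_cases hx : x ∈ Ω
      · simp only [hχdef, hx, if_true]
        exact ⟨Real.smoothTransition.nonneg _, Real.smoothTransition.le_one _⟩
      · simp [hχdef, hx]
    · intro x hx j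
      have hdx := hd0 x hx
      rw [(dzR_levi_congr (hχeq n x hx)).1, hexp x hx]
      set D := deriv Real.smoothTransition (n * d x - 1) with hD
      have hder : HasFDerivAt (fun y => Real.smoothTransition (n * d y - 1)) (-(D * n) • fderiv ℝ Ψ x) x := by
        have h1 : HasFDerivAt d (-fderiv ℝ Ψ x) x := (hdat x hx).hasFDerivAt.const_sub c
        have h2 : HasFDerivAt (fun y => n * d y - 1) ((n:ℝ) • (-fderiv ℝ Ψ x)) x := (h1.const_mul (n:ℝ)).sub_const 1
        have h3 : HasDerivAt Real.smoothTransition D (n * d x - 1) :=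
          ((Real.smoothTransition.contDiff (n := 1)).differentiable (by norm_num) _).hasDerivAt
        refine (h3.comp_hasFDerivAt x h2).congr_fderiv ?_
        ext e; simp; ring
      have e1 : ‖dzR (b j) (fun y => Real.smoothTransition (n * d y - 1)) x‖ ^ 2
          = (D * n) ^ 2 * ‖dzR (b j) Ψ x‖ ^ 2 := by
        rw [norm_dzR_sq hder.differentiableAt, norm_dzR_sq (hdat x hx), hder.fderiv]
        simp; ring
      rw [e1]
      by_cases hD0 : D = 0
      · rw [hD0]; simp; positivity
      have h1 := (hT (n * d x - 1)).2 hD0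
      have h2 : (n:ℝ) ≤ 2 / d x := by rw [le_div_iff₀ hdx]; linarith [h1.2]
      have h3 : D ^ 2 ≤ M₀ ^ 2 := by
        rw [← sq_abs]; gcongr; exact (hT _).1
      calc (D * n) ^ 2 * ‖dzR (b j) Ψ x‖ ^ 2 = D ^ 2 * n ^ 2 * ‖dzR (b j) Ψ x‖ ^ 2 := by ring
        _ ≤ M₀ ^ 2 * (2 / d x) ^ 2 * M₁ ^ 2 := by
          gcongr
          exact hDb x (hΩK hx) j
        _ = B / d x ^ 2 := by rw [hB]; field_simp
  have hχ1 : ∀ x ∈ Ω, ∀ᶠ n in atTop, χ n =ᶠ[𝓝 x] fun _ => 1 := by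
    intro x hx
    have hdx := hd0 x hx
    obtain ⟨n₀, hn₀⟩ := exists_nat_gt (2 / (d x / 2))
    filter_upwards [eventually_ge_atTop n₀] with n hn
    have hdc : ContinuousAt d x := (hdC.contDiffAt (hΩ.mem_nhds hx)).continuousAt
    filter_upwards [hχeq n x hx, hdc.eventually (lt_mem_nhds (show d x / 2 < d x by linarith))] with y h1 h2
    rw [h1]
    refine Real.smoothTransition.one_of_one_le ?_
    have h3 : 2 / (d x / 2) < n := hn₀.trans_le (by exact_mod_cast hn)
    rw [div_lt_iff₀ (by positivity)] at h3
    have h4 : (n:ℝ) * (d x / 2) ≤ n * d y := by gcongr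
    linarith
  -- integrability of f
  have hfin : IsFiniteMeasure (μ.restrict Ω) :=
    ⟨by rw [Measure.restrict_apply_univ]; exact (measure_mono hΩK).trans_lt hK.measure_lt_top⟩
  have hf : ∀ j, MemLp (fun x => ((Real.exp ((η x - φ x) / 2) : ℝ) : ℂ) * f j x) 2 (μ.restrict Ω) := by
    intro j
    have hc1 : ContinuousOn (fun x => ((Real.exp ((η x - φ x) / 2) : ℝ) : ℂ)) Ω := by
      have h1 := hηC.continuousOn; have h2 := hφC.continuousOn
      exact Complex.continuous_ofReal.comp_continuousOn (Real.continuous_exp.comp_continuousOn ((h1.sub h2).div_const 2))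
    refine MemLp.of_bound ((hc1.aestronglyMeasurable hΩ.measurableSet).mul (hfm j)) (Real.sqrt B * (2 / C) * M) ?_
    refine (ae_restrict_iff' hΩ.measurableSet).2 (ae_of_all _ fun x hx => ?_)
    have hdx := hd0 x hx
    rw [norm_mul, Complex.norm_real, Real.norm_eq_abs, abs_of_pos (Real.exp_pos _)]
    have e1 : Real.exp ((η x - φ x) / 2) = Real.sqrt B * (1 / d x * Real.exp (-(C / 2 / d x))) := by
      have : (η x - φ x) / 2 = Real.log B / 2 + (- Real.log (d x)) + (-(C / 2 / d x)) := by
        simp only [hη, hφ]; ring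
      rw [this, Real.exp_add, Real.exp_add, Real.exp_neg (Real.log _), Real.exp_log hdx, ← Real.log_sqrt hB0.le,
        Real.exp_log (Real.sqrt_pos.2 hB0)]
      ring
    have e2 : 1 / d x * Real.exp (-(C / 2 / d x)) ≤ 2 / C := by
      rw [Real.exp_neg]
      have h1 : C / 2 / d x ≤ Real.exp (C / 2 / d x) := by
        have := Real.add_one_le_exp (C / 2 / d x); linarith
      have h2 : 1 / d x = C / 2 / d x * (2 / C) := by field_simp
      rw [h2]
      have h3 : C / 2 / d x * (Real.exp (C / 2 / d x))⁻¹ ≤ 1 := by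
        rw [← div_eq_mul_inv]; exact div_le_one_of_le₀ h1 (Real.exp_pos _).le
      calc C / 2 / d x * (2 / C) * (Real.exp (C / 2 / d x))⁻¹ = (C / 2 / d x * (Real.exp (C / 2 / d x))⁻¹) * (2 / C) := by ring
        _ ≤ 1 * (2 / C) := by gcongr
        _ = _ := one_mul _
    rw [e1]
    gcongr
    exact hfb j x hx
  obtain ⟨u, hu, hu2⟩ := l2_existence μ b hΩ hφC hηC hlevi hχ hχ1 f hf hcl
  refine ⟨u, fun K hKs hKc => ?_, hu2⟩
  have hc1 : ContinuousOn (fun x => ((Real.exp (-(η x - φ x / 2)) : ℝ) : ℂ)) K := by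
    have h1 := hηC.continuousOn.mono hKs; have h2 := hφC.continuousOn.mono hKs
    exact Complex.continuous_ofReal.comp_continuousOn (Real.continuous_exp.comp_continuousOn ((h1.sub (h2.div_const 2)).neg))
  obtain ⟨M', hM'⟩ := hKc.exists_bound_of_continuousOn hc1
  have h1 : MemLp (fun x => ((Real.exp (η x - φ x / 2) : ℝ) : ℂ) * u x) 2 (μ.restrict K) :=
    hu.mono_measure (Measure.restrict_mono hKs le_rfl)
  have h2 : MemLp (fun x => ((Real.exp (-(η x - φ x / 2)) : ℝ) : ℂ) * (((Real.exp (η x - φ x / 2) : ℝ) : ℂ) * u x))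
      2 (μ.restrict K) := by
    refine MemLp.of_le_mul (c := M') h1 ((hc1.aestronglyMeasurable hKc.measurableSet).mul h1.1)
      ((ae_restrict_iff' hKc.measurableSet).2 (ae_of_all _ fun x hx => ?_))
    rw [norm_mul]; gcongr; exact hM' x hx
  refine h2.ae_eq (ae_of_all _ fun x => ?_)
  simp only [← mul_assoc, ← Complex.ofReal_mul, ← Real.exp_add]
  simp

end SteinAux

set_option linter.unusedSectionVars false
set_option linter.unusedSimpArgs false

namespace SteinAux

variable {E : Type*} [NormedAddCommGroup E] [NormedSpace ℂ E]
  [FiniteDimensional ℂ E] [MeasurableSpace E] [BorelSpace E]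
  (μ : Measure E) [μ.IsAddHaarMeasure] {N : ℕ} (b : Module.Basis (Fin N) ℂ E)

lemma taylor2 {Ψ : E → ℝ} {p : E} (hΨ : ContDiffAt ℝ 2 Ψ p) {ε : ℝ} (hε : 0 < ε) :
    ∀ᶠ x in 𝓝 p, |Ψ x - Ψ p - fderiv ℝ Ψ p (x - p) - 1 / 2 * fderiv ℝ (fderiv ℝ Ψ) p (x - p) (x - p)|
      ≤ ε * ‖x - p‖ ^ 2 := by
  set B := fderiv ℝ (fderiv ℝ Ψ) p with hB
  have hsymm : ∀ v w, B v w = B w v := fun v w => snd_symm hΨ v w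
  have hdd : HasFDerivAt (fderiv ℝ Ψ) B p :=
    ((hΨ.fderiv_right (m := 1) (by norm_num)).differentiableAt (by norm_num)).hasFDerivAt
  have h1 := hdd.isLittleO.def hε
  have hd : ∀ᶠ y in 𝓝 p, DifferentiableAt ℝ Ψ y := by
    filter_upwards [hΨ.eventually (by simp)] with y hy
    exact hy.differentiableAt (by norm_num)
  obtain ⟨r, hr, hball⟩ := Metric.eventually_nhds_iff_ball.1 (h1.and hd)
  filter_upwards [ball_mem_nhds p hr] with x hx
  set G : E → ℝ := fun x => Ψ x - Ψ p - fderiv ℝ Ψ p (x - p) - 1 / 2 * B (x - p) (x - p) with hG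
  have hGd : ∀ y ∈ ball p r, HasFDerivAt G (fderiv ℝ Ψ y - fderiv ℝ Ψ p - B (y - p)) y := by
    intro y hy
    have a1 : HasFDerivAt (fun x => x - p) (ContinuousLinearMap.id ℝ E) y := (hasFDerivAt_id y).sub_const p
    have a2 : HasFDerivAt (fun x => fderiv ℝ Ψ p (x - p)) (fderiv ℝ Ψ p ∘L ContinuousLinearMap.id ℝ E) y :=
      (fderiv ℝ Ψ p).hasFDerivAt.comp y a1
    have a3 : HasFDerivAt (fun x => B (x - p)) (B ∘L ContinuousLinearMap.id ℝ E) y := B.hasFDerivAt.comp y a1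
    have a4 := a3.clm_apply a1
    have a5 := (((hball y hy).2.hasFDerivAt.sub_const (Ψ p)).sub a2).sub (a4.const_mul (1 / 2))
    refine a5.congr_fderiv ?_
    ext e
    simp
    rw [hsymm e (y)]; rw [hsymm e p]; ring
  have hsub : closedBall p ‖x - p‖ ⊆ ball p r := by
    refine closedBall_subset_ball ?_
    rwa [mem_ball, dist_eq_norm] at hx
  have key := (convex_closedBall p ‖x - p‖).norm_image_sub_le_of_norm_hasFDerivWithin_le (C := ε * ‖x - p‖)
    (f := G) (x := p) (y := x) (fun y hy => (hGd y (hsub hy)).hasFDerivWithinAt) (fun y hy => by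
      refine ((hball y (hsub hy)).1).trans ?_
      have : ‖y - p‖ ≤ ‖x - p‖ := by rwa [mem_closedBall, dist_eq_norm] at hy
      gcongr) (mem_closedBall_self (norm_nonneg _)) (by simp [dist_eq_norm])
  have hGp : G p = 0 := by simp [hG]
  rw [hGp, sub_zero, Real.norm_eq_abs] at key
  refine key.trans (le_of_eq (by ring))

lemma levi_poly {Ψ : E → ℝ} {p : E} (hΨ : ContDiffAt ℝ 2 Ψ p) {κ : ℝ} (hκ : 0 < κ)
    (hlev : ∀ v, κ * ‖v‖ ^ 2 ≤ levi Ψ p v) :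
    ∃ F : E → ℂ, ContDiff ℝ ∞ F ∧ (∀ x, DifferentiableAt ℂ F x) ∧ F p = 0 ∧
      ∀ᶠ x in 𝓝 p, Ψ p + (F x).re + κ / 8 * ‖x - p‖ ^ 2 ≤ Ψ x := by
  set B := fderiv ℝ (fderiv ℝ Ψ) p with hB
  have hsymm : ∀ v w, B v w = B w v := fun v w => snd_symm hΨ v w
  set L := fderiv ℝ Ψ p with hL
  obtain ⟨J, hJ⟩ : ∃ J : E →L[ℝ] E, ∀ v, J v = I • v :=
    ⟨(I • ContinuousLinearMap.id ℂ E).restrictScalars ℝ, fun v => by simp⟩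
  set F : E → ℂ := fun x => (L (x - p) : ℂ) - I * (L (J (x - p)) : ℂ) + 1 / 4 *
    ((B (x - p) (x - p) : ℂ) - (B (J (x - p)) (J (x - p)) : ℂ) - 2 * I * (B (x - p) (J (x - p)) : ℂ)) with hF
  have hsm : ContDiff ℝ ∞ F := by
    have o : ∀ f : E → ℝ, ContDiff ℝ ∞ f → ContDiff ℝ ∞ (fun x => (f x : ℂ)) := fun f hf => contDiff_ofReal hf
    have s : ContDiff ℝ ∞ (fun x : E => x - p) := contDiff_id.sub contDiff_const
    have sJ : ContDiff ℝ ∞ (fun x : E => J (x - p)) := J.contDiff.comp s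
    have bb : ∀ f g : E → E, ContDiff ℝ ∞ f → ContDiff ℝ ∞ g → ContDiff ℝ ∞ (fun x => B (f x) (g x)) :=
      fun f g hf hg => (B.contDiff.comp hf).clm_apply hg
    refine ((o _ (L.contDiff.comp s)).sub (contDiff_const.mul (o _ (L.contDiff.comp sJ)))).add
      (contDiff_const.mul (((o _ (bb _ _ s s)).sub (o _ (bb _ _ sJ sJ))).sub (contDiff_const.mul (o _ (bb _ _ s sJ)))))
  refine ⟨F, hsm, fun x => ?_, by simp [hF], ?_⟩
  · refine holo_of_dzb (Module.finBasis ℂ E) (hsm.differentiable (by simp) x) fun j => ?_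
    generalize (Module.finBasis ℂ E) j = e
    have a1 : HasFDerivAt (fun x => x - p) (ContinuousLinearMap.id ℝ E) x := (hasFDerivAt_id x).sub_const p
    have a1J : HasFDerivAt (fun x => J (x - p)) J x := J.hasFDerivAt.comp x a1
    have bb : ∀ (f g : E → E) (f' g' : E →L[ℝ] E), HasFDerivAt f f' x → HasFDerivAt g g' x →
        ∃ T : E →L[ℝ] ℂ, HasFDerivAt (fun x => (B (f x) (g x) : ℂ)) T x ∧
          ∀ e, T e = ((B (f x) (g' e) + B (f' e) (g x) : ℝ) : ℂ) := by
      intro f g f' g' hf hg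
      have h1 : HasFDerivAt (fun x => B (f x)) (B ∘L f') x := B.hasFDerivAt.comp x hf
      have h2 := Complex.ofRealCLM.hasFDerivAt.comp x (h1.clm_apply hg)
      exact ⟨_, h2, fun e => by simp⟩
    have ll : ∀ (f : E → E) (f' : E →L[ℝ] E), HasFDerivAt f f' x →
        ∃ T : E →L[ℝ] ℂ, HasFDerivAt (fun x => (L (f x) : ℂ)) T x ∧ ∀ e, T e = ((L (f' e) : ℝ) : ℂ) := by
      intro f f' hf
      have h1 : HasFDerivAt (fun x => L (f x)) (L ∘L f') x := L.hasFDerivAt.comp x hf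
      exact ⟨_, Complex.ofRealCLM.hasFDerivAt.comp x h1, fun e => by simp⟩
    obtain ⟨T1, h1, e1⟩ := ll _ _ a1
    obtain ⟨T2, h2, e2⟩ := ll _ _ a1J
    obtain ⟨T3, h3, e3⟩ := bb _ _ _ _ a1 a1
    obtain ⟨T4, h4, e4⟩ := bb _ _ _ _ a1J a1J
    obtain ⟨T5, h5, e5⟩ := bb _ _ _ _ a1 a1J
    have hFd : HasFDerivAt F (T1 - I • T2 + (1 / 4 : ℂ) • (T3 - T4 - (2 * I) • T5)) x :=
      (h1.sub (h2.const_mul I)).add (((h3.sub h4).sub (h5.const_mul (2 * I))).const_mul (1 / 4 : ℂ))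
    rw [dzb, hFd.fderiv]
    have hJ2 : J (I • e) = -e := by rw [hJ, ← mul_smul]; simp
    simp only [ContinuousLinearMap.add_apply, ContinuousLinearMap.sub_apply, ContinuousLinearMap.smul_apply,
      e1, e2, e3, e4, e5, hJ2, ContinuousLinearMap.id_apply, smul_eq_mul]
    rw [← hJ e]
    set v := x - p
    rw [hsymm (J e) v, hsymm e v, hsymm (J e) (J v), hsymm e (J v)]
    rw [hsymm (-e) (J v)]
    simp only [map_neg]
    push_cast
    linear_combination (1 / 2 * (L e : ℂ) + 1 / 4 * (B v e : ℂ) - 1 / 4 * (B (J v) (J e) : ℂ)) * Complex.I_sq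
  · filter_upwards [taylor2 hΨ (show 0 < κ / 8 by positivity)] with x hx
    have h1 := hlev (x - p)
    rw [levi, ← hB] at h1
    have h2 := (abs_le.1 hx).1
    have h3 : (F x).re = L (x - p) + 1 / 4 * (B (x - p) (x - p) - B (J (x - p)) (J (x - p))) := by
      simp only [hF]
      simp
    rw [h3, hJ]
    linarith


lemma dzb_holo {F : E → ℂ} {x : E} (hF : DifferentiableAt ℂ F x) (e : E) : dzb e F x = 0 := by
  have h : fderiv ℝ F x = (fderiv ℂ F x).restrictScalars ℝ := (hF.hasFDerivAt.restrictScalars ℝ).fderiv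
  rw [dzb, h]
  simp only [ContinuousLinearMap.coe_restrictScalars', map_smul, smul_eq_mul]
  linear_combination (1 / 2 * fderiv ℂ F x e) * Complex.I_sq

lemma inv_trick {F : E → ℂ} (hF : ContDiff ℝ ∞ F) (hFh : ∀ x, DifferentiableAt ℂ F x) {T : Set E}
    (hT : IsClosed T) {v : E → ℂ} (hv : ContDiff ℝ 2 v) (hvc : HasCompactSupport v)
    (hne : ∀ x ∈ T, x ∈ tsupport v → F x ≠ 0) :
    ∃ v' : E → ℂ, ContDiff ℝ 2 v' ∧ HasCompactSupport v' ∧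
      ∀ x ∈ T, v' x = (F x)⁻¹ * v x ∧ ∀ e, dzb e v' x = (F x)⁻¹ * dzb e v x := by
  have hU : IsOpen {x | F x ≠ 0} := isOpen_ne_fun hF.continuous continuous_const
  obtain ⟨θ, hθ, -, hθs, ⟨S, hSo, hS, -, hS1⟩, -⟩ := exists_cutoff
    (K := tsupport v ∩ T) (hvc.isCompact.inter_right hT) hU (fun x hx => hne x hx.2 hx.1)
  have hG : ContDiff ℝ 2 (fun x => θ x • (F x)⁻¹) :=
    contDiff_smul_of_tsupport hU (hθ.of_le two_le_inf).contDiffOn hθs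
      ((hF.of_le two_le_inf).contDiffOn.inv fun x hx => hx)
  refine ⟨fun x => (θ x • (F x)⁻¹) * v x, hG.mul hv, hvc.mul_left, fun x hx => ?_⟩
  by_cases hxv : x ∈ tsupport v
  · have hx0 : F x ≠ 0 := hne x hx hxv
    have hxS : x ∈ S := hS ⟨hxv, hx⟩
    refine ⟨by simp [hS1 x hxS], fun e => ?_⟩
    have h1 : (fun x => (θ x • (F x)⁻¹) * v x) =ᶠ[𝓝 x] fun x => (F x)⁻¹ * v x := by
      filter_upwards [hSo.mem_nhds hxS] with y hy
      simp [hS1 y hy]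
    have hi : DifferentiableAt ℂ (fun y => (F y)⁻¹) x := (hFh x).inv hx0
    rw [dzb_congr e h1, dzb_mul e (hi.restrictScalars ℝ) (hv.differentiable (by norm_num) x), dzb_holo hi]
    ring
  · have h0 : v x = 0 := image_eq_zero_of_notMem_tsupport hxv
    refine ⟨by simp [h0], fun e => ?_⟩
    rw [dzb_zero_of_notMem e hxv, mul_zero]
    apply dzb_zero_of_notMem
    intro h
    exact hxv (closure_mono (Function.support_mul_subset_right _ _) h)

end SteinAux

set_option linter.unusedSectionVars false
set_option linter.unusedSimpArgs false

namespace SteinAux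

variable {E : Type*} [NormedAddCommGroup E] [NormedSpace ℂ E]
  [FiniteDimensional ℂ E] [MeasurableSpace E] [BorelSpace E]
  (μ : Measure E) [μ.IsAddHaarMeasure] {N : ℕ} (b : Module.Basis (Fin N) ℂ E)

set_option maxHeartbeats 1000000 in
theorem peak {W : Set E} (hW : IsOpen W) {Ψ : E → ℝ} (hΨ : ContDiffOn ℝ 2 Ψ W) {κ c c' : ℝ} (hκ : 0 < κ)
    (hlev : ∀ x ∈ W, ∀ v, κ * ‖v‖ ^ 2 ≤ levi Ψ x v) (hcc : c < c') (hK : IsCompact {x ∈ W | Ψ x ≤ c'})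
    {p : E} (hpW : p ∈ W) (hpc : Ψ p = c) :
    ∃ H : E → ℂ, DifferentiableOn ℂ H {x ∈ W | Ψ x < c} ∧
      Tendsto (fun x => ‖H x‖) (𝓝[{x ∈ W | Ψ x < c}] p) atTop := by
  have : ProperSpace E := FiniteDimensional.proper ℂ E
  let μ : Measure E := Measure.addHaar
  let b := Module.finBasis ℂ E
  obtain ⟨F, hF, hFh, hFp, hFe⟩ := levi_poly (hΨ.contDiffAt (hW.mem_nhds hpW)) hκ (hlev p hpW)
  obtain ⟨r, hr, hball⟩ := Metric.eventually_nhds_iff_ball.1 (hFe.and (hW.mem_nhds hpW))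
  rw [hpc] at hball
  set δ : ℝ := κ / 8 * (r / 3) ^ 2 / 2 with hδ
  have hδ0 : 0 < δ := by positivity
  set c₁ := min c' (c + δ) with hc₁
  have hcc₁ : c < c₁ := lt_min hcc (by linarith)
  have hc₁' : c₁ ≤ c' := min_le_left _ _
  have hc₁δ : c₁ ≤ c + δ := min_le_right _ _
  have hK₁ : IsCompact {x ∈ W | Ψ x ≤ c₁} := by
    have : {x ∈ W | Ψ x ≤ c₁} = {x ∈ {x ∈ W | Ψ x ≤ c'} | Ψ x ∈ Iic c₁} := by
      ext x; simp only [mem_setOf_eq, mem_Iic]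
      exact ⟨fun h => ⟨⟨h.1, h.2.trans hc₁'⟩, h.2⟩, fun h => ⟨h.1.1, h.2⟩⟩
    rw [this]
    refine hK.of_isClosed_subset ?_ (fun x hx => hx.1)
    exact (hΨ.continuousOn.mono fun x hx => hx.1).preimage_isClosed_of_isClosed hK.isClosed isClosed_Iic
  have hΩ : IsOpen {x ∈ W | Ψ x < c} := hΨ.continuousOn.isOpen_inter_preimage hW isOpen_Iio
  have hΩ₁ : IsOpen {x ∈ W | Ψ x < c₁} := hΨ.continuousOn.isOpen_inter_preimage hW isOpen_Iio
  have hsolve := fun f => solve_dbar μ b hW hΨ hκ hlev hK₁ f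
  set Ω := {x ∈ W | Ψ x < c} with hΩdef
  set Ω₁ := {x ∈ W | Ψ x < c₁} with hΩ₁def
  have hΩΩ₁ : Ω ⊆ Ω₁ := fun x hx => ⟨hx.1, hx.2.trans hcc₁⟩
  -- cutoff
  obtain ⟨θ, hθ, hθc, hθs, ⟨S, hSo, hS, -, hS1⟩, hθ01⟩ := exists_cutoff
    (isCompact_closedBall p (r / 3)) (isOpen_ball (x := p) (ε := 2 * r / 3)) (closedBall_subset_ball (by linarith))
  have hθs' : tsupport θ ⊆ ball p r := hθs.trans (ball_subset_ball (by linarith))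
  set Θ : E → ℂ := fun x => (θ x : ℂ) with hΘ
  have hΘC : ContDiff ℝ 2 Θ := contDiff_ofReal (hθ.of_le two_le_inf)
  have hΘsupp : tsupport Θ ⊆ tsupport θ := by
    refine closure_mono fun x hx => ?_
    simpa [hΘ] using hx
  have hΘc : HasCompactSupport Θ := hθc.comp_left (g := fun t : ℝ => (t : ℂ)) (by simp)
  -- lower bound on F
  have hFΩ : ∀ x ∈ Ω, x ∈ ball p r → (F x).re < 0 := by
    intro x hx hxb
    have h1 := (hball x hxb).1
    have h2 : Ψ x < c := hx.2
    have : 0 ≤ κ / 8 * ‖x - p‖ ^ 2 := by positivity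
    linarith
  set T : Set E := tsupport θ ∩ (ball p (r / 3))ᶜ with hT
  have hTc : IsClosed T := (isClosed_tsupport θ).inter isOpen_ball.isClosed_compl
  have hFT : ∀ x ∈ Ω₁, x ∈ T → δ ≤ ‖F x‖ := by
    intro x hx hxT
    have h1 := (hball x (hθs' hxT.1)).1
    have h2 : Ψ x < c₁ := hx.2
    have h3 : r / 3 ≤ ‖x - p‖ := by
      have := hxT.2
      simpa [dist_eq_norm] using this
    have h4 : κ / 8 * (r / 3) ^ 2 ≤ κ / 8 * ‖x - p‖ ^ 2 := by gcongr
    have h5 : (F x).re ≤ -δ := by rw [hδ] at *; linarith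
    have h6 := Complex.abs_re_le_norm (F x)
    have h7 := neg_abs_le (F x).re
    linarith
  have hdT : ∀ x ∉ T, ∀ e, dzb e Θ x = 0 := by
    intro x hx e
    by_cases hxs : x ∈ tsupport θ
    · have hxb : x ∈ ball p (r / 3) := by by_contra h; exact hx ⟨hxs, h⟩
      have : Θ =ᶠ[𝓝 x] fun _ => 1 := by
        filter_upwards [isOpen_ball.mem_nhds hxb] with y hy
        simp [hΘ, hS1 y (hS (ball_subset_closedBall hy))]
      rw [dzb_congr e this]; simp [dzb]
    · exact dzb_zero_of_notMem e fun h => hxs (hΘsupp h)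
  have hdc : ∀ e, Continuous (dzb e Θ) := fun e => (contDiff_dzb (k := 1) hΘC (by norm_num) e).continuous
  set f : Fin (Module.finrank ℂ E) → E → ℂ := fun j x => dzb (b j) Θ x * (F x)⁻¹ with hf
  have hfm : ∀ j, Measurable (f j) := fun j => (hdc _).measurable.mul (hF.continuous.measurable.inv)
  obtain ⟨M, hM⟩ : ∃ M, ∀ j, ∀ x, ‖dzb (b j) Θ x‖ ≤ M := by
    have : ∀ j, ∃ M, ∀ x, ‖dzb (b j) Θ x‖ ≤ M := fun j =>
      (hcs_dzb _ hΘc).exists_bound_of_continuous (hdc _)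
    choose M hM using this
    refine ⟨∑ j, |M j|, fun j x => (hM j x).trans ((le_abs_self _).trans ?_)⟩
    exact Finset.single_le_sum (f := fun j => |M j|) (fun i _ => abs_nonneg _) (Finset.mem_univ j)
  obtain ⟨u, huL, hu⟩ := hsolve f (fun j => (hfm j).aestronglyMeasurable) (M := M / δ)
    (by
      intro j x hx
      by_cases hxT : x ∈ T
      · have h1 := hFT x hx hxT
        rw [hf]; simp only
        rw [norm_mul, norm_inv, ← div_eq_mul_inv]
        gcongr
        · exact (norm_nonneg _).trans (hM j x)
        · exact hM j x
      · rw [hf]; simp only [hdT x hxT]; simp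
        have : 0 ≤ M := (norm_nonneg _).trans (hM j x)
        positivity)
    (by
      intro v hv j k
      obtain ⟨v', hv', hvc', hvT⟩ := inv_trick hF hFh hTc hv.1 hv.2.1 (fun x hxT hxv h0 => by
        have := hFT x (hv.2.2 hxv) hxT
        rw [h0, norm_zero] at this; linarith)
      have e : ∀ i l x, f i x * dzb (b l) v x = dzb (b i) Θ x * dzb (b l) v' x := by
        intro i l x
        by_cases hxT : x ∈ T
        · rw [(hvT x hxT).2]; simp only [hf]; ring
        · simp only [hf, hdT x hxT]; simp
      have hz : ∀ i l, ∀ x ∉ Ω₁, f i x * dzb (b l) v x = 0 := fun i l x hx => by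
        rw [dzb_zero_of_notMem _ (fun h => hx (hv.2.2 h)), mul_zero]
      rw [setInt_eq μ (hz j k), setInt_eq μ (hz k j)]
      simp only [e]
      exact ibp_dzb_dzb μ hΘC hv' hvc' (b j) (b k))
  -- holomorphic function on Ω
  have hFne : ∀ x ∈ Ω, x ∈ tsupport θ → F x ≠ 0 := by
    intro x hx hxs h0
    have := hFΩ x hx (hθs' hxs)
    rw [h0] at this; simp at this
  have hqC : ContinuousOn (fun x => Θ x * (F x)⁻¹) Ω := by
    intro x hx
    by_cases hxs : x ∈ tsupport θ
    · exact (hΘC.continuous.continuousAt.mul (hF.continuous.continuousAt.inv₀ (hFne x hx hxs))).continuousWithinAt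
    · have : (fun x => Θ x * (F x)⁻¹) =ᶠ[𝓝 x] fun _ => 0 := by
        filter_upwards [notMem_tsupport_iff_eventuallyEq.1 hxs] with y hy
        simp [hΘ, hy]
      exact (continuousAt_const.congr this.symm).continuousWithinAt
  have hw1 : ∀ v, IsTest Ω v → ∀ j, ∫ x in Ω, (Θ x * (F x)⁻¹ - u x) * dzb (b j) v x ∂μ = 0 := by
    intro v hv j
    have hv₁ : IsTest Ω₁ v := ⟨hv.1, hv.2.1, hv.2.2.trans hΩΩ₁⟩
    obtain ⟨v', hv', hvc', hvT⟩ := inv_trick hF hFh (isClosed_tsupport θ) hv.1 hv.2.1 (fun x hxT hxv => hFne x (hv.2.2 hxv) hxT)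
    have hdv : Continuous (dzb (b j) v) := (contDiff_dzb (k := 1) hv.1 (by norm_num) _).continuous
    have e1 : ∫ x in Ω, Θ x * (F x)⁻¹ * dzb (b j) v x ∂μ = - ∫ x in Ω₁, f j x * v x ∂μ := by
      rw [setInt_eq μ (fun x hx => by
        rw [dzb_zero_of_notMem _ (fun h => hx (hv.2.2 h)), mul_zero])]
      rw [setInt_eq μ (fun x hx => by
        rw [image_eq_zero_of_notMem_tsupport (fun h => hx (hv₁.2.2 h)), mul_zero])]
      have h1 : ∀ x, Θ x * (F x)⁻¹ * dzb (b j) v x = Θ x * dzb (b j) v' x := by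
        intro x
        by_cases hxs : x ∈ tsupport θ
        · rw [(hvT x hxs).2]; ring
        · have : Θ x = 0 := by simp [hΘ, image_eq_zero_of_notMem_tsupport hxs]
          simp [this]
      have h2 : ∀ x, f j x * v x = dzb (b j) Θ x * v' x := by
        intro x
        by_cases hxs : x ∈ tsupport θ
        · rw [(hvT x hxs).1]; simp only [hf]; ring
        · have : dzb (b j) Θ x = 0 := dzb_zero_of_notMem _ fun h => hxs (hΘsupp h)
          simp [hf, this]
      simp only [h1, h2]
      exact ibp_dzb μ (hΘC.of_le (by norm_num)) (hv'.of_le (by norm_num)) hvc' (b j)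
    have e2 : ∫ x in Ω, u x * dzb (b j) v x ∂μ = - ∫ x in Ω₁, f j x * v x ∂μ := by
      rw [← hu v hv₁ j]
      rw [setInt_eq μ (fun x hx => by
        rw [dzb_zero_of_notMem _ (fun h => hx (hv.2.2 h)), mul_zero])]
      rw [setInt_eq μ (fun x hx => by
        rw [dzb_zero_of_notMem _ (fun h => hx (hv₁.2.2 h)), mul_zero])]
    have hintg : ∀ w : E → ℂ, IntegrableOn (fun x => w x * dzb (b j) v x) (tsupport v) μ →
        IntegrableOn (fun x => w x * dzb (b j) v x) Ω μ := by
      intro w hw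
      refine hw.of_forall_diff_eq_zero hΩ.measurableSet ?_
      rintro x ⟨_, hx⟩
      rw [dzb_zero_of_notMem _ hx, mul_zero]
    have i1 : IntegrableOn (fun x => Θ x * (F x)⁻¹ * dzb (b j) v x) Ω μ := by
      apply hintg
      exact ((hqC.mono hv.2.2).mul hdv.continuousOn).integrableOn_compact hv.2.1
    have i2 : IntegrableOn (fun x => u x * dzb (b j) v x) Ω μ := by
      apply hintg
      have h1 := huL _ hv₁.2.2 hv.2.1
      have h2 : MemLp (dzb (b j) v) 2 (μ.restrict (tsupport v)) :=
        (hdv.memLp_of_hasCompactSupport (hcs_dzb _ hv.2.1)).restrict _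
      exact h1.integrable_mul h2
    simp only [sub_mul]
    rw [integral_sub i1 i2, e1, e2, sub_self]
  have hqL : ∀ K ⊆ Ω, IsCompact K → MemLp (fun x => Θ x * (F x)⁻¹) 2 (μ.restrict K) := by
    intro K hKs hKc
    obtain ⟨B, hB⟩ := hKc.exists_bound_of_continuousOn (hqC.mono hKs)
    have : IsFiniteMeasure (μ.restrict K) := ⟨by simpa using hKc.measure_lt_top⟩
    refine MemLp.of_bound ((hqC.mono hKs).aestronglyMeasurable hKc.measurableSet) B ?_
    filter_upwards [ae_restrict_mem hKc.measurableSet] with x hx using hB x hx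
  obtain ⟨H, hH, hHu⟩ := weyl μ b hΩ (u := fun x => Θ x * (F x)⁻¹ - u x) (fun K hKs hKc =>
    (MemLp.sub (hqL K hKs hKc) (huL K (hKs.trans hΩΩ₁) hKc))) hw1
  -- holomorphic function near p
  set S₁ := ball p (r / 3) ∩ Ω₁ with hS₁
  have hS₁o : IsOpen S₁ := isOpen_ball.inter hΩ₁
  have hS₁f : ∀ x ∈ S₁, ∀ j, f j x = 0 := by
    intro x hx j
    simp only [hf]
    rw [hdT x (fun h => h.2 hx.1), zero_mul]
  obtain ⟨G, hG, hGu⟩ := weyl μ b hS₁o (u := u) (fun K hKs hKc => huL K (hKs.trans inter_subset_right) hKc) (by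
    intro v hv j
    have hv₁ : IsTest Ω₁ v := ⟨hv.1, hv.2.1, hv.2.2.trans inter_subset_right⟩
    rw [setInt_eq μ (fun x hx => by
        rw [dzb_zero_of_notMem _ (fun h => hx (hv.2.2 h)), mul_zero])]
    have := hu v hv₁ j
    rw [setInt_eq μ (fun x hx => by
        rw [dzb_zero_of_notMem _ (fun h => hx (hv₁.2.2 h)), mul_zero])] at this
    rw [this]
    have h0 : ∀ x, f j x * v x = 0 := by
      intro x
      by_cases hx : x ∈ S₁
      · rw [hS₁f x hx, zero_mul]
      · rw [image_eq_zero_of_notMem_tsupport (fun h => hx (hv.2.2 h)), mul_zero]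
    simp [h0])
  have hpS₁ : p ∈ S₁ := ⟨mem_ball_self (by positivity), hpW, by rw [hpc]; exact hcc₁⟩
  have hagree : EqOn H (fun x => (F x)⁻¹ - G x) (S₁ ∩ Ω) := by
    have hFi : ContinuousOn (fun x => (F x)⁻¹) (S₁ ∩ Ω) := by
      refine hF.continuous.continuousOn.inv₀ fun x hx h0 => ?_
      have := hFΩ x hx.2 (ball_subset_ball (by linarith) hx.1.1)
      rw [h0] at this; simp at this
    have ha : (fun x => Θ x * (F x)⁻¹ - u x) =ᵐ[μ.restrict (S₁ ∩ Ω)] H :=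
      ae_restrict_of_ae_restrict_of_subset inter_subset_right hHu
    have hb : u =ᵐ[μ.restrict (S₁ ∩ Ω)] G :=
      ae_restrict_of_ae_restrict_of_subset inter_subset_left hGu
    refine Measure.eqOn_open_of_ae_eq (μ := μ) ?_ (hS₁o.inter hΩ) (hH.continuousOn.mono inter_subset_right)
      (hFi.sub (hG.continuousOn.mono inter_subset_left))
    filter_upwards [ha, hb, ae_restrict_mem (hS₁o.inter hΩ).measurableSet] with x h1 h2 h3
    rw [← h1, h2]
    simp [hΘ, hS1 x (hS (ball_subset_closedBall h3.1.1))]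
  refine ⟨H, hH, ?_⟩
  have hGc : ContinuousAt G p := (hG.continuousOn).continuousAt (hS₁o.mem_nhds hpS₁)
  have hFt : Tendsto (fun x => ‖(F x)⁻¹‖) (𝓝[Ω] p) atTop := by
    have h1 : Tendsto F (𝓝[Ω] p) (𝓝[≠] 0) := by
      refine tendsto_nhdsWithin_iff.2 ⟨?_, ?_⟩
      · have := hF.continuous.tendsto p
        rw [hFp] at this
        exact this.mono_left nhdsWithin_le_nhds
      · filter_upwards [self_mem_nhdsWithin, mem_nhdsWithin_of_mem_nhds (ball_mem_nhds p hr)] with x hx hxb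
        intro h0
        have h0' : F x = 0 := h0
        have := hFΩ x hx hxb
        rw [h0'] at this; simp at this
    exact (tendsto_norm_cobounded_atTop.comp tendsto_inv₀_nhdsNE_zero).comp h1
  have hG2 : Tendsto (fun x => -‖G x‖) (𝓝[Ω] p) (𝓝 (-‖G p‖)) :=
    (hGc.norm.neg).tendsto.mono_left nhdsWithin_le_nhds
  refine tendsto_atTop_mono' _ ?_ (hFt.atTop_add hG2)
  filter_upwards [self_mem_nhdsWithin, mem_nhdsWithin_of_mem_nhds (hS₁o.mem_nhds hpS₁)] with x hx hx1
  rw [hagree ⟨hx1, hx⟩]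
  have := norm_sub_norm_le (F x)⁻¹ (G x)
  linarith

theorem stein_sublevel {W : Set E} (hW : IsOpen W) {Ψ : E → ℝ} (hΨ : ContDiffOn ℝ 2 Ψ W) {κ c c' : ℝ} (hκ : 0 < κ)
    (hlev : ∀ x ∈ W, ∀ v, κ * ‖v‖ ^ 2 ≤ levi Ψ x v) (hcc : c < c') (hK : IsCompact {x ∈ W | Ψ x ≤ c'}) :
    SteinOpen {x ∈ W | Ψ x < c} := by
  have : ProperSpace E := FiniteDimensional.proper ℂ E
  have hΩ : IsOpen {x ∈ W | Ψ x < c} := hΨ.continuousOn.isOpen_inter_preimage hW isOpen_Iio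
  refine ⟨hΩ, fun K hKΩ hKc => ?_⟩
  set Ω := {x ∈ W | Ψ x < c} with hΩdef
  set Ĥ := {z ∈ Ω | ∀ h : E → ℂ, DifferentiableOn ℂ h Ω → ‖h z‖ ≤ sSup ((fun w => ‖h w‖) '' K)} with hĤ
  have hsub : Ĥ ⊆ {x ∈ W | Ψ x ≤ c'} := fun x hx => ⟨hx.1.1, hx.1.2.le.trans hcc.le⟩
  refine hK.of_isClosed_subset ?_ hsub
  refine isClosed_of_closure_subset fun z hz => ?_
  have hzK : z ∈ {x ∈ W | Ψ x ≤ c'} := closure_minimal hsub hK.isClosed hz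
  have hnb : (𝓝[Ĥ] z).NeBot := mem_closure_iff_nhdsWithin_neBot.1 hz
  have hzc : Ψ z ≤ c := by
    have h1 : Tendsto Ψ (𝓝[Ĥ] z) (𝓝 (Ψ z)) :=
      ((hΨ.continuousOn.continuousAt (hW.mem_nhds hzK.1)).tendsto).mono_left nhdsWithin_le_nhds
    refine le_of_tendsto h1 ?_
    filter_upwards [self_mem_nhdsWithin] with x hx using hx.1.2.le
  rcases hzc.lt_or_eq with hlt | heq
  · refine ⟨⟨hzK.1, hlt⟩, fun h hh => ?_⟩
    have h1 : Tendsto (fun x => ‖h x‖) (𝓝[Ĥ] z) (𝓝 ‖h z‖) :=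
      ((hh.continuousOn.continuousAt (hΩ.mem_nhds ⟨hzK.1, hlt⟩)).norm.tendsto).mono_left nhdsWithin_le_nhds
    refine le_of_tendsto h1 ?_
    filter_upwards [self_mem_nhdsWithin] with x hx using hx.2 h hh
  · exfalso
    obtain ⟨H, hH, hHt⟩ := peak hW hΨ hκ hlev hcc hK hzK.1 heq
    have h1 : Tendsto (fun x => ‖H x‖) (𝓝[Ĥ] z) atTop := hHt.mono_left (nhdsWithin_mono z fun x hx => hx.1)
    obtain ⟨x, h2, h3⟩ := ((h1.eventually_gt_atTop (sSup ((fun w => ‖H w‖) '' K))).and self_mem_nhdsWithin).exists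
    exact absurd (h3.2 H hH) (not_le.2 h2)

end SteinAux

set_option linter.unusedSectionVars false
set_option linter.unusedSimpArgs false

namespace SteinAux

variable {E : Type*} [NormedAddCommGroup E] [NormedSpace ℂ E]
  [FiniteDimensional ℂ E] [MeasurableSpace E] [BorelSpace E]
  (μ : Measure E) [μ.IsAddHaarMeasure] {N : ℕ} (b : Module.Basis (Fin N) ℂ E)

lemma levi_smul (φ : E → ℝ) (x v : E) (t : ℝ) : levi φ x (t • v) = t ^ 2 * levi φ x v := by
  have : I • (t • v) = t • (I • v) := smul_comm _ _ _
  simp only [levi, this, map_smul, ContinuousLinearMap.smul_apply, smul_eq_mul]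
  ring

lemma levi_strict {V K : Set E} {ρ : E → ℝ} (hV : IsOpen V) (hρ : ContDiffOn ℝ 2 ρ V) (hK : IsCompact K)
    (hKV : K ⊆ V) (hlev : ∀ x ∈ K, ∀ v, v ≠ 0 → fderiv ℝ ρ x v = 0 → fderiv ℝ ρ x (I • v) = 0 →
      0 < levi ρ x v) :
    ∃ C κ : ℝ, 0 < C ∧ 0 < κ ∧ ∃ V', IsOpen V' ∧ K ⊆ V' ∧ V' ⊆ V ∧ ∀ x ∈ V', ∀ v,
      κ * ‖v‖ ^ 2 ≤ levi ρ x v + C * ((fderiv ℝ ρ x v) ^ 2 + (fderiv ℝ ρ x (I • v)) ^ 2) := by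
  have : ProperSpace E := FiniteDimensional.proper ℂ E
  have c1 : ContinuousOn (fderiv ℝ ρ) V := hρ.continuousOn_fderiv_of_isOpen hV (by norm_num)
  have c2 : ContinuousOn (fderiv ℝ (fderiv ℝ ρ)) V :=
    (hρ.fderiv_of_isOpen (m := 1) hV (by norm_num)).continuousOn_fderiv_of_isOpen hV (by norm_num)
  set A : E × E → ℝ := fun p => levi ρ p.1 p.2 with hA
  set B : E × E → ℝ := fun p => (fderiv ℝ ρ p.1 p.2) ^ 2 + (fderiv ℝ ρ p.1 (I • p.2)) ^ 2 with hB
  have hmaps : MapsTo Prod.fst (V ×ˢ (univ : Set E)) V := fun p hp => hp.1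
  have c1' := c1.comp continuousOn_fst hmaps
  have c2' := c2.comp continuousOn_fst hmaps
  have cI : Continuous fun p : E × E => I • p.2 := by fun_prop
  have cA : ContinuousOn A (V ×ˢ univ) := by
    simp only [hA, levi]
    exact ((c2'.clm_apply continuousOn_snd).clm_apply continuousOn_snd).add
      ((c2'.clm_apply cI.continuousOn).clm_apply cI.continuousOn)
  have cB : ContinuousOn B (V ×ˢ univ) := by
    simp only [hB]
    exact ((c1'.clm_apply continuousOn_snd).pow 2).add ((c1'.clm_apply cI.continuousOn).pow 2)
  have hB0 : ∀ p, 0 ≤ B p := fun p => by positivity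
  have hVo : IsOpen (V ×ˢ (univ : Set E)) := hV.prod isOpen_univ
  set T : ℕ → Set (E × E) := fun n => {p ∈ V ×ˢ (univ : Set E) | 1 / ((n : ℝ) + 1) < A p + (n + 1) * B p} with hT
  have hTo : ∀ n, IsOpen (T n) := fun n =>
    (cA.add (continuousOn_const.mul cB)).isOpen_inter_preimage hVo isOpen_Ioi
  obtain ⟨n, hn⟩ := (hK.prod (isCompact_sphere (0 : E) 1)).elim_directed_cover T hTo (by
    rintro ⟨x, v⟩ ⟨hx, hv⟩
    have hx : x ∈ K := hx
    have hv : ‖v‖ = 1 := by simpa using hv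
    have hv0 : v ≠ 0 := by rintro rfl; simp at hv
    have key : ∀ᶠ n : ℕ in atTop, 1 / ((n : ℝ) + 1) < A (x, v) + (n + 1) * B (x, v) := by
      have ht : Tendsto (fun n : ℕ => 1 / ((n : ℝ) + 1)) atTop (𝓝 0) := tendsto_one_div_add_atTop_nhds_zero_nat
      have hs : Tendsto (fun n : ℕ => (n : ℝ) + 1) atTop atTop :=
        tendsto_atTop_add_const_right _ _ tendsto_natCast_atTop_atTop
      rcases (hB0 (x, v)).eq_or_lt with h0 | h0
      · have hpos : 0 < A (x, v) := by
          have h1 : (fderiv ℝ ρ x v) ^ 2 + (fderiv ℝ ρ x (I • v)) ^ 2 = 0 := h0.symm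
          refine hlev x hx v hv0 ?_ ?_
          · nlinarith [sq_nonneg (fderiv ℝ ρ x v), sq_nonneg (fderiv ℝ ρ x (I • v))]
          · nlinarith [sq_nonneg (fderiv ℝ ρ x v), sq_nonneg (fderiv ℝ ρ x (I • v))]
        filter_upwards [ht.eventually_lt_const hpos] with n hn
        rw [← h0]; linarith
      · have h3 : Tendsto (fun n : ℕ => A (x, v) + ((n : ℝ) + 1) * B (x, v)) atTop atTop :=
          tendsto_atTop_add_const_left _ _ (hs.atTop_mul_const h0)
        filter_upwards [ht.eventually_lt_const one_pos, h3.eventually_gt_atTop 1] with n h1 h2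
        linarith
    obtain ⟨n, hn⟩ := key.exists
    exact mem_iUnion.2 ⟨n, ⟨hKV hx, mem_univ _⟩, hn⟩) (by
    refine directed_of_isDirected_le fun i j hij p hp => ⟨hp.1, ?_⟩
    have hij' : (i : ℝ) ≤ j := by exact_mod_cast hij
    have h1 : 1 / ((j : ℝ) + 1) ≤ 1 / ((i : ℝ) + 1) := by gcongr
    have h2 : ((i : ℝ) + 1) * B p ≤ (j + 1) * B p := by
      have := hB0 p
      gcongr
    have := hp.2
    show 1 / ((j : ℝ) + 1) < A p + (j + 1) * B p
    linarith)
  obtain ⟨u, w, hu, hw, hKu, hsw, huw⟩ := generalized_tube_lemma hK (isCompact_sphere (0 : E) 1) (hTo n) hn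
  refine ⟨n + 1, 1 / ((n : ℝ) + 1), by positivity, by positivity, u ∩ V, hu.inter hV, subset_inter hKu hKV,
    inter_subset_right, fun x hx v => ?_⟩
  rcases eq_or_ne v 0 with rfl | hv
  · simp [levi]
  · have hvn : 0 < ‖v‖ := norm_pos_iff.2 hv
    have hs : ‖v‖⁻¹ • v ∈ sphere (0 : E) 1 := by
      simp [norm_smul, hvn.ne']
    have h1 := (huw (show (x, ‖v‖⁻¹ • v) ∈ u ×ˢ w from ⟨hx.1, hsw hs⟩)).2
    have e : v = ‖v‖ • (‖v‖⁻¹ • v) := by rw [smul_smul, mul_inv_cancel₀ hvn.ne', one_smul]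
    set y := ‖v‖⁻¹ • v
    have e1 : levi ρ x v = ‖v‖ ^ 2 * A (x, y) := by
      conv_lhs => rw [e]
      rw [levi_smul]
    have e2 : (fderiv ℝ ρ x v) ^ 2 + (fderiv ℝ ρ x (I • v)) ^ 2 = ‖v‖ ^ 2 * B (x, y) := by
      have : I • (‖v‖ • y) = ‖v‖ • (I • y) := smul_comm _ _ _
      conv_lhs => rw [e]
      rw [this]
      simp only [hB, map_smul, smul_eq_mul]; ring
    rw [e1, e2]
    have : 0 < ‖v‖ ^ 2 := by positivity
    nlinarith

lemma exists_field {V K O : Set E} {ρ : E → ℝ} (hV : IsOpen V) (hρ : ContDiffOn ℝ 2 ρ V) (hK : IsCompact K)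
    (hKV : K ⊆ V) (hO : IsOpen O) (hKO : K ⊆ O) (hd : ∀ x ∈ K, fderiv ℝ ρ x ≠ 0) :
    ∃ n : E → E, ContDiff ℝ 2 n ∧ HasCompactSupport n ∧ tsupport n ⊆ O ∧ ∀ x ∈ K, 1 < fderiv ℝ ρ x (n x) := by
  classical
  have : ProperSpace E := FiniteDimensional.proper ℂ E
  have : FiniteDimensional ℝ E := FiniteDimensional.complexToReal E
  have c1 : ContinuousOn (fderiv ℝ ρ) V := hρ.continuousOn_fderiv_of_isOpen hV (by norm_num)
  obtain ⟨n, hn⟩ := exists_contMDiffMap_forall_mem_convex_of_local_const (M := E) (F := E)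
    (modelWithCornersSelf ℝ E) (n := ⊤)
    (t := fun x => {c : E | x ∈ K → 1 < fderiv ℝ ρ x c}) (by
      intro x
      by_cases hx : x ∈ K
      · simp only [hx, forall_const]
        exact (convex_Ioi (1 : ℝ)).linear_preimage (fderiv ℝ ρ x).toLinearMap
      · simp only [hx, false_imp_iff, setOf_true]
        exact convex_univ) (by
      intro x
      by_cases hx : x ∈ K
      · obtain ⟨c, hc⟩ : ∃ c, fderiv ℝ ρ x c ≠ 0 := by
          by_contra h; push Not at h
          exact hd x hx (by ext c; simpa using h c)
        refine ⟨(2 / fderiv ℝ ρ x c) • c, ?_⟩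
        have h2 : fderiv ℝ ρ x ((2 / fderiv ℝ ρ x c) • c) = 2 := by
          rw [map_smul, smul_eq_mul]; field_simp
        have ct : ContinuousAt (fun y => fderiv ℝ ρ y ((2 / fderiv ℝ ρ x c) • c)) x :=
          (c1.continuousAt (hV.mem_nhds (hKV hx))).clm_apply continuousAt_const
        have := ct.tendsto.eventually_const_lt (u := 1) (by rw [h2]; norm_num)
        filter_upwards [this] with y hy _ using hy
      · refine ⟨0, ?_⟩
        filter_upwards [hK.isClosed.isOpen_compl.mem_nhds hx] with y hy hy2
        exact absurd hy2 hy)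
  obtain ⟨θ, hθ, hθc, hθs, ⟨S, hSo, hS, -, hS1⟩, hθ01⟩ := exists_cutoff hK hO hKO
  have hn' : ContDiff ℝ ∞ n := n.contMDiff.contDiff
  refine ⟨fun x => θ x • n x, (hθ.smul hn').of_le two_le_inf, hθc.smul_right, ?_, fun x hx => ?_⟩
  · exact (tsupport_smul_subset_left θ n).trans hθs
  · simp only [hS1 x (hS hx), one_smul]
    exact hn x hx

end SteinAux

set_option linter.unusedSectionVars false
set_option linter.unusedSimpArgs false

namespace SteinAux

variable {E : Type*} [NormedAddCommGroup E] [NormedSpace ℂ E]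
  [FiniteDimensional ℂ E] [MeasurableSpace E] [BorelSpace E]
  (μ : Measure E) [μ.IsAddHaarMeasure] {N : ℕ} (b : Module.Basis (Fin N) ℂ E)

lemma hasDerivAt_pospow (k : ℕ) (t : ℝ) :
    HasDerivAt (fun s : ℝ => (max s 0) ^ (k + 2)) ((k + 2) * (max t 0) ^ (k + 1)) t := by
  rcases lt_trichotomy t 0 with h | h | h
  · have : (fun s : ℝ => (max s 0) ^ (k + 2)) =ᶠ[𝓝 t] fun _ => 0 := by
      filter_upwards [gt_mem_nhds h] with s hs
      simp [max_eq_right hs.le]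
    rw [max_eq_right h.le]
    simpa using (hasDerivAt_const t (0 : ℝ)).congr_of_eventuallyEq this
  · subst h
    rw [hasDerivAt_iff_isLittleO]
    simp only [max_self, ne_eq, Nat.add_eq_zero_iff, one_ne_zero, and_false, not_false_eq_true, zero_pow,
      mul_zero, smul_zero, sub_zero, OfNat.ofNat_ne_zero]
    have h1 : (fun s : ℝ => (max s 0) ^ (k + 2)) =O[𝓝 0] fun s : ℝ => s ^ (k + 2) := by
      refine Asymptotics.IsBigO.of_bound 1 (Eventually.of_forall fun s => ?_)
      rw [one_mul, norm_pow, norm_pow]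
      gcongr
      rcases le_total s 0 with h | h <;> simp [h]
    refine h1.trans_isLittleO ?_
    have := Asymptotics.isLittleO_pow_pow (𝕜 := ℝ) (m := 1) (n := k + 2) (by omega)
    simpa using this
  · have : (fun s : ℝ => (max s 0) ^ (k + 2)) =ᶠ[𝓝 t] fun s => s ^ (k + 2) := by
      filter_upwards [lt_mem_nhds h] with s hs
      simp [max_eq_left hs.le]
    rw [max_eq_left h.le]
    have h2 := (hasDerivAt_pow (k + 2) t).congr_of_eventuallyEq this
    simpa using h2

lemma cube_facts (b : ℝ) : ContDiff ℝ 2 (fun t : ℝ => (max (t + b) 0) ^ 3) ∧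
    (∀ t, HasDerivAt (fun t : ℝ => (max (t + b) 0) ^ 3) (3 * (max (t + b) 0) ^ 2) t) ∧
    (∀ t, HasDerivAt (fun t : ℝ => 3 * (max (t + b) 0) ^ 2) (6 * max (t + b) 0) t) := by
  have h1 : ∀ t, HasDerivAt (fun t : ℝ => (max (t + b) 0) ^ 3) (3 * (max (t + b) 0) ^ 2) t := by
    intro t
    have := (hasDerivAt_pospow 1 (t + b)).comp_add_const t b
    norm_num at this
    exact this
  have h2 : ∀ t, HasDerivAt (fun t : ℝ => 3 * (max (t + b) 0) ^ 2) (6 * max (t + b) 0) t := by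
    intro t
    have := ((hasDerivAt_pospow 0 (t + b)).comp_add_const t b).const_mul 3
    norm_num at this
    refine this.congr_deriv ?_
    ring
  refine ⟨?_, h1, h2⟩
  have : (2 : ℕ∞ω) = 1 + 1 := by norm_num
  rw [this, contDiff_succ_iff_deriv]
  refine ⟨fun t => (h1 t).differentiableAt, by simp, ?_⟩
  rw [funext fun t => (h1 t).deriv, contDiff_one_iff_deriv]
  refine ⟨fun t => (h2 t).differentiableAt, ?_⟩
  rw [funext fun t => (h2 t).deriv]
  fun_prop

/-- Geometry near the boundary. -/
lemma geom_near {D V : Set E} {ρ : E → ℝ} (hD : IsOpen D) (hDb : Bornology.IsBounded D) (hV : IsOpen V)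
    (hKV : frontier D ⊆ V) (hρ : ContDiffOn ℝ 2 ρ V) (hDV : D ∩ V = {z ∈ V | ρ z < 0}) {V' : Set E}
    (hV' : IsOpen V') (hKV' : frontier D ⊆ V') (hV'V : V' ⊆ V)
    (hd : ∀ x ∈ frontier D, fderiv ℝ ρ x ≠ 0) {τ : ℝ} (hτ : 0 < τ) :
    ∃ δ : ℝ, 0 < δ ∧ cthickening δ (frontier D) ⊆ V' ∧ (∀ x ∈ cthickening δ (frontier D), ρ x < τ) ∧
      (∀ x ∈ cthickening δ (frontier D), x ∉ closure D → 0 < ρ x) ∧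
      (∀ x ∈ frontier D, ρ x = 0) := by
  have : ProperSpace E := FiniteDimensional.proper ℂ E
  have hK : IsCompact (frontier D) := hDb.isCompact_closure.of_isClosed_subset isClosed_frontier frontier_subset_closure
  have c1 : ContinuousOn (fderiv ℝ ρ) V := hρ.continuousOn_fderiv_of_isOpen hV (by norm_num)
  have hρ0 : ∀ x ∈ frontier D, ρ x = 0 := by
    intro x hx
    have hxV := hKV hx
    apply le_antisymm
    · have hcl : x ∈ closure D := frontier_subset_closure hx
      have hnb : (𝓝[D] x).NeBot := mem_closure_iff_nhdsWithin_neBot.1 hcl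
      have h1 : Tendsto ρ (𝓝[D] x) (𝓝 (ρ x)) :=
        ((hρ.continuousOn.continuousAt (hV.mem_nhds hxV)).tendsto).mono_left nhdsWithin_le_nhds
      refine le_of_tendsto h1 ?_
      filter_upwards [self_mem_nhdsWithin, mem_nhdsWithin_of_mem_nhds (hV.mem_nhds hxV)] with y hy hyV
      have : y ∈ {z ∈ V | ρ z < 0} := hDV ▸ ⟨hy, hyV⟩
      exact this.2.le
    · by_contra h
      push Not at h
      have h1 : x ∈ D ∩ V := hDV ▸ ⟨hxV, h⟩
      rw [hD.frontier_eq] at hx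
      exact hx.2 h1.1
  set V2 : Set E := (V ∩ fderiv ℝ ρ ⁻¹' {0}ᶜ) ∩ (V ∩ ρ ⁻¹' Iio τ) ∩ V' with hV2
  have hV2o : IsOpen V2 := ((c1.isOpen_inter_preimage hV isOpen_compl_singleton).inter
    (hρ.continuousOn.isOpen_inter_preimage hV isOpen_Iio)).inter hV'
  have hKV2 : frontier D ⊆ V2 := fun x hx =>
    ⟨⟨⟨hKV hx, hd x hx⟩, hKV hx, by simp [hρ0 x hx, hτ]⟩, hKV' hx⟩
  obtain ⟨δ, hδ, hδV⟩ := hK.exists_cthickening_subset_open hV2o hKV2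
  refine ⟨δ, hδ, fun x hx => (hδV hx).2, fun x hx => (hδV hx).1.2.2, fun x hx hxD => ?_, hρ0⟩
  have hxV := (hδV hx).1.1.1
  by_contra h
  push Not at h
  rcases h.lt_or_eq with h | h
  · have h1 : x ∈ D ∩ V := hDV ▸ ⟨hxV, h⟩
    exact hxD (subset_closure h1.1)
  · refine (hδV hx).1.1.2 (IsLocalMin.fderiv_eq_zero ?_)
    filter_upwards [isClosed_closure.isOpen_compl.mem_nhds hxD, hV.mem_nhds hxV] with y hy hyV
    rw [h]
    by_contra h2
    push Not at h2
    have h1 : y ∈ D ∩ V := hDV ▸ ⟨hyV, h2⟩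
    exact hy (subset_closure h1.1)

/-- Pushing inwards along the field. -/
lemma push_in {K V : Set E} {ρ : E → ℝ} {n : E → E} (hK : IsCompact K) (hV : IsOpen V) (hKV : K ⊆ V)
    (hρ : ContDiffOn ℝ 2 ρ V) (hn : Continuous n) (hnK : ∀ x ∈ K, 1 < fderiv ℝ ρ x (n x)) {B : ℝ}
    (hB : ∀ x, ‖n x‖ ≤ B) :
    ∃ δ ε₁ : ℝ, 0 < δ ∧ 0 < ε₁ ∧ ∀ z ∈ thickening δ K, ∀ ε ∈ Ioo 0 ε₁,
      z - ε • n z ∈ V ∧ ρ (z - ε • n z) ≤ ρ z - ε := by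
  have c1 : ContinuousOn (fderiv ℝ ρ) V := hρ.continuousOn_fderiv_of_isOpen hV (by norm_num)
  set T : Set (E × E) := (univ ×ˢ V) ∩ (fun p : E × E => fderiv ℝ ρ p.2 (n p.1)) ⁻¹' Ioi 1 with hT
  have hTo : IsOpen T := by
    refine ContinuousOn.isOpen_inter_preimage ?_ (isOpen_univ.prod hV) isOpen_Ioi
    exact (c1.comp continuousOn_snd fun p hp => hp.2).clm_apply (hn.comp continuous_fst).continuousOn
  have hdiag : IsCompact ((fun x : E => (x, x)) '' K) := hK.image (by fun_prop)
  obtain ⟨δ, hδ, hδT⟩ := hdiag.exists_thickening_subset_open hTo (by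
    rintro _ ⟨x, hx, rfl⟩
    exact ⟨⟨mem_univ _, hKV hx⟩, hnK x hx⟩)
  have hB0 : 0 ≤ B := (norm_nonneg _).trans (hB 0)
  have key : ∀ z ∈ thickening (δ / 2) K, ∀ y, dist y z < δ / 2 → y ∈ V ∧ 1 < fderiv ℝ ρ y (n z) := by
    intro z hz y hy
    obtain ⟨x, hx, hxz⟩ := mem_thickening_iff.1 hz
    have : (z, y) ∈ thickening δ ((fun x : E => (x, x)) '' K) := by
      refine mem_thickening_iff.2 ⟨(x, x), ⟨x, hx, rfl⟩, ?_⟩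
      rw [Prod.dist_eq]
      refine max_lt (by linarith) ?_
      have := dist_triangle y z x
      show dist y x < δ
      linarith
    have := hδT this
    exact ⟨this.1.2, this.2⟩
  refine ⟨δ / 2, δ / 2 / (B + 1), by positivity, by positivity, fun z hz ε hε => ?_⟩
  have hε2 : ε * (B + 1) < δ / 2 := by
    have := hε.2
    rwa [lt_div_iff₀ (by positivity)] at this
  have hnear : ∀ t ∈ Icc 0 ε, dist (z - t • n z) z < δ / 2 := by
    intro t ht
    rw [dist_eq_norm, sub_sub_cancel_left, norm_neg, norm_smul, Real.norm_of_nonneg ht.1]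
    have h1 : t * ‖n z‖ ≤ ε * B := mul_le_mul ht.2 (hB z) (norm_nonneg _) (ht.1.trans ht.2)
    nlinarith [hε.1]
  refine ⟨(key z hz _ (hnear ε (right_mem_Icc.2 hε.1.le))).1, ?_⟩
  have hder : ∀ t ∈ Icc 0 ε, HasDerivAt (fun t : ℝ => ρ (z - t • n z)) (-fderiv ℝ ρ (z - t • n z) (n z)) t := by
    intro t ht
    have hm := (key z hz _ (hnear t ht)).1
    have h1 : HasFDerivAt ρ (fderiv ℝ ρ (z - t • n z)) (z - t • n z) :=
      ((hρ.contDiffAt (hV.mem_nhds hm)).differentiableAt (by norm_num)).hasFDerivAt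
    have h2 : HasDerivAt (fun t : ℝ => z - t • n z) (-n z) t := by
      simpa using ((hasDerivAt_id t).smul_const (n z)).const_sub z
    have := h1.comp_hasDerivAt t h2
    rw [map_neg] at this
    exact this
  obtain ⟨t, ht, hts⟩ := exists_hasDerivAt_eq_slope (fun t : ℝ => ρ (z - t • n z))
    (fun t => -fderiv ℝ ρ (z - t • n z) (n z)) hε.1 (fun t ht => (hder t ht).continuousAt.continuousWithinAt)
    (fun t ht => hder t (Ioo_subset_Icc_self ht))
  have h3 := (key z hz _ (hnear t (Ioo_subset_Icc_self ht))).2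
  simp only [sub_zero, zero_smul] at hts
  rw [eq_div_iff hε.1.ne'] at hts
  nlinarith [hε.1]

end SteinAux

set_option linter.unusedSectionVars false
set_option linter.unusedSimpArgs false

namespace SteinAux

variable {E : Type*} [NormedAddCommGroup E] [NormedSpace ℂ E]
  [FiniteDimensional ℂ E] [MeasurableSpace E] [BorelSpace E]
  (μ : Measure E) [μ.IsAddHaarMeasure] {N : ℕ} (b : Module.Basis (Fin N) ℂ E)

set_option maxHeartbeats 1000000 in
theorem geomA {D V : Set E} {ρ : E → ℝ} (hD : IsOpen D) (hDb : Bornology.IsBounded D) (hV : IsOpen V)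
    (hKV : frontier D ⊆ V) (hρ : ContDiffOn ℝ 2 ρ V) (hDV : D ∩ V = {z ∈ V | ρ z < 0})
    (hd : ∀ x ∈ frontier D, fderiv ℝ ρ x ≠ 0)
    (hlev : ∀ x ∈ frontier D, ∀ v, v ≠ 0 → fderiv ℝ ρ x v = 0 → fderiv ℝ ρ x (I • v) = 0 →
      0 < levi ρ x v) :
    ∃ (W : Set E) (r : E → ℝ) (n : E → E) (κ a ε₀ R : ℝ), IsOpen W ∧ closure D ⊆ W ∧ ContDiffOn ℝ 2 r W ∧
      ContDiff ℝ 2 n ∧ HasCompactSupport n ∧ 0 < κ ∧ 0 < a ∧ 0 < ε₀ ∧ (∀ x ∈ closure D, r x ≤ 0) ∧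
      (∀ x, -R ≤ r x) ∧ (∀ x ∈ W, ∀ v, 0 ≤ levi r x v) ∧
      (∀ x ∈ W, x ∈ tsupport n → ∀ v, κ * ‖v‖ ^ 2 ≤ levi r x v) ∧
      ∀ ε ∈ Ioo 0 ε₀, IsCompact {z ∈ W | r z ≤ a * ε} ∧ ∀ z ∈ W, r z ≤ a * ε → z - ε • n z ∈ D := by
  classical
  have : ProperSpace E := FiniteDimensional.proper ℂ E
  have hDc : IsCompact (closure D) := hDb.isCompact_closure
  have hK : IsCompact (frontier D) := hDc.of_isClosed_subset isClosed_frontier frontier_subset_closure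
  obtain ⟨C, κ, hC, hκ, V', hV', hKV', hV'V, hCκ⟩ := levi_strict hV hρ hK hKV hlev
  obtain ⟨δ, hδ, hLV', hLτ, hLpos, hρ0⟩ := geom_near hD hDb hV hKV hρ hDV hV' hKV' hV'V hd (τ := 1 / C) (by positivity)
  set K := frontier D with hKdef
  set L := cthickening δ K with hL
  have hLc : IsCompact L := hK.cthickening
  have hLV : L ⊆ V := hLV'.trans hV'V
  have hTL : thickening δ K ⊆ L := thickening_subset_cthickening δ K
  have hTV : thickening δ K ⊆ V := hTL.trans hLV
  have hKT : K ⊆ thickening δ K := self_subset_thickening hδ K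
  have hDK : ∀ x ∈ closure D, x ∉ K → x ∈ D := by
    intro x hx hxK
    by_contra h
    exact hxK (by rw [hKdef, hD.frontier_eq]; exact ⟨hx, h⟩)
  set M := closure D \ thickening δ K with hM
  have hMc : IsCompact M := hDc.diff isOpen_thickening
  have hMD : M ⊆ D := fun x hx => hDK x hx.1 fun h => hx.2 (hKT h)
  have hneg : ∀ x ∈ D, x ∈ V → ρ x < 0 := fun x hx hxV =>
    (show x ∈ {z ∈ V | ρ z < 0} from hDV ▸ ⟨hx, hxV⟩).2
  obtain ⟨b₀, hb₀, hb₀L⟩ := (hLc.inter hMc).exists_forall_le' (f := fun x => -ρ x)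
    ((hρ.continuousOn.mono (inter_subset_left.trans hLV)).neg) (a := 0)
    (fun x hx => by have := hneg x (hMD hx.2) (hLV hx.1); linarith)
  set b := min (b₀ / 2) (1 / C) with hb
  have hb0 : 0 < b := by positivity
  have hbC : b ≤ 1 / C := min_le_right _ _
  have hbb : b < b₀ := (min_le_left _ _).trans_lt (by linarith)
  obtain ⟨hh, hh1, hh2⟩ := cube_facts b
  set h : ℝ → ℝ := fun t => (max (t + b) 0) ^ 3 with hhdef
  set r : E → ℝ := fun x => if x ∈ thickening δ K then h (ρ x) - b ^ 3 else - b ^ 3 with hr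
  have rT : ∀ x ∈ thickening δ K, r x = h (ρ x) - b ^ 3 := fun x hx => by simp [hr, hx]
  have r1 : ∀ x ∈ thickening δ K, r =ᶠ[𝓝 x] fun y => h (ρ y) - b ^ 3 := by
    intro x hx
    filter_upwards [isOpen_thickening.mem_nhds hx] with y hy using rT y hy
  have r2 : ∀ x ∈ M, r =ᶠ[𝓝 x] fun _ => - b ^ 3 := by
    intro x hx
    by_cases hxL : x ∈ L
    · have h1 : ρ x < -b := by have := hb₀L x ⟨hxL, hx⟩; linarith
      have h2 := (hρ.continuousOn.continuousAt (hV.mem_nhds (hLV hxL))).eventually_lt_const h1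
      filter_upwards [h2] with y hy
      simp only [hr]
      split_ifs
      · simp only [hhdef]
        rw [max_eq_right (by linarith)]; simp
      · rfl
    · filter_upwards [isClosed_cthickening.isOpen_compl.mem_nhds hxL] with y hy
      simp only [hr]
      rw [if_neg fun h => hy (hTL h)]
  set W := D ∪ thickening δ K with hW
  have hWo : IsOpen W := hD.union isOpen_thickening
  have hWc : ∀ x ∈ W, x ∈ thickening δ K ∨ x ∈ M := by
    intro x hx
    by_cases hxT : x ∈ thickening δ K
    · exact Or.inl hxT
    · exact Or.inr ⟨subset_closure (hx.resolve_right hxT), hxT⟩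
  have hρat : ∀ x ∈ thickening δ K, ContDiffAt ℝ 2 ρ x := fun x hx => hρ.contDiffAt (hV.mem_nhds (hTV hx))
  have hrC : ContDiffOn ℝ 2 r W := by
    intro x hx
    refine ContDiffAt.contDiffWithinAt ?_
    rcases hWc x hx with hx | hx
    · exact ((hh.contDiffAt.comp x (hρat x hx)).sub contDiffAt_const).congr_of_eventuallyEq (r1 x hx)
    · exact contDiffAt_const.congr_of_eventuallyEq (r2 x hx)
  have hl : ∀ x ∈ thickening δ K, ∀ v, 3 * (max (ρ x + b) 0) ^ 2 * (κ * ‖v‖ ^ 2) ≤ levi r x v := by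
    intro x hx v
    rw [(dzR_levi_congr (r1 x hx)).2 v]
    have e := levi_comp (hρat x hx) (h := fun t => h t - b ^ 3) (Eventually.of_forall fun t => (hh1 t).sub_const (b ^ 3)) (hh2 (ρ x)) v
    rw [e]
    have h1 := hCκ x (hLV' (hTL hx)) v
    set s := max (ρ x + b) 0 with hs
    have hs0 : 0 ≤ s := le_max_right _ _
    have hs1 : s * C ≤ 2 := by
      have h2 : s ≤ 2 / C := by
        refine max_le ?_ (by positivity)
        have := hLτ x (hTL hx)
        have e : 2 / C = 1 / C + 1 / C := by ring
        linarith
      rwa [le_div_iff₀ hC] at h2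
    set Q := (fderiv ℝ ρ x v) ^ 2 + (fderiv ℝ ρ x (I • v)) ^ 2 with hQ
    have hQ0 : 0 ≤ Q := by positivity
    have h3 : 3 * s ^ 2 * (κ * ‖v‖ ^ 2) ≤ 3 * s ^ 2 * (levi ρ x v + C * Q) := by gcongr
    have h4 : (s * C) * (3 * s * Q) ≤ 2 * (3 * s * Q) := by gcongr
    nlinarith
  set O := thickening δ K ∩ (V ∩ ρ ⁻¹' Ioi (-b / 2)) with hO
  have hOo : IsOpen O := isOpen_thickening.inter (hρ.continuousOn.isOpen_inter_preimage hV isOpen_Ioi)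
  have hKO : K ⊆ O := fun x hx => ⟨hKT hx, hKV hx, by
    show -b / 2 < ρ x
    rw [hρ0 x hx]; linarith⟩
  obtain ⟨n, hn, hnc, hnO, hnK⟩ := exists_field hV hρ hK hKV hOo hKO hd
  obtain ⟨B, hB⟩ := hnc.exists_bound_of_continuous hn.continuous
  have hB0 : 0 ≤ B := (norm_nonneg _).trans (hB 0)
  obtain ⟨δ', ε₁, hδ', hε₁, hpush⟩ := push_in hK hV hKV hρ hn.continuous hnK hB
  set δ₂ := min δ' (δ / 2) with hδ₂
  have hδ₂0 : 0 < δ₂ := by positivity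
  have hδ₂δ : δ₂ < δ := (min_le_right _ _).trans_lt (by linarith)
  set S := thickening δ₂ K with hS
  have hKS : K ⊆ S := self_subset_thickening hδ₂0 K
  obtain ⟨β, hβ, hβN⟩ := (hLc.diff (hD.union (isOpen_thickening : IsOpen S))).exists_forall_le' (f := ρ)
    (hρ.continuousOn.mono (diff_subset.trans hLV)) (a := 0)
    (fun x hx => hLpos x hx.1 fun hcl => hx.2 (by
      by_cases hxK : x ∈ K
      · exact Or.inr (hKS hxK)
      · exact Or.inl (hDK x hcl hxK)))
  obtain ⟨η, hη, hηD⟩ := (hDc.diff (isOpen_thickening : IsOpen S)).exists_thickening_subset_open hD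
    (fun x hx => hDK x hx.1 fun h => hx.2 (hKS h))
  have hra : ∀ ε, 0 < ε → ∀ x ∈ thickening δ K, r x ≤ 3 * b ^ 2 / 2 * ε → ρ x ≤ ε / 2 := by
    intro ε hε x hx hrx
    by_contra hlt
    push Not at hlt
    rw [rT x hx] at hrx
    simp only [hhdef] at hrx
    rw [max_eq_left (by linarith)] at hrx
    have hρx : 0 < ρ x := by linarith
    have h1 : 3 * b ^ 2 * (ε / 2) < 3 * b ^ 2 * ρ x := by gcongr
    have h2 : 0 ≤ 3 * ρ x ^ 2 * b + ρ x ^ 3 := by positivity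
    nlinarith
  have hloc : ∀ ε ∈ Ioo 0 (2 * β), ∀ z ∈ W, r z ≤ 3 * b ^ 2 / 2 * ε → z ∈ S ∨ (z ∈ D ∧ z ∉ S) := by
    intro ε hε z hz hrz
    by_cases hzS : z ∈ S
    · exact Or.inl hzS
    · refine Or.inr ⟨?_, hzS⟩
      by_contra hzD
      have hzT : z ∈ thickening δ K := hz.resolve_left hzD
      have h1 := hra ε hε.1 z hzT hrz
      have h2 := hβN z ⟨hTL hzT, fun h => h.elim hzD hzS⟩
      linarith [hε.2]
  refine ⟨W, r, n, 3 * (b / 2) ^ 2 * κ, 3 * b ^ 2 / 2, min ε₁ (min (2 * β) (η / (B + 1))), b ^ 3, hWo, ?_, hrC, hn, hnc,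
    by positivity, by positivity, by positivity, ?_, ?_, ?_, ?_, ?_⟩
  · intro x hx
    by_cases hxK : x ∈ K
    · exact Or.inr (hKT hxK)
    · exact Or.inl (hDK x hx hxK)
  · intro x hx
    by_cases hxT : x ∈ thickening δ K
    · rw [rT x hxT]
      have h1 : ρ x ≤ 0 := by
        by_cases hxK : x ∈ K
        · exact (hρ0 x hxK).le
        · exact (hneg x (hDK x hx hxK) (hTV hxT)).le
      have h2 : h (ρ x) ≤ b ^ 3 := by
        simp only [hhdef]
        gcongr
        exact max_le (by linarith) hb0.le
      linarith
    · simp only [hr, if_neg hxT]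
      have : 0 < b ^ 3 := by positivity
      linarith
  · intro x
    simp only [hr]
    split_ifs
    · have : 0 ≤ h (ρ x) := pow_nonneg (le_max_right _ _) 3
      linarith
    · exact le_rfl
  · intro x hx v
    rcases hWc x hx with hx | hx
    · exact le_trans (by positivity) (hl x hx v)
    · rw [(dzR_levi_congr (r2 x hx)).2 v]; simp [levi]
  · intro x hx hxn v
    obtain ⟨h1, h2, h3⟩ := hnO hxn
    have h3 : -b / 2 < ρ x := h3
    refine le_trans ?_ (hl x h1 v)
    rw [mul_assoc]
    gcongr
    exact le_trans (by linarith) (le_max_left _ _)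
  · intro ε hε
    have e1 : ε < ε₁ := hε.2.trans_le (min_le_left _ _)
    have e2 : ε < 2 * β := hε.2.trans_le ((min_le_right _ _).trans (min_le_left _ _))
    have e3 : ε < η / (B + 1) := hε.2.trans_le ((min_le_right _ _).trans (min_le_right _ _))
    rw [lt_div_iff₀ (by positivity)] at e3
    have hl2 := hloc ε ⟨hε.1, e2⟩
    constructor
    · have hQ : IsCompact (closure D ∪ cthickening δ₂ K) := hDc.union hK.cthickening
      have hQW : closure D ∪ cthickening δ₂ K ⊆ W := by
        rintro x (hx | hx)
        · by_cases hxK : x ∈ K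
          · exact Or.inr (hKT hxK)
          · exact Or.inl (hDK x hx hxK)
        · exact Or.inr (cthickening_subset_thickening' hδ hδ₂δ K hx)
      have e : {z ∈ W | r z ≤ 3 * b ^ 2 / 2 * ε} =
          (closure D ∪ cthickening δ₂ K) ∩ r ⁻¹' Iic (3 * b ^ 2 / 2 * ε) := by
        ext z
        constructor
        · rintro ⟨hz, hrz⟩
          refine ⟨?_, hrz⟩
          rcases hl2 z hz hrz with h1 | h1
          · exact Or.inr (thickening_subset_cthickening _ _ h1)
          · exact Or.inl (subset_closure h1.1)
        · rintro ⟨hz, hrz⟩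
          exact ⟨hQW hz, hrz⟩
      rw [e]
      exact hQ.of_isClosed_subset
        ((hrC.continuousOn.mono hQW).preimage_isClosed_of_isClosed hQ.isClosed isClosed_Iic) inter_subset_left
    · intro z hz hrz
      rcases hl2 z hz hrz with h1 | ⟨h1, h2⟩
      · obtain ⟨h3, h4⟩ := hpush z (thickening_mono (min_le_left _ _) K h1) ε ⟨hε.1, e1⟩
        have h5 := hra ε hε.1 z (thickening_mono hδ₂δ.le K h1) hrz
        have h6 : z - ε • n z ∈ D ∩ V := by
          rw [hDV]; exact ⟨h3, by linarith [hε.1]⟩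
        exact h6.1
      · refine hηD (mem_thickening_iff.2 ⟨z, ⟨subset_closure h1, h2⟩, ?_⟩)
        rw [dist_eq_norm, sub_sub_cancel_left, norm_neg, norm_smul, Real.norm_of_nonneg hε.1.le]
        have : ε * ‖n z‖ ≤ ε * B := mul_le_mul_of_nonneg_left (hB z) hε.1.le
        nlinarith [hε.1]

end SteinAux

set_option linter.unusedSectionVars false
set_option linter.unusedSimpArgs false

namespace SteinAux

variable {E : Type*} [NormedAddCommGroup E] [NormedSpace ℂ E]
  [FiniteDimensional ℂ E] [MeasurableSpace E] [BorelSpace E]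
  (μ : Measure E) [μ.IsAddHaarMeasure] {N : ℕ} (b : Module.Basis (Fin N) ℂ E)

lemma holo_smooth {D : Set E} (hD : IsOpen D) {f : E → ℂ} (hf : DifferentiableOn ℂ f D) {x₀ : E} (hx₀ : x₀ ∈ D) :
    ContDiffAt ℝ ∞ f x₀ := by
  have : ProperSpace E := FiniteDimensional.proper ℂ E
  let μ : Measure E := Measure.addHaar
  let b := Module.finBasis ℂ E
  obtain ⟨R, hR, hRD⟩ := Metric.isOpen_iff.1 hD x₀ hx₀
  set r := R / 3 with hr
  have hr0 : 0 < r := by positivity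
  obtain ⟨θ, hθ, hθc, hθs, ⟨S, hSo, hS, -, hS1⟩, hθ01⟩ := exists_cutoff
    (isCompact_closedBall x₀ (2 * r)) (isOpen_ball (x := x₀) (ε := R)) (closedBall_subset_ball (by linarith))
  set w : E → ℂ := fun x => (θ x : ℂ) * f x with hw
  have hwf : ∀ x ∈ S, w x = f x := fun x hx => by simp [hw, hS1 x hx]
  have hwc : Continuous w := by
    rw [continuous_iff_continuousAt]
    intro x
    by_cases hx : x ∈ tsupport θ
    · exact (Complex.continuous_ofReal.comp hθ.continuous).continuousAt.mul
        (hf.continuousOn.continuousAt (hD.mem_nhds (hRD (hθs hx))))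
    · have : w =ᶠ[𝓝 x] fun _ => 0 := by
        filter_upwards [notMem_tsupport_iff_eventuallyEq.1 hx] with y hy
        simp [hw, hy]
      exact continuousAt_const.congr this.symm
  have hBs : ball x₀ (2 * r) ⊆ S := ball_subset_closedBall.trans hS
  obtain ⟨n, hn⟩ : ∃ n : ℕ, (∑ j, ‖b j‖) / ((n : ℝ) + 1) < r := by
    have h1 : Tendsto (fun n : ℕ => (∑ j, ‖b j‖) * (1 / ((n : ℝ) + 1))) atTop (𝓝 ((∑ j, ‖b j‖) * 0)) :=
      tendsto_one_div_add_atTop_nhds_zero_nat.const_mul _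
    rw [mul_zero] at h1
    obtain ⟨n, hn⟩ := (h1.eventually_lt_const hr0).exists
    exact ⟨n, by simpa [div_eq_mul_inv] using hn⟩
  have key : ∀ x ∈ ball x₀ r, mconv μ b n w x = f x := by
    intro x hx
    have hx2 : x ∈ ball x₀ (2 * r) := ball_subset_ball (by linarith) hx
    rw [mean_value μ b n hwc x, hwf x (hBs hx2)]
    intro y hy ζ hζ
    have hm : x - ζ • y ∈ ball x₀ (2 * r) := by
      have h1 : ‖ζ • y‖ < r := by
        rw [norm_smul]
        have h2 : ‖ζ‖ ≤ 1 := by simpa using hζ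
        have := mul_le_mul h2 hy (norm_nonneg _) zero_le_one
        linarith
      have h3 : dist x x₀ < r := hx
      rw [mem_ball, dist_eq_norm] at *
      have : x - ζ • y - x₀ = (x - x₀) - ζ • y := by abel
      rw [this]
      have := norm_sub_le (x - x₀) (ζ • y)
      linarith
    have e : (fun ζ : ℂ => w (x - ζ • y)) =ᶠ[𝓝 ζ] fun ζ => f (x - ζ • y) := by
      have hc : ContinuousAt (fun ζ : ℂ => x - ζ • y) ζ := by fun_prop
      filter_upwards [hc.preimage_mem_nhds (isOpen_ball.mem_nhds hm)] with s hs
      exact hwf _ (hBs hs)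
    refine DifferentiableAt.congr_of_eventuallyEq ?_ e
    have h5 : DifferentiableAt ℂ f (x - ζ • y) :=
      hf.differentiableAt (hD.mem_nhds (hRD (ball_subset_ball (by linarith) hm)))
    exact h5.comp ζ (f := fun ζ : ℂ => x - ζ • y) (by fun_prop)
  have hsm : ContDiffAt ℝ ∞ (mconv μ b n w) x₀ := (contDiff_mconv μ b n hwc.locallyIntegrable).contDiffAt
  refine hsm.congr_of_eventuallyEq ?_
  filter_upwards [ball_mem_nhds x₀ hr0] with x hx using (key x hx).symm

variable {F : Type*} [NormedAddCommGroup F] [NormedSpace ℂ F] [FiniteDimensional ℂ F]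

lemma holo_smoothF {D : Set E} (hD : IsOpen D) {g : E → F} (hg : DifferentiableOn ℂ g D) {x₀ : E} (hx₀ : x₀ ∈ D) :
    ContDiffAt ℝ ∞ g x₀ := by
  let c := Module.finBasis ℂ F
  have e : g = fun x => ∑ j, (c.repr (g x) j) • c j := by
    ext x; exact (c.sum_repr (g x)).symm
  rw [e]
  refine ContDiffAt.sum fun j _ => ?_
  refine ContDiffAt.smul ?_ contDiffAt_const
  refine holo_smooth hD ?_ hx₀
  have : (fun x => c.repr (g x) j) = (LinearMap.toContinuousLinearMap (c.coord j)) ∘ g := by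
    ext x; simp
  rw [this]
  exact (ContinuousLinearMap.differentiable _).comp_differentiableOn hg

lemma diffAt_clm_apply {f : E → E →L[ℂ] F} {x : E} (h : ∀ y, DifferentiableAt ℂ (fun z => f z y) x) :
    DifferentiableAt ℂ f x := by
  let d := Module.finrank ℂ E
  have hd : d = Module.finrank ℂ (Fin d → ℂ) := (Module.finrank_fin_fun ℂ).symm
  let e₁ := ContinuousLinearEquiv.ofFinrankEq hd
  let e₂ := (e₁.arrowCongr (1 : F ≃L[ℂ] F)).trans (ContinuousLinearEquiv.piRing (Fin d))
  rw [← Function.id_comp f, ← e₂.symm_comp_self]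
  exact e₂.symm.differentiableAt.comp x (differentiableAt_pi.mpr fun i => h _)

lemma holo_snd {D : Set E} (hD : IsOpen D) {g : E → F} (hg : DifferentiableOn ℂ g D) {x : E} (hx : x ∈ D) :
    (∀ v, fderiv ℝ g x v = fderiv ℂ g x v) ∧
    ∀ v w, fderiv ℝ (fderiv ℝ g) x v w = fderiv ℂ (fderiv ℂ g) x v w := by
  have hR : ∀ y ∈ D, fderiv ℝ g y = (fderiv ℂ g y).restrictScalars ℝ := fun y hy =>
    ((hg.differentiableAt (hD.mem_nhds hy)).fderiv_restrictScalars ℝ)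
  refine ⟨fun v => by rw [hR x hx]; rfl, ?_⟩
  have hC := holo_smoothF hD hg hx
  have hC2 : ContDiffAt ℝ 2 g x := hC.of_le two_le_inf
  have hd1 : DifferentiableAt ℝ (fderiv ℝ g) x :=
    (hC2.fderiv_right (m := 1) (by norm_num)).differentiableAt (by norm_num)
  have e1 : ∀ w v, fderiv ℝ (fun y => fderiv ℝ g y w) x v = fderiv ℝ (fderiv ℝ g) x v w := by
    intro w v
    have : HasFDerivAt (fun y => fderiv ℝ g y w)
        ((ContinuousLinearMap.apply ℝ F w).comp (fderiv ℝ (fderiv ℝ g) x)) x :=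
      (ContinuousLinearMap.apply ℝ F w).hasFDerivAt.comp x hd1.hasFDerivAt
    rw [this.fderiv]; rfl
  have hIlin : ∀ v w, fderiv ℝ (fderiv ℝ g) x v (I • w) = I • fderiv ℝ (fderiv ℝ g) x v w := by
    intro v w
    rw [← e1, ← e1]
    have h1 : (fun y => fderiv ℝ g y (I • w)) =ᶠ[𝓝 x] fun y => I • fderiv ℝ g y w := by
      filter_upwards [hD.mem_nhds hx] with y hy
      rw [hR y hy]; simp
    rw [h1.fderiv_eq]
    have h2 : DifferentiableAt ℝ (fun y => fderiv ℝ g y w) x := hd1.clm_apply (differentiableAt_const w)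
    rw [fderiv_fun_const_smul h2]; rfl
  have hdc : ∀ w, DifferentiableAt ℂ (fun y => fderiv ℂ g y w) x := by
    intro w
    have h1 : (fun y => fderiv ℂ g y w) =ᶠ[𝓝 x] fun y => fderiv ℝ g y w := by
      filter_upwards [hD.mem_nhds hx] with y hy
      rw [hR y hy]; rfl
    refine DifferentiableAt.congr_of_eventuallyEq ?_ h1
    have h2 : DifferentiableAt ℝ (fun y => fderiv ℝ g y w) x := hd1.clm_apply (differentiableAt_const w)
    rw [differentiableAt_iff_restrictScalars ℝ h2]
    have hI : ∀ v, fderiv ℝ (fun y => fderiv ℝ g y w) x (I • v) = I • fderiv ℝ (fun y => fderiv ℝ g y w) x v := by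
      intro v
      rw [e1, e1, snd_symm hC2, hIlin, snd_symm hC2]
    set A := fderiv ℝ (fun y => fderiv ℝ g y w) x
    refine ⟨{ toFun := A, map_add' := A.map_add, map_smul' := ?_, cont := A.cont }, by ext v; rfl⟩
    intro c v
    have hc : c • v = c.re • v + c.im • (I • v) := by
      conv_lhs => rw [← Complex.re_add_im c]
      rw [add_smul, mul_smul]
      simp
    rw [hc, map_add, map_smul, map_smul, hI, RingHom.id_apply]
    conv_rhs => rw [← Complex.re_add_im c]
    rw [add_smul, mul_smul]
    simp
  have hd2 : DifferentiableAt ℂ (fderiv ℂ g) x := diffAt_clm_apply hdc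
  intro v w
  rw [← e1]
  have h1 : (fun y => fderiv ℂ g y w) =ᶠ[𝓝 x] fun y => fderiv ℝ g y w := by
    filter_upwards [hD.mem_nhds hx] with y hy
    rw [hR y hy]; rfl
  rw [← h1.fderiv_eq, (hdc w).fderiv_restrictScalars ℝ]
  have : HasFDerivAt (fun y => fderiv ℂ g y w)
      ((ContinuousLinearMap.apply ℂ F w).comp (fderiv ℂ (fderiv ℂ g) x)) x :=
    (ContinuousLinearMap.apply ℂ F w).hasFDerivAt.comp x hd2.hasFDerivAt
  rw [this.fderiv]; rfl

lemma snd_comp {X Y Z : Type*} [NormedAddCommGroup X] [NormedSpace ℝ X] [NormedAddCommGroup Y] [NormedSpace ℝ Y]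
    [NormedAddCommGroup Z] [NormedSpace ℝ Z] {f : Y → Z} {q : X → Y} {x : X} (hf : ContDiffAt ℝ 2 f (q x))
    (hq : ContDiffAt ℝ 2 q x) (v w : X) :
    fderiv ℝ (fderiv ℝ (fun y => f (q y))) x v w =
      fderiv ℝ (fderiv ℝ f) (q x) (fderiv ℝ q x v) (fderiv ℝ q x w) + fderiv ℝ f (q x) (fderiv ℝ (fderiv ℝ q) x v w) := by
  have hfe : ∀ᶠ y in 𝓝 (q x), DifferentiableAt ℝ f y :=
    (hf.eventually (by simp)).mono fun y hy => hy.differentiableAt (by norm_num)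
  have hqe : ∀ᶠ y in 𝓝 x, DifferentiableAt ℝ q y :=
    (hq.eventually (by simp)).mono fun y hy => hy.differentiableAt (by norm_num)
  have e : fderiv ℝ (fun y => f (q y)) =ᶠ[𝓝 x] fun y => (fderiv ℝ f (q y)).comp (fderiv ℝ q y) := by
    filter_upwards [hqe, hq.continuousAt.eventually hfe] with y h1 h2
    exact fderiv_comp' y h2 h1
  have hf1 : DifferentiableAt ℝ (fderiv ℝ f) (q x) :=
    (hf.fderiv_right (m := 1) (by norm_num)).differentiableAt (by norm_num)
  have hq1 : DifferentiableAt ℝ (fderiv ℝ q) x :=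
    (hq.fderiv_right (m := 1) (by norm_num)).differentiableAt (by norm_num)
  have hc : HasFDerivAt (fun y => fderiv ℝ f (q y)) ((fderiv ℝ (fderiv ℝ f) (q x)).comp (fderiv ℝ q x)) x :=
    hf1.hasFDerivAt.comp x (hq.differentiableAt (by norm_num)).hasFDerivAt
  rw [e.fderiv_eq, (hc.clm_comp hq1.hasFDerivAt).fderiv]
  simp [add_comm]

end SteinAux

set_option linter.unusedSectionVars false
set_option linter.unusedSimpArgs false

namespace SteinAux

section LV

variable {X Z E F : Type*} [NormedAddCommGroup X] [NormedSpace ℂ X] [NormedAddCommGroup Z] [NormedSpace ℝ Z]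
  [NormedAddCommGroup E] [NormedSpace ℂ E] [NormedAddCommGroup F] [InnerProductSpace ℂ F]

/-- Vector valued Levi form. -/
def lv (f : X → Z) (x v : X) : Z :=
  fderiv ℝ (fderiv ℝ f) x v v + fderiv ℝ (fderiv ℝ f) x (I • v) (I • v)

lemma levi_eq_lv (f : X → ℝ) (x v : X) : levi f x v = lv f x v := rfl

lemma snd_add {f g : X → Z} {x : X} (hf : ContDiffAt ℝ 2 f x) (hg : ContDiffAt ℝ 2 g x) (v w : X) :
    fderiv ℝ (fderiv ℝ (fun y => f y + g y)) x v w = fderiv ℝ (fderiv ℝ f) x v w + fderiv ℝ (fderiv ℝ g) x v w := by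
  have hfe : ∀ᶠ y in 𝓝 x, DifferentiableAt ℝ f y :=
    (hf.eventually (by simp)).mono fun y hy => hy.differentiableAt (by norm_num)
  have hge : ∀ᶠ y in 𝓝 x, DifferentiableAt ℝ g y :=
    (hg.eventually (by simp)).mono fun y hy => hy.differentiableAt (by norm_num)
  have e : fderiv ℝ (fun y => f y + g y) =ᶠ[𝓝 x] fun y => fderiv ℝ f y + fderiv ℝ g y := by
    filter_upwards [hfe, hge] with y h1 h2
    exact fderiv_fun_add h1 h2
  have hf1 : DifferentiableAt ℝ (fderiv ℝ f) x :=
    (hf.fderiv_right (m := 1) (by norm_num)).differentiableAt (by norm_num)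
  have hg1 : DifferentiableAt ℝ (fderiv ℝ g) x :=
    (hg.fderiv_right (m := 1) (by norm_num)).differentiableAt (by norm_num)
  rw [e.fderiv_eq, fderiv_fun_add hf1 hg1]; rfl

lemma snd_smul {f : X → Z} {x : X} (hf : ContDiffAt ℝ 2 f x) (c : ℝ) (v w : X) :
    fderiv ℝ (fderiv ℝ (fun y => c • f y)) x v w = c • fderiv ℝ (fderiv ℝ f) x v w := by
  have hfe : ∀ᶠ y in 𝓝 x, DifferentiableAt ℝ f y :=
    (hf.eventually (by simp)).mono fun y hy => hy.differentiableAt (by norm_num)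
  have e : fderiv ℝ (fun y => c • f y) =ᶠ[𝓝 x] fun y => c • fderiv ℝ f y := by
    filter_upwards [hfe] with y h1
    exact fderiv_fun_const_smul h1 c
  have hf1 : DifferentiableAt ℝ (fderiv ℝ f) x :=
    (hf.fderiv_right (m := 1) (by norm_num)).differentiableAt (by norm_num)
  rw [e.fderiv_eq, fderiv_fun_const_smul hf1 c]; rfl

lemma lv_add {f g : X → Z} {x : X} (hf : ContDiffAt ℝ 2 f x) (hg : ContDiffAt ℝ 2 g x) (v : X) :
    lv (fun y => f y + g y) x v = lv f x v + lv g x v := by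
  simp only [lv, snd_add hf hg]; abel

lemma lv_smul {f : X → Z} {x : X} (hf : ContDiffAt ℝ 2 f x) (c : ℝ) (v : X) :
    lv (fun y => c • f y) x v = c • lv f x v := by
  simp only [lv, snd_smul hf, smul_add]

lemma snd_clm {Y : Type*} [NormedAddCommGroup Y] [NormedSpace ℝ Y] (p : Y →L[ℝ] Z) (x v w : Y) :
    fderiv ℝ (fderiv ℝ (fun y => p y)) x v w = 0 := by
  have : fderiv ℝ (fun y => p y) = fun _ => p := by ext1 y; exact p.fderiv
  rw [this]; simp

lemma lv_comp_clm {f : E → Z} (p : X →L[ℂ] E) {x : X} (hf : ContDiffAt ℝ 2 f (p x)) (v : X) :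
    lv (fun y => f (p y)) x v = lv f (p x) (p v) := by
  have hp : ContDiffAt ℝ 2 (fun y => p y) x := (p.restrictScalars ℝ).contDiff.contDiffAt
  have h1 : fderiv ℝ (fun y => p y) x = p.restrictScalars ℝ := (p.restrictScalars ℝ).fderiv
  have h2 : ∀ v w, fderiv ℝ (fderiv ℝ (fun y => p y)) x v w = 0 := fun v w => snd_clm (p.restrictScalars ℝ) x v w
  simp only [lv, snd_comp (q := fun y => p y) hf hp, h1, h2, map_zero, add_zero]
  simp

lemma lv_clm (p : X →L[ℂ] E) (x v : X) : lv (fun y => p y) x v = 0 := by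
  have h2 : ∀ v w, fderiv ℝ (fderiv ℝ (fun y => p y)) x v w = 0 := fun v w => snd_clm (p.restrictScalars ℝ) x v w
  simp [lv, h2]

lemma fderiv_normsq (y h : F) : fderiv ℝ (fun u : F => ‖u‖ ^ 2) y h = 2 * (inner ℂ y h).re := by
  have h0 : HasFDerivAt (fun u : F => inner ℂ u u) _ y :=
    (hasFDerivAt_id (𝕜 := ℝ) y).inner ℂ (hasFDerivAt_id (𝕜 := ℝ) y)
  have h1 := Complex.reCLM.hasFDerivAt.comp y h0
  have e : (fun u : F => ‖u‖ ^ 2) = (Complex.reCLM ∘ fun u : F => inner ℂ u u) := by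
    ext u
    simp only [Function.comp, Complex.reCLM_apply]
    exact (inner_self_eq_norm_sq (𝕜 := ℂ) u).symm
  rw [e, h1.fderiv]
  have : (inner ℂ h y : ℂ).re = (inner ℂ y h : ℂ).re := inner_re_symm (𝕜 := ℂ) h y
  simp [fderivInnerCLM_apply, this]
  ring

lemma contDiff_normsq : ContDiff ℝ 2 (fun u : F => ‖u‖ ^ 2) := (contDiff_id.norm_sq ℂ)

lemma snd_normsq (y v w : F) : fderiv ℝ (fderiv ℝ (fun u : F => ‖u‖ ^ 2)) y v w = 2 * (inner ℂ v w).re := by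
  have hd1 : DifferentiableAt ℝ (fderiv ℝ (fun u : F => ‖u‖ ^ 2)) y :=
    (contDiff_normsq.contDiffAt.fderiv_right (m := 1) (by norm_num)).differentiableAt (by norm_num)
  have : HasFDerivAt (fun z => fderiv ℝ (fun u : F => ‖u‖ ^ 2) z w)
      ((ContinuousLinearMap.apply ℝ ℝ w).comp (fderiv ℝ (fderiv ℝ (fun u : F => ‖u‖ ^ 2)) y)) y :=
    (ContinuousLinearMap.apply ℝ ℝ w).hasFDerivAt.comp y hd1.hasFDerivAt
  have e : fderiv ℝ (fun z => fderiv ℝ (fun u : F => ‖u‖ ^ 2) z w) y v =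
      fderiv ℝ (fderiv ℝ (fun u : F => ‖u‖ ^ 2)) y v w := by rw [this.fderiv]; rfl
  rw [← e]
  simp only [fderiv_normsq]
  have h0 : HasFDerivAt (fun u : F => inner ℂ u w) _ y :=
    (hasFDerivAt_id (𝕜 := ℝ) y).inner ℂ (hasFDerivAt_const (𝕜 := ℝ) w y)
  have h1 := (Complex.reCLM.hasFDerivAt.comp y h0).const_mul 2
  have e2 : (fun u : F => 2 * (inner ℂ u w).re) = fun u => 2 * (Complex.reCLM ∘ fun u : F => inner ℂ u w) u := by
    ext u; simp
  rw [e2, h1.fderiv]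
  simp [fderivInnerCLM_apply]

lemma lv_normsq {u : X → F} {x : X} (hu : ContDiffAt ℝ 2 u x) (v : X) :
    lv (fun y => ‖u y‖ ^ 2) x v =
      2 * (‖fderiv ℝ u x v‖ ^ 2 + ‖fderiv ℝ u x (I • v)‖ ^ 2) + 2 * (inner ℂ (u x) (lv u x v)).re := by
  have hs : ∀ z : F, (inner ℂ z z : ℂ).re = ‖z‖ ^ 2 := fun z => inner_self_eq_norm_sq (𝕜 := ℂ) z
  simp only [lv, snd_comp (f := fun u : F => ‖u‖ ^ 2) contDiff_normsq.contDiffAt hu, snd_normsq, fderiv_normsq, hs,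
    inner_add_right, Complex.add_re]
  ring

lemma lv_normsq_ge {u : X → F} {x : X} (hu : ContDiffAt ℝ 2 u x) (v : X) :
    -(2 * (‖u x‖ * ‖lv u x v‖)) ≤ lv (fun y => ‖u y‖ ^ 2) x v := by
  rw [lv_normsq hu]
  have h1 : |(inner ℂ (u x) (lv u x v)).re| ≤ ‖u x‖ * ‖lv u x v‖ :=
    (Complex.abs_re_le_norm _).trans (norm_inner_le_norm _ _)
  have h2 := neg_abs_le (inner ℂ (u x) (lv u x v)).re
  have : 0 ≤ 2 * (‖fderiv ℝ u x v‖ ^ 2 + ‖fderiv ℝ u x (I • v)‖ ^ 2) := by positivity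
  linarith

lemma lv_normsq_clm (p : X →L[ℂ] F) (x v : X) : lv (fun y => ‖p y‖ ^ 2) x v = 4 * ‖p v‖ ^ 2 := by
  have hp : ContDiffAt ℝ 2 (fun y => p y) x := (p.restrictScalars ℝ).contDiff.contDiffAt
  have h1 : fderiv ℝ (fun y => p y) x = p.restrictScalars ℝ := (p.restrictScalars ℝ).fderiv
  rw [lv_normsq hp, lv_clm, h1]
  simp [norm_smul]
  ring

end LV

end SteinAux

set_option linter.unusedSectionVars false
set_option linter.unusedSimpArgs false

namespace SteinAux

variable {E : Type*} [NormedAddCommGroup E] [NormedSpace ℂ E]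
  [FiniteDimensional ℂ E] [MeasurableSpace E] [BorelSpace E]
  (μ : Measure E) [μ.IsAddHaarMeasure] {N : ℕ} (b : Module.Basis (Fin N) ℂ E)

variable {F : Type*} [NormedAddCommGroup F] [NormedSpace ℂ F] [FiniteDimensional ℂ F]

lemma lv_shift {D : Set E} (hD : IsOpen D) {g : E → F} (hg : DifferentiableOn ℂ g D) {n : E → E}
    (hn : ContDiff ℝ 2 n) {M1 M2 N1 N2 : ℝ} (hM1 : ∀ x ∈ D, ∀ v, ‖fderiv ℝ g x v‖ ≤ M1 * ‖v‖)
    (hM2 : ∀ x ∈ D, ∀ v w, ‖fderiv ℝ (fderiv ℝ g) x v w‖ ≤ M2 * ‖v‖ * ‖w‖)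
    (hN1 : ∀ x v, ‖fderiv ℝ n x v‖ ≤ N1 * ‖v‖) (hN2 : ∀ x v w, ‖fderiv ℝ (fderiv ℝ n) x v w‖ ≤ N2 * ‖v‖ * ‖w‖)
    (m1 : 0 ≤ M1) (m2 : 0 ≤ M2) (n1 : 0 ≤ N1) (n2 : 0 ≤ N2)
    {ε : ℝ} (hε : 0 ≤ ε) (hε1 : ε ≤ 1) {z : E} (hz : z - ε • n z ∈ D) (s : E) :
    ‖lv (fun y => g (y - ε • n y)) z s‖ ≤ ε * (M2 * (4 * N1 + 2 * N1 ^ 2) + 2 * M1 * N2) * ‖s‖ ^ 2 ∧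
    (z ∉ tsupport n → lv (fun y => g (y - ε • n y)) z s = 0) := by
  obtain ⟨hg1, hg2⟩ := holo_snd hD hg hz
  have hgC : ContDiffAt ℝ 2 g (z - ε • n z) := (holo_smoothF hD hg hz).of_le two_le_inf
  have hid : ContDiffAt ℝ 2 (fun y : E => y) z := contDiffAt_id
  have hnn : ContDiffAt ℝ 2 (fun y : E => (-ε) • n y) z := contDiffAt_const.smul hn.contDiffAt
  have hΦe : (fun y : E => y - ε • n y) = fun y => y + (-ε) • n y := by ext y; simp [sub_eq_add_neg]
  have hΦ : ContDiffAt ℝ 2 (fun y : E => y - ε • n y) z := by rw [hΦe]; exact hid.add hnn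
  have hnd : DifferentiableAt ℝ n z := hn.differentiable (by norm_num) z
  have d1 : ∀ v, fderiv ℝ (fun y : E => y - ε • n y) z v = v - ε • fderiv ℝ n z v := by
    intro v
    have h : HasFDerivAt (fun y : E => y - ε • n y) (ContinuousLinearMap.id ℝ E - ε • fderiv ℝ n z) z :=
      (hasFDerivAt_id z).sub (hnd.hasFDerivAt.const_smul ε)
    rw [h.fderiv]; rfl
  have d2 : ∀ v w, fderiv ℝ (fderiv ℝ (fun y : E => y - ε • n y)) z v w = -(ε • fderiv ℝ (fderiv ℝ n) z v w) := by
    intro v w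
    rw [hΦe, snd_add hid hnn, snd_smul hn.contDiffAt]
    have := snd_clm (ContinuousLinearMap.id ℝ E) z v w
    simp only [ContinuousLinearMap.id_apply] at this
    rw [this]; simp
  have key : ∀ v, fderiv ℝ (fderiv ℝ (fun y => g (y - ε • n y))) z v v =
      fderiv ℝ (fderiv ℝ g) (z - ε • n z) (v - ε • fderiv ℝ n z v) (v - ε • fderiv ℝ n z v)
        - ε • fderiv ℝ g (z - ε • n z) (fderiv ℝ (fderiv ℝ n) z v v) := by
    intro v
    rw [snd_comp (q := fun y => y - ε • n y) hgC hΦ, d1, d2, map_neg, map_smul]; abel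
  have hIz : fderiv ℝ (fderiv ℝ g) (z - ε • n z) (I • s) (I • s) = -fderiv ℝ (fderiv ℝ g) (z - ε • n z) s s := by
    rw [hg2, hg2]
    simp only [map_smul, ContinuousLinearMap.smul_apply, smul_smul, I_mul_I, neg_one_smul]
  set A := fderiv ℝ (fderiv ℝ g) (z - ε • n z) with hA
  set a := fderiv ℝ n z s with ha
  set a' := fderiv ℝ n z (I • s) with ha'
  set B := fderiv ℝ g (z - ε • n z) with hB
  have total : lv (fun y => g (y - ε • n y)) z s =
      ε • (-(A s a) - A a s - A (I • s) a' - A a' (I • s) + ε • (A a a + A a' a')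
        - B (fderiv ℝ (fderiv ℝ n) z s s) - B (fderiv ℝ (fderiv ℝ n) z (I • s) (I • s))) := by
    rw [lv, key, key]
    simp only [map_sub, map_smul, ContinuousLinearMap.sub_apply, ContinuousLinearMap.smul_apply, hIz, ← ha, ← ha']
    module
  have nI : ‖I • s‖ = ‖s‖ := by simp [norm_smul]
  have ba : ‖a‖ ≤ N1 * ‖s‖ := hN1 z s
  have ba' : ‖a'‖ ≤ N1 * ‖s‖ := by rw [← nI]; exact hN1 z _
  constructor
  · rw [total, norm_smul, Real.norm_of_nonneg hε, mul_assoc]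
    refine mul_le_mul_of_nonneg_left ?_ hε
    have t : ∀ x1 x2 x3 x4 x5 x6 x7 : F, ‖-x1 - x2 - x3 - x4 + x5 - x6 - x7‖ ≤
        ‖x1‖ + ‖x2‖ + ‖x3‖ + ‖x4‖ + ‖x5‖ + ‖x6‖ + ‖x7‖ := by
      intro x1 x2 x3 x4 x5 x6 x7
      have h1 := norm_sub_le (-x1 - x2 - x3 - x4 + x5 - x6) x7
      have h2 := norm_sub_le (-x1 - x2 - x3 - x4 + x5) x6
      have h3 := norm_add_le (-x1 - x2 - x3 - x4) x5
      have h4 := norm_sub_le (-x1 - x2 - x3) x4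
      have h5 := norm_sub_le (-x1 - x2) x3
      have h6 := norm_sub_le (-x1) x2
      have h7 := norm_neg x1
      linarith
    refine (t _ _ _ _ _ _ _).trans ?_
    have hs := norm_nonneg s
    have b1 : ∀ v w, ‖v‖ = ‖s‖ → ‖w‖ ≤ N1 * ‖s‖ → ‖A v w‖ ≤ M2 * N1 * ‖s‖ ^ 2 := by
      intro v w hv hw
      calc ‖A v w‖ ≤ M2 * ‖v‖ * ‖w‖ := hM2 _ hz v w
        _ ≤ M2 * ‖s‖ * (N1 * ‖s‖) := by rw [hv]; gcongr
        _ = _ := by ring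
    have b2 : ∀ v w, ‖v‖ = ‖s‖ → ‖w‖ ≤ N1 * ‖s‖ → ‖A w v‖ ≤ M2 * N1 * ‖s‖ ^ 2 := by
      intro v w hv hw
      calc ‖A w v‖ ≤ M2 * ‖w‖ * ‖v‖ := hM2 _ hz w v
        _ ≤ M2 * (N1 * ‖s‖) * ‖s‖ := by rw [hv]; gcongr
        _ = _ := by ring
    have b3 : ∀ w, ‖w‖ ≤ N1 * ‖s‖ → ‖A w w‖ ≤ M2 * N1 ^ 2 * ‖s‖ ^ 2 := by
      intro w hw
      calc ‖A w w‖ ≤ M2 * ‖w‖ * ‖w‖ := hM2 _ hz w w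
        _ ≤ M2 * (N1 * ‖s‖) * (N1 * ‖s‖) := by gcongr
        _ = _ := by ring
    have b4 : ∀ v, ‖v‖ = ‖s‖ → ‖B (fderiv ℝ (fderiv ℝ n) z v v)‖ ≤ M1 * N2 * ‖s‖ ^ 2 := by
      intro v hv
      calc ‖B (fderiv ℝ (fderiv ℝ n) z v v)‖ ≤ M1 * ‖fderiv ℝ (fderiv ℝ n) z v v‖ := hM1 _ hz _
        _ ≤ M1 * (N2 * ‖v‖ * ‖v‖) := by gcongr; exact hN2 z v v
        _ = _ := by rw [hv]; ring
    have b5 : ‖ε • (A a a + A a' a')‖ ≤ 2 * (M2 * N1 ^ 2 * ‖s‖ ^ 2) := by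
      rw [norm_smul, Real.norm_of_nonneg hε]
      have h1 := (norm_add_le (A a a) (A a' a')).trans (add_le_add (b3 a ba) (b3 a' ba'))
      have h2 := norm_nonneg (A a a + A a' a')
      nlinarith
    have c1 := b1 s a rfl ba
    have c2 := b2 s a rfl ba
    have c3 := b1 (I • s) a' nI ba'
    have c4 := b2 (I • s) a' nI ba'
    have c5 := b4 s rfl
    have c6 := b4 (I • s) nI
    nlinarith
  · intro hzn
    have h0 : n =ᶠ[𝓝 z] fun _ => 0 := notMem_tsupport_iff_eventuallyEq.1 hzn
    have h1 : fderiv ℝ n z = 0 := by rw [h0.fderiv_eq]; simp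
    have h2 : fderiv ℝ (fderiv ℝ n) z = 0 := by rw [h0.fderiv.fderiv_eq]; simp
    have e1 : a = 0 := by rw [ha, h1]; rfl
    have e2 : a' = 0 := by rw [ha', h1]; rfl
    rw [total, e1, e2, h2]; simp

lemma classAm_bounds {D : Set E} (hD : IsOpen D) (hDb : Bornology.IsBounded D) {g : E → F} (hg : ClassAm 2 D g) :
    ∃ M1 M2 : ℝ, 0 ≤ M1 ∧ 0 ≤ M2 ∧ (∀ x ∈ D, ∀ v, ‖fderiv ℝ g x v‖ ≤ M1 * ‖v‖) ∧
      (∀ x ∈ D, ∀ v w, ‖fderiv ℝ (fderiv ℝ g) x v w‖ ≤ M2 * ‖v‖ * ‖w‖) := by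
  have : ProperSpace E := FiniteDimensional.proper ℂ E
  have hc : IsCompact (closure D) := hDb.isCompact_closure
  obtain ⟨G1, hG1, hG1e⟩ := hg.2.2 1 (by norm_num)
  obtain ⟨G2, hG2, hG2e⟩ := hg.2.2 2 le_rfl
  obtain ⟨M1, hM1⟩ := hc.exists_bound_of_continuousOn hG1
  obtain ⟨M2, hM2⟩ := hc.exists_bound_of_continuousOn hG2
  refine ⟨max M1 0, max M2 0, le_max_right _ _, le_max_right _ _, fun x hx v => ?_, fun x hx v w => ?_⟩
  · rw [(holo_snd hD hg.2.1 hx).1]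
    refine ContinuousLinearMap.le_of_opNorm_le _ ?_ v
    have h1 := hM1 x (subset_closure hx)
    rw [hG1e hx, norm_iteratedFDeriv_one] at h1
    exact h1.trans (le_max_left _ _)
  · rw [(holo_snd hD hg.2.1 hx).2]
    have h1 := hM2 x (subset_closure hx)
    rw [hG2e hx] at h1
    have h2 := (iteratedFDeriv ℂ 2 g x).le_of_opNorm_le (h1.trans (le_max_left M2 0)) ![v, w]
    rw [iteratedFDeriv_two_apply] at h2
    simpa [Fin.prod_univ_two, mul_assoc] using h2

lemma field_bounds {n : E → E} (hn : ContDiff ℝ 2 n) (hnc : HasCompactSupport n) :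
    ∃ B N1 N2 : ℝ, 0 ≤ B ∧ 0 ≤ N1 ∧ 0 ≤ N2 ∧ (∀ x, ‖n x‖ ≤ B) ∧ (∀ x v, ‖fderiv ℝ n x v‖ ≤ N1 * ‖v‖) ∧
      (∀ x v w, ‖fderiv ℝ (fderiv ℝ n) x v w‖ ≤ N2 * ‖v‖ * ‖w‖) := by
  obtain ⟨B, hB⟩ := hnc.exists_bound_of_continuous hn.continuous
  have h1 := hnc.fderiv (𝕜 := ℝ)
  have h2 := h1.fderiv (𝕜 := ℝ)
  have c1 : ContDiff ℝ 1 (fderiv ℝ n) := hn.fderiv_right (by norm_num)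
  obtain ⟨N1, hN1⟩ := h1.exists_bound_of_continuous c1.continuous
  obtain ⟨N2, hN2⟩ := h2.exists_bound_of_continuous (c1.continuous_fderiv (by norm_num))
  refine ⟨B, N1, N2, (norm_nonneg _).trans (hB 0), (norm_nonneg _).trans (hN1 0), (norm_nonneg _).trans (hN2 0), hB,
    fun x v => ContinuousLinearMap.le_of_opNorm_le _ (hN1 x) v, fun x v w => ?_⟩
  exact ContinuousLinearMap.le_of_opNorm_le _ (ContinuousLinearMap.le_of_opNorm_le _ (hN2 x) v) w

end SteinAux

set_option linter.unusedSectionVars false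
set_option linter.unusedSimpArgs false

namespace SteinAux

section FIN

variable {X E F : Type*} [NormedAddCommGroup X] [NormedSpace ℂ X] [NormedAddCommGroup E] [InnerProductSpace ℂ E]
  [NormedAddCommGroup F] [InnerProductSpace ℂ F]

lemma contDiff_pq (p : X →L[ℂ] E) : ContDiff ℝ 2 (fun y => p y) := (p.restrictScalars ℝ).contDiff

lemma fin_contDiff {p : X →L[ℂ] E} {q : X →L[ℂ] F} {G : E → F} {r : E → ℝ} {x : X}
    (hG : ContDiffAt ℝ 2 G (p x)) (hr : ContDiffAt ℝ 2 r (p x)) (k e : ℝ) :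
    ContDiffAt ℝ 2 (fun y => ‖q y - G (p y)‖ ^ 2 + k • r (p y) + e • (‖p y‖ ^ 2 + ‖q y‖ ^ 2)) x := by
  have hp : ContDiffAt ℝ 2 (fun y => p y) x := (contDiff_pq p).contDiffAt
  have hq : ContDiffAt ℝ 2 (fun y => q y) x := (contDiff_pq q).contDiffAt
  have hGp : ContDiffAt ℝ 2 (fun y => G (p y)) x := hG.comp x hp
  have hrp : ContDiffAt ℝ 2 (fun y => r (p y)) x := hr.comp x hp
  have h1 : ContDiffAt ℝ 2 (fun y => ‖q y - G (p y)‖ ^ 2) x := (hq.sub hGp).norm_sq ℂ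
  exact (h1.add (hrp.const_smul k)).add (((hp.norm_sq ℂ).add (hq.norm_sq ℂ)).const_smul e)

lemma fin_levi {p : X →L[ℂ] E} {q : X →L[ℂ] F} (hpq : ∀ v, ‖v‖ ^ 2 ≤ ‖p v‖ ^ 2 + ‖q v‖ ^ 2)
    {G : E → F} {r : E → ℝ} {x : X}
    (hG : ContDiffAt ℝ 2 G (p x)) (hr : ContDiffAt ℝ 2 r (p x)) {k e : ℝ} (he : 0 ≤ e)
    (hu : ‖q x - G (p x)‖ ≤ 1) (h : ∀ s, 2 * ‖lv G (p x) s‖ ≤ k * levi r (p x) s) (v : X) :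
    4 * e * ‖v‖ ^ 2 ≤ levi (fun y => ‖q y - G (p y)‖ ^ 2 + k • r (p y) + e • (‖p y‖ ^ 2 + ‖q y‖ ^ 2)) x v := by
  have hp : ContDiffAt ℝ 2 (fun y => p y) x := (contDiff_pq p).contDiffAt
  have hq : ContDiffAt ℝ 2 (fun y => q y) x := (contDiff_pq q).contDiffAt
  have hGp : ContDiffAt ℝ 2 (fun y => G (p y)) x := hG.comp x hp
  have hrp : ContDiffAt ℝ 2 (fun y => r (p y)) x := hr.comp x hp
  have hnG : ContDiffAt ℝ 2 (fun y => (-1 : ℝ) • G (p y)) x := contDiffAt_const.smul hGp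
  have h1 : ContDiffAt ℝ 2 (fun y => ‖q y - G (p y)‖ ^ 2) x := (hq.sub hGp).norm_sq ℂ
  have h2 : ContDiffAt ℝ 2 (fun y => k • r (p y)) x := hrp.const_smul k
  have h3 : ContDiffAt ℝ 2 (fun y => ‖p y‖ ^ 2) x := hp.norm_sq ℂ
  have h4 : ContDiffAt ℝ 2 (fun y => ‖q y‖ ^ 2) x := hq.norm_sq ℂ
  have h34 : ContDiffAt ℝ 2 (fun y => ‖p y‖ ^ 2 + ‖q y‖ ^ 2) x := h3.add h4
  have h5 : ContDiffAt ℝ 2 (fun y => e • (‖p y‖ ^ 2 + ‖q y‖ ^ 2)) x := h34.const_smul e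
  have h12 : ContDiffAt ℝ 2 (fun y => ‖q y - G (p y)‖ ^ 2 + k • r (p y)) x := h1.add h2
  rw [levi_eq_lv, lv_add h12 h5, lv_add h1 h2, lv_smul hrp, lv_smul h34, lv_add h3 h4, lv_normsq_clm, lv_normsq_clm,
    lv_comp_clm p hr]
  have hue : lv (fun y => q y - G (p y)) x v = (-1 : ℝ) • lv G (p x) (p v) := by
    have e1 : (fun y => q y - G (p y)) = fun y => q y + (-1 : ℝ) • G (p y) := by ext y; simp [sub_eq_add_neg]
    rw [e1, lv_add hq hnG, lv_clm, lv_smul hGp, lv_comp_clm p hG, zero_add]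
  have hge := lv_normsq_ge (u := fun y => q y - G (p y)) (hq.sub hGp) v
  rw [hue, norm_smul] at hge
  have hs := h (p v)
  rw [levi_eq_lv] at hs
  have hv := hpq v
  have h0 := norm_nonneg (lv G (p x) (p v))
  simp only [norm_neg, norm_one, one_mul] at hge
  simp only [smul_eq_mul]
  have := mul_le_mul_of_nonneg_left hv he
  have hm := mul_le_mul_of_nonneg_right hu h0
  nlinarith

lemma shift_est {E F : Type*} [NormedAddCommGroup E] [NormedSpace ℂ E] [NormedAddCommGroup F] [NormedSpace ℂ F]
    {D : Set E} (hD : IsOpen D) {g : E → F} (hgc : ContinuousOn g (closure D))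
    (hg : DifferentiableOn ℂ g D) {M1 B : ℝ} (m1 : 0 ≤ M1) (hM1 : ∀ x ∈ D, ∀ v, ‖fderiv ℝ g x v‖ ≤ M1 * ‖v‖)
    {z w : E} (hz : z ∈ closure D) {ε : ℝ} (hε : 0 < ε) (hw : ‖w‖ ≤ B) (ht : ∀ t ∈ Ioc 0 ε, z - t • w ∈ D) :
    ‖g z - g (z - ε • w)‖ ≤ M1 * B * ε := by
  have hγ : Continuous (fun s : ℝ => z - (ε - s) • w) := by fun_prop
  have hmem : ∀ s ∈ Ico 0 ε, z - (ε - s) • w ∈ D := fun s hs => ht _ ⟨by linarith [hs.2], by linarith [hs.1]⟩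
  have hc : ContinuousOn (fun s : ℝ => g (z - (ε - s) • w)) (Icc 0 ε) := by
    refine hgc.comp hγ.continuousOn fun s hs => ?_
    rcases eq_or_lt_of_le hs.2 with h | h
    · subst h; simpa using hz
    · exact subset_closure (hmem s ⟨hs.1, h⟩)
  have hder : ∀ s ∈ Ico 0 ε, HasDerivWithinAt (fun s : ℝ => g (z - (ε - s) • w))
      (fderiv ℝ g (z - (ε - s) • w) w) (Ici s) s := by
    intro s hs
    have h1 : HasFDerivAt g (fderiv ℝ g (z - (ε - s) • w)) (z - (ε - s) • w) :=
      ((hg.differentiableAt (hD.mem_nhds (hmem s hs))).restrictScalars ℝ).hasFDerivAt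
    have h2 : HasDerivAt (fun s : ℝ => z - (ε - s) • w) w s := by
      have := (((hasDerivAt_id s).const_sub ε).smul_const w).const_sub z
      simpa using this
    exact (h1.comp_hasDerivAt s h2).hasDerivWithinAt
  have := norm_image_sub_le_of_norm_deriv_right_le_segment hc hder (C := M1 * B)
    (fun s hs => (hM1 _ (hmem s hs) w).trans (by gcongr)) ε ⟨hε.le, le_rfl⟩
  simpa using this

end FIN

end SteinAux

set_option linter.unusedSectionVars false
set_option linter.unusedSimpArgs false

namespace SteinAux

section FIN2

variable {X E F : Type*} [NormedAddCommGroup X] [NormedSpace ℂ X] [FiniteDimensional ℂ X]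
  [MeasurableSpace X] [BorelSpace X] [NormedAddCommGroup E] [InnerProductSpace ℂ E]
  [FiniteDimensional ℂ E] [MeasurableSpace E] [BorelSpace E]
  [NormedAddCommGroup F] [InnerProductSpace ℂ F] [FiniteDimensional ℂ F]

set_option maxHeartbeats 1000000 in
/-- Final step of the construction: from the geometry of the base to Stein neighborhoods of the graph. -/
lemma fin_main {p : X →L[ℂ] E} {q : X →L[ℂ] F} (hpq : ∀ v, ‖v‖ ^ 2 ≤ ‖p v‖ ^ 2 + ‖q v‖ ^ 2)
    {j : E × F → X} (hj : Continuous j) (hpj : ∀ y, p (j y) = y.1) (hqj : ∀ y, q (j y) = y.2)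
    (hjx : ∀ x, j (p x, q x) = x)
    {D : Set E} (hD : IsOpen D) (hDb : Bornology.IsBounded D) {g : E → F} (hg : ClassAm 2 D g)
    {W : Set E} {r : E → ℝ} {n : E → E} {κ a ε₀ R : ℝ} (hW : IsOpen W) (hDW : closure D ⊆ W)
    (hr : ContDiffOn ℝ 2 r W) (hn : ContDiff ℝ 2 n) (hnc : HasCompactSupport n) (hκ : 0 < κ) (ha : 0 < a)
    (hε₀ : 0 < ε₀) (hr0 : ∀ x ∈ closure D, r x ≤ 0) (hrR : ∀ x, -R ≤ r x)
    (hlev0 : ∀ x ∈ W, ∀ v, 0 ≤ levi r x v)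
    (hlev : ∀ x ∈ W, x ∈ tsupport n → ∀ v, κ * ‖v‖ ^ 2 ≤ levi r x v)
    (hsub : ∀ ε ∈ Ioo 0 ε₀, IsCompact {z ∈ W | r z ≤ a * ε} ∧ ∀ z ∈ W, r z ≤ a * ε → z - ε • n z ∈ D)
    {U : Set X} (hU : IsOpen U) (hAU : {x | p x ∈ closure D ∧ q x = g (p x)} ⊆ U) :
    ∃ Ω : Set X, SteinOpen Ω ∧ {x | p x ∈ closure D ∧ q x = g (p x)} ⊆ Ω ∧ Ω ⊆ U := by
  have : ProperSpace E := FiniteDimensional.proper ℂ E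
  have : ProperSpace F := FiniteDimensional.proper ℂ F
  obtain ⟨M1, M2, m1, m2, hM1, hM2⟩ := classAm_bounds hD hDb hg
  obtain ⟨B, N1, N2, b0, n1, n2, hB, hN1, hN2⟩ := field_bounds hn hnc
  obtain ⟨C2, hC2⟩ : ∃ C2, C2 = M2 * (4 * N1 + 2 * N1 ^ 2) + 2 * M1 * N2 := ⟨_, rfl⟩
  have C20 : 0 ≤ C2 := by rw [hC2]; positivity
  obtain ⟨C1, hC1⟩ : ∃ C1, C1 = (M1 * B) ^ 2 + 1 := ⟨_, rfl⟩
  have C10 : 0 < C1 := by rw [hC1]; positivity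
  obtain ⟨K, hK⟩ : ∃ K, K = 2 * C2 / κ + 4 * C1 / a + 1 := ⟨_, rfl⟩
  have K0 : 0 < K := by rw [hK]; positivity
  have K1 : 2 * C2 ≤ K * κ := by
    have : 2 * C2 = 2 * C2 / κ * κ := by field_simp
    rw [this]; gcongr; rw [hK]; have : 0 ≤ 4 * C1 / a := by positivity
    linarith
  have K2 : 4 * C1 ≤ K * a := by
    have : 4 * C1 = 4 * C1 / a * a := by field_simp
    rw [this]; gcongr; rw [hK]; have : 0 ≤ 2 * C2 / κ := by positivity
    linarith
  -- the graph is compact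
  have hDc : IsCompact (closure D) := hDb.isCompact_closure
  have hjg : ContinuousOn (fun z => j (z, g z)) (closure D) :=
    hj.comp_continuousOn (continuousOn_id.prodMk hg.1)
  have hAeq : {x | p x ∈ closure D ∧ q x = g (p x)} = (fun z => j (z, g z)) '' closure D := by
    ext x; constructor
    · rintro ⟨h1, h2⟩; exact ⟨p x, h1, by simp only [← h2, hjx]⟩
    · rintro ⟨z, hz, rfl⟩; simp only [mem_setOf_eq, hpj, hqj]; exact ⟨hz, trivial⟩
  have hAc : IsCompact {x | p x ∈ closure D ∧ q x = g (p x)} := by rw [hAeq]; exact hDc.image_of_continuousOn hjg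
  obtain ⟨A, hA⟩ : ∃ A, A = {x | p x ∈ closure D ∧ q x = g (p x)} := ⟨_, rfl⟩
  rw [← hA] at hAc hAU ⊢
  obtain ⟨δ, hδ, hδU⟩ := hAc.exists_thickening_subset_open hU hAU
  obtain ⟨S, hS⟩ := hAc.exists_bound_of_continuousOn (f := fun x => ‖p x‖ ^ 2 + ‖q x‖ ^ 2)
    (by fun_prop)
  obtain ⟨S', hS', hS0⟩ : ∃ S', (∀ x ∈ A, ‖p x‖ ^ 2 + ‖q x‖ ^ 2 ≤ S') ∧ 0 ≤ S' :=
    ⟨max S 0, fun x hx => ((le_abs_self _).trans (hS x hx)).trans (le_max_left _ _), le_max_right _ _⟩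
  -- choice of the shift parameter
  have ev1 : ∀ᶠ ε in 𝓝[>] (0 : ℝ), 4 * C1 * ε ^ 2 + K * ε * |R| < 1 / 4 := by
    refine nhdsWithin_le_nhds ?_
    have hc : Continuous fun ε : ℝ => 4 * C1 * ε ^ 2 + K * ε * |R| := by fun_prop
    exact (hc.tendsto 0).eventually_lt_const (by norm_num)
  have ev2 : ∀ᶠ ε in 𝓝[>] (0 : ℝ), (ε * B) ^ 2 + (2 * C1 * ε ^ 2 + K * ε * |R|) < δ ^ 2 := by
    refine nhdsWithin_le_nhds ?_
    have hc : Continuous fun ε : ℝ => (ε * B) ^ 2 + (2 * C1 * ε ^ 2 + K * ε * |R|) := by fun_prop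
    refine (hc.tendsto 0).eventually_lt_const ?_
    simpa using by positivity
  have ev3 : ∀ᶠ ε in 𝓝[>] (0 : ℝ), ε ∈ Ioo 0 (min ε₀ 1) := Ioo_mem_nhdsGT (by positivity)
  obtain ⟨ε, h1, h2, hε, hε3⟩ := (ev1.and (ev2.and ev3)).exists
  have hεε : ε < ε₀ := hε3.trans_le (min_le_left _ _)
  have hε1 : ε ≤ 1 := (hε3.trans_le (min_le_right _ _)).le
  obtain ⟨hZc, hZD⟩ := hsub ε ⟨hε, hεε⟩
  obtain ⟨G, hG⟩ : ∃ G : E → F, G = fun z => g (z - ε • n z) := ⟨_, rfl⟩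
  have hΦ : Continuous fun z => z - ε • n z := continuous_id.sub (hn.continuous.const_smul ε)
  have hGC : ∀ z, z - ε • n z ∈ D → ContDiffAt ℝ 2 G z := by
    intro z hz
    rw [hG]
    have h1 : ContDiffAt ℝ 2 g (z - ε • n z) := (holo_smoothF hD hg.2.1 hz).of_le two_le_inf
    have h2 : ContDiffAt ℝ 2 (fun z => z - ε • n z) z := contDiffAt_id.sub (hn.contDiffAt.const_smul ε)
    exact h1.comp z h2
  obtain ⟨W₀, hW₀⟩ : ∃ W₀ : Set E, W₀ = {z | z ∈ W ∧ z - ε • n z ∈ D} := ⟨_, rfl⟩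
  have hW₀o : IsOpen W₀ := by rw [hW₀]; exact hW.inter (hD.preimage hΦ)
  have hGo : ContinuousOn G W₀ := fun z hz => by
    rw [hW₀] at hz
    exact (hGC z hz.2).continuousAt.continuousWithinAt
  have hpc : Continuous p := p.continuous
  have hqc : Continuous q := q.continuous
  have hP₀ : IsOpen (p ⁻¹' W₀) := hW₀o.preimage hpc
  have huc : ContinuousOn (fun x => ‖q x - G (p x)‖) (p ⁻¹' W₀) :=
    (hqc.continuousOn.sub (hGo.comp hpc.continuousOn fun x hx => hx)).norm
  obtain ⟨W', hW'⟩ : ∃ W' : Set X, W' = p ⁻¹' W₀ ∩ (fun x => ‖q x - G (p x)‖) ⁻¹' Iio 1 := ⟨_, rfl⟩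
  have hW'o : IsOpen W' := by rw [hW']; exact huc.isOpen_inter_preimage hP₀ isOpen_Iio
  have memW' : ∀ x, x ∈ W' ↔ (p x ∈ W ∧ p x - ε • n (p x) ∈ D) ∧ ‖q x - G (p x)‖ < 1 := by
    intro x; rw [hW', hW₀]; rfl
  obtain ⟨e, he⟩ : ∃ e, e = C1 * ε ^ 2 / (S' + 1) := ⟨_, rfl⟩
  have e0 : 0 < e := by rw [he]; positivity
  have eS : e * S' ≤ C1 * ε ^ 2 := by
    rw [he, div_mul_eq_mul_div, div_le_iff₀ (by positivity)]
    have : 0 ≤ C1 * ε ^ 2 := by positivity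
    rw [mul_add]; linarith
  obtain ⟨Ψ, hΨ⟩ : ∃ Ψ : X → ℝ, Ψ = fun y => ‖q y - G (p y)‖ ^ 2 + (K * ε) • r (p y) + e • (‖p y‖ ^ 2 + ‖q y‖ ^ 2) :=
    ⟨_, rfl⟩
  have hrA : ∀ z ∈ W, ContDiffAt ℝ 2 r z := fun z hz => hr.contDiffAt (hW.mem_nhds hz)
  have hΨC : ContDiffOn ℝ 2 Ψ W' := fun x hx => by
    obtain ⟨⟨h1, h2⟩, h3⟩ := (memW' x).1 hx
    rw [hΨ]; exact (fin_contDiff (hGC _ h2) (hrA _ h1) _ _).contDiffWithinAt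
  have hΨl : ∀ x ∈ W', ∀ v, 4 * e * ‖v‖ ^ 2 ≤ levi Ψ x v := fun x hx v => by
    obtain ⟨⟨h1, h2⟩, h3⟩ := (memW' x).1 hx
    rw [hΨ]
    refine fin_levi hpq (hGC _ h2) (hrA _ h1) e0.le h3.le (fun s => ?_) v
    obtain ⟨t1, t2⟩ := lv_shift hD hg.2.1 hn hM1 hM2 hN1 hN2 m1 m2 n1 n2 hε.le hε1 h2 s
    rw [← hG, ← hC2] at t1
    rw [← hG] at t2
    by_cases hx : p x ∈ tsupport n
    · have t3 := hlev _ h1 hx s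
      have t4 : ε * C2 * ‖s‖ ^ 2 * 2 ≤ K * ε * (κ * ‖s‖ ^ 2) := by
        have : 0 ≤ ε * ‖s‖ ^ 2 := by positivity
        have := mul_le_mul_of_nonneg_right K1 this
        linarith
      have t5 := mul_le_mul_of_nonneg_left t3 (by positivity : 0 ≤ K * ε)
      linarith
    · rw [t2 hx, norm_zero, mul_zero]
      exact mul_nonneg (by positivity) (hlev0 _ h1 s)
  -- consequences of a bound on the exhaustion
  have hb : ∀ x c, Ψ x ≤ c → ‖q x - G (p x)‖ ^ 2 ≤ c + K * ε * |R| ∧ K * ε * r (p x) ≤ c := by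
    intro x c hx
    rw [hΨ] at hx
    simp only [smul_eq_mul] at hx
    have t1 : 0 ≤ e * (‖p x‖ ^ 2 + ‖q x‖ ^ 2) := by positivity
    have t2 : -|R| ≤ r (p x) := (neg_le_neg (le_abs_self R)).trans (hrR _)
    have t3 := mul_le_mul_of_nonneg_left t2 (by positivity : 0 ≤ K * ε)
    have t4 : 0 ≤ ‖q x - G (p x)‖ ^ 2 := by positivity
    constructor <;> linarith
  have hcomp : IsCompact {x ∈ W' | Ψ x ≤ 4 * C1 * ε ^ 2} := by
    obtain ⟨Z, hZ⟩ : ∃ Z, Z = {z ∈ W | r z ≤ a * ε} := ⟨_, rfl⟩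
    rw [← hZ] at hZc
    have hZW : Z ⊆ W₀ := by
      rw [hZ, hW₀]; exact fun z hz => ⟨hz.1, hZD z hz.1 hz.2⟩
    have hT : IsCompact ((fun y : E × F => j (y.1, y.2 + G y.1)) '' (Z ×ˢ closedBall 0 (1 / 2))) := by
      refine (hZc.prod (isCompact_closedBall 0 (1 / 2))).image_of_continuousOn ?_
      refine hj.comp_continuousOn (continuousOn_fst.prodMk (continuousOn_snd.add ?_))
      exact (hGo.mono hZW).comp continuousOn_fst fun y hy => hy.1
    obtain ⟨T, hTe⟩ : ∃ T, T = (fun y : E × F => j (y.1, y.2 + G y.1)) '' (Z ×ˢ closedBall 0 (1 / 2)) := ⟨_, rfl⟩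
    rw [← hTe] at hT
    have hTW : T ⊆ W' := by
      rw [hTe]; rintro _ ⟨⟨z, u⟩, ⟨hz, hu⟩, rfl⟩
      rw [memW']
      simp only [hpj, hqj, add_sub_cancel_right]
      have := hZW hz
      rw [hW₀] at this
      simp only [mem_closedBall, dist_zero_right] at hu
      exact ⟨this, by linarith⟩
    have heq : {x ∈ W' | Ψ x ≤ 4 * C1 * ε ^ 2} = T ∩ Ψ ⁻¹' Iic (4 * C1 * ε ^ 2) := by
      ext x; constructor
      · rintro ⟨hx, hx2⟩
        refine ⟨?_, hx2⟩
        obtain ⟨t1, t2⟩ := hb x _ hx2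
        obtain ⟨⟨h3, h4⟩, h5⟩ := (memW' x).1 hx
        rw [hTe]
        refine ⟨(p x, q x - G (p x)), ⟨?_, ?_⟩, by simp [hjx]⟩
        · rw [hZ]; refine ⟨h3, ?_⟩
          have : K * ε * r (p x) ≤ K * ε * (a * ε) := by
            refine t2.trans ?_
            have : 0 ≤ ε ^ 2 := by positivity
            have := mul_le_mul_of_nonneg_right K2 this
            linarith
          exact le_of_mul_le_mul_left this (by positivity)
        · simp only [mem_closedBall, dist_zero_right]
          have : ‖q x - G (p x)‖ ^ 2 ≤ (1 / 2) ^ 2 := by norm_num; linarith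
          exact (pow_le_pow_iff_left₀ (norm_nonneg _) (by norm_num) (by norm_num)).1 this
      · exact fun hx => ⟨hTW hx.1, hx.2⟩
    rw [heq]
    exact hT.of_isClosed_subset
      ((hΨC.continuousOn.mono hTW).preimage_isClosed_of_isClosed hT.isClosed isClosed_Iic) inter_subset_left
  refine ⟨{x ∈ W' | Ψ x < 2 * C1 * ε ^ 2}, stein_sublevel hW'o hΨC (by positivity : 0 < 4 * e) hΨl ?_ hcomp, ?_, ?_⟩
  · have : 0 < C1 * ε ^ 2 := by positivity
    linarith
  · intro x hx
    have hxS := hS' x hx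
    rw [hA] at hx
    obtain ⟨hx1, hx2⟩ := hx
    have hzt : ∀ t ∈ Ioc 0 ε, p x - t • n (p x) ∈ D := fun t ht =>
      (hsub t ⟨ht.1, ht.2.trans_lt hεε⟩).2 _ (hDW hx1) ((hr0 _ hx1).trans (mul_nonneg ha.le ht.1.le))
    have hest := shift_est hD hg.1 hg.2.1 m1 hM1 hx1 hε (hB (p x)) hzt
    have hGe : ‖q x - G (p x)‖ ≤ M1 * B * ε := by rw [hx2, hG]; exact hest
    have hsq : ‖q x - G (p x)‖ ^ 2 ≤ (M1 * B) ^ 2 * ε ^ 2 := by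
      rw [← mul_pow]; gcongr
    have hε2 : 0 < ε ^ 2 := by positivity
    have hlt : (M1 * B) ^ 2 * ε ^ 2 < C1 * ε ^ 2 := by rw [hC1, add_mul]; linarith
    have hKR : 0 ≤ K * ε * |R| := by positivity
    refine ⟨(memW' x).2 ⟨⟨hDW hx1, hzt ε ⟨hε, le_rfl⟩⟩, ?_⟩, ?_⟩
    · by_contra hcon
      push Not at hcon
      have := one_le_pow₀ hcon (n := 2)
      linarith
    · rw [hΨ]; simp only [smul_eq_mul]
      have t1 : K * ε * r (p x) ≤ 0 := mul_nonpos_of_nonneg_of_nonpos (by positivity) (hr0 _ hx1)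
      have t2 := mul_le_mul_of_nonneg_left hxS e0.le
      linarith
  · rintro x ⟨hx, hx2⟩
    obtain ⟨t1, t2⟩ := hb x _ hx2.le
    obtain ⟨⟨h3, h4⟩, h5⟩ := (memW' x).1 hx
    refine hδU (mem_thickening_iff.2 ⟨j (p x - ε • n (p x), G (p x)), ?_, ?_⟩)
    · rw [hA]; simp only [mem_setOf_eq, hpj, hqj]
      exact ⟨subset_closure h4, by rw [hG]⟩
    · rw [dist_eq_norm]
      have h6 := hpq (x - j (p x - ε • n (p x), G (p x)))
      rw [map_sub, map_sub, hpj, hqj] at h6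
      have h7 : ‖p x - (p x - ε • n (p x))‖ ≤ ε * B := by
        rw [sub_sub_cancel, norm_smul, Real.norm_of_nonneg hε.le]
        gcongr; exact hB _
      have h8 : ‖p x - (p x - ε • n (p x))‖ ^ 2 ≤ (ε * B) ^ 2 := by gcongr
      simp only at h6
      refine (pow_lt_pow_iff_left₀ (norm_nonneg _) hδ.le (two_ne_zero)).1 ?_
      linarith

end FIN2

end SteinAux

/-- The graph over `D̄` of a `C²` map, holomorphic in a bounded strongly
pseudoconvex Stein domain `D ⊆ ℂ^m`, has a basis of open Stein neighborhoods
in `ℂ^m × ℂ^k`. -/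
theorem stein_neighborhood_basis_of_graph
    (m k : ℕ) (D : Set (Cn m)) (hDopen : IsOpen D) (hDbdd : Bornology.IsBounded D)
    (hDstein : SteinOpen D) (hDspsc : SPSCBoundary 2 D)
    (g : Cn m → Cn k) (hg : ClassAm 2 D g) :
    ∀ U : Set (Cn m × Cn k), IsOpen U →
      {p : Cn m × Cn k | p.1 ∈ closure D ∧ p.2 = g p.1} ⊆ U →
      ∃ Ω : Set (Cn m × Cn k), SteinOpen Ω ∧
        {p : Cn m × Cn k | p.1 ∈ closure D ∧ p.2 = g p.1} ⊆ Ω ∧ Ω ⊆ U := by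
  intro U hU hAU
  obtain ⟨V, hV, hKV, ρ, hρ, hDV, hd, hlev⟩ := hDspsc
  have hlev' : ∀ x ∈ frontier D, ∀ v : Cn m, v ≠ 0 → fderiv ℝ ρ x v = 0 → fderiv ℝ ρ x (Complex.I • v) = 0 →
      0 < SteinAux.levi ρ x v := by
    intro x hx v hv h1 h2
    have h3 := hlev x hx v hv h1 h2
    rw [LeviForm, iteratedFDeriv_two_apply, iteratedFDeriv_two_apply] at h3
    have h4 : (1 / 4 : ℝ) * SteinAux.levi ρ x v > 0 := h3
    linarith
  letI : MeasurableSpace (Cn m × Cn k) := borel _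
  haveI : BorelSpace (Cn m × Cn k) := ⟨rfl⟩
  obtain ⟨W, r, n, κ, a, ε₀, R, hW, hDW, hr, hn, hnc, hκ, ha, hε₀, hr0, hrR, hl0, hl, hsub⟩ :=
    SteinAux.geomA hDopen hDbdd hV hKV hρ hDV hd hlev'
  refine SteinAux.fin_main (p := ContinuousLinearMap.fst ℂ (Cn m) (Cn k)) (q := ContinuousLinearMap.snd ℂ (Cn m) (Cn k))
    (j := id) ?_ continuous_id (fun _ => rfl) (fun _ => rfl) (fun _ => rfl) hDopen hDbdd hg hW hDW hr hn hnc hκ ha hε₀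
    hr0 hrR hl0 hl hsub hU hAU
  intro v
  simp only [ContinuousLinearMap.coe_fst', ContinuousLinearMap.coe_snd']
  rcases le_total ‖v.1‖ ‖v.2‖ with h | h
  · rw [Prod.norm_def, max_eq_right h]; nlinarith [sq_nonneg ‖v.1‖]
  · rw [Prod.norm_def, max_eq_left h]; nlinarith [sq_nonneg ‖v.2‖]
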